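/- arXiv:2107.11735 — 3 statements merged into one kernel-verified Lean document; each statement's English description precedes it below -/
import Mathlib

section
/- For every fixed z₁ with 0 < z₁ ≤ ẑ, one has lim_{z₂→∞} φ₂(z₁,z₂) = ∞, and there exists a unique ϑ(z₁) ∈ (z₁,∞) such that φ₂(z₁, ϑ(z₁)) = 0. -/
open MeasureTheory

lemma aux_tangent (u : ℝ → ℝ) (hc : StrictConcaveOn ℝ (Set.Ici 0) u) (c d s : ℝ) (hc0 : 0 < c)
    (hd0 : 0 < d) (hs : HasDerivAt u s c) : u d ≤ u c + s * (d - c) := by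
  rcases lt_trichotomy c d with h | h | h
  · have := hc.concaveOn.slope_le_of_hasDerivAt (x := c) (y := d) hc0.le hd0.le h hs
    rw [slope_def_field, div_le_iff₀ (by linarith)] at this
    linarith
  · subst h; simp
  · have := hc.concaveOn.le_slope_of_hasDerivAt (x := d) (y := c) hd0.le hc0.le h hs
    rw [slope_def_field, le_div_iff₀ (by linarith)] at this
    nlinarith

lemma aux_deriv (I U : ℝ → ℝ) (hI : ContinuousOn I (Set.Ioi 0))
    (hU : ∀ a b : ℝ, 0 < a → 0 < b → U b + (b - a) * I b ≤ U a) (y : ℝ) (hy : 0 < y) :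
    HasDerivAt U (-I y) y := by
  rw [hasDerivAt_iff_isLittleO, Asymptotics.isLittleO_iff]
  intro c hc
  have hcont : ContinuousAt I y := hI.continuousAt (Ioi_mem_nhds hy)
  have h1 : ∀ᶠ x in nhds y, |I x - I y| < c := by
    have := Metric.tendsto_nhds.1 hcont c hc
    simpa [Real.dist_eq] using this
  filter_upwards [h1, Ioi_mem_nhds hy] with x hx hx0
  have e1 := hU x y hx0 hy
  have e2 := hU y x hy hx0
  simp only [smul_eq_mul, Real.norm_eq_abs]
  have e3 : |U x - U y - (x - y) * -I y| ≤ |(x - y) * (I x - I y)| := by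
    rw [abs_of_nonneg (by linarith)]
    rw [abs_of_nonpos (by nlinarith)]
    nlinarith
  rw [abs_mul] at e3
  nlinarith [abs_nonneg (x - y)]

lemma aux_core (m : ℝ) (hm : 0 < m) (g : ℝ → ℝ) (hg : StrictMonoOn g (Set.Ioi 0))
    (hgi : ∀ y : ℝ, 0 < y → IntegrableOn (fun η => η ^ m * g η) (Set.Ioo 0 y))
    (e N : ℝ) (he : 0 < e) (hN : 1 ≤ N) (hgN : ∀ η, N < η → e ≤ g η) (K z₁ : ℝ) (hz₁ : 0 < z₁)
    (F : ℝ → ℝ) (hF : ∀ z, 0 < z → F z = (∫ η in Set.Ioo 0 z, η ^ m * g η) + K)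
    (hneg : F z₁ < 0) :
    Filter.Tendsto F Filter.atTop Filter.atTop ∧ ∃! t : ℝ, z₁ < t ∧ F t = 0 := by
  have hii : ∀ a b : ℝ, 0 ≤ a → a ≤ b → 
      IntervalIntegrable (fun η => η ^ m * g η) volume a b := by
    intro a b ha hab
    rw [intervalIntegrable_iff_integrableOn_Ioo_of_le hab]
    rcases hab.eq_or_lt with h | h
    · subst h; simp
    · exact (hgi b (by linarith)).mono_set (Set.Ioo_subset_Ioo_left ha)
  have hF' : ∀ z, 0 < z → F z = (∫ η in (0:ℝ)..z, η ^ m * g η) + K := by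
    intro z hz
    rw [hF z hz, intervalIntegral.integral_of_le hz.le, integral_Ioc_eq_integral_Ioo]
  have hdiff : ∀ a b : ℝ, 0 < a → a ≤ b → F b - F a = ∫ η in a..b, η ^ m * g η := by
    intro a b ha hab
    rw [hF' a ha, hF' b (by linarith), ← intervalIntegral.integral_add_adjacent_intervals
      (hii 0 a le_rfl ha.le) (hii a b ha.le hab)]
    ring
  have htop : Filter.Tendsto F Filter.atTop Filter.atTop := by
    have hlin : Filter.Tendsto (fun z : ℝ => F N + e * (z - N)) Filter.atTop Filter.atTop := by
      apply Filter.tendsto_atTop_add_const_left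
      apply Filter.Tendsto.const_mul_atTop he
      exact Filter.tendsto_atTop_add_const_right _ _ Filter.tendsto_id
    refine Filter.tendsto_atTop_mono' _ ?_ hlin
    filter_upwards [Filter.eventually_ge_atTop N] with z hz
    have h1 := hdiff N z (by linarith) hz
    have h2 : ∫ η in N..z, e ≤ ∫ η in N..z, η ^ m * g η := by
      apply intervalIntegral.integral_mono_on_of_le_Ioo hz (by simp) (hii N z (by linarith) hz)
      intro x hx
      have h3 := hgN x hx.1
      have h4 : 1 ≤ x ^ m := Real.one_le_rpow (by linarith [hx.1]) hm.le
      nlinarith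
    simp at h2
    linarith
  refine ⟨htop, ?_⟩
  have hFc : ContinuousOn F (Set.Ici z₁) := by
    intro x hx
    have hx : z₁ ≤ x := hx
    have h1 : ContinuousOn (fun z => (∫ η in (0:ℝ)..z, η ^ m * g η) + K) (Set.Icc 0 (x+1)) := by
      refine ContinuousOn.add ?_ continuousOn_const
      have := intervalIntegral.continuousOn_primitive_interval' (μ := volume) 
        (hii 0 (x+1) le_rfl (by linarith)) (a := 0) (by simp)
      rwa [Set.uIcc_of_le (by linarith)] at this
    have h2 := h1.continuousAt (x := x) (Icc_mem_nhds (by linarith) (by linarith))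
    refine ContinuousAt.continuousWithinAt (h2.congr ?_)
    filter_upwards [Ioi_mem_nhds (show 0 < x by linarith)] with z hz
    exact (hF' z hz).symm
  have hpos : ∀ a b, 0 < a → a < b → 0 ≤ g a → F a < F b := by
    intro a b ha hab hga
    have : 0 < ∫ η in a..b, η ^ m * g η := by
      apply intervalIntegral.intervalIntegral_pos_of_pos_on (hii a b ha.le hab.le) _ hab
      intro x hx
      have hx0 : 0 < x := ha.trans hx.1
      exact mul_pos (Real.rpow_pos_of_pos hx0 _) (hga.trans_lt (hg ha hx0 hx.1))
    linarith [hdiff a b ha hab.le]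
  have hnegg : ∀ b, z₁ < b → g b < 0 → F b < 0 := by
    intro b hb hgb
    have : ∫ η in z₁..b, η ^ m * g η ≤ ∫ η in z₁..b, 0 := by
      apply intervalIntegral.integral_mono_on_of_le_Ioo hb.le (hii z₁ b hz₁.le hb.le) (by simp)
      intro x hx
      have hx0 : 0 < x := hz₁.trans hx.1
      exact (mul_neg_of_pos_of_neg (Real.rpow_pos_of_pos hx0 _) 
        ((hg hx0 (hz₁.trans hb) hx.2).trans hgb)).le
    simp at this
    linarith [hdiff z₁ b hz₁ hb.le]
  have huniq : ∀ s t, z₁ < s → s < t → F s = 0 → F t = 0 → False := by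
    intro s t hs hst h1 h2
    by_cases hgs : 0 ≤ g s
    · linarith [hpos s t (by linarith) hst hgs]
    · linarith [hnegg s hs (by linarith)]
  obtain ⟨b, hb1, hb2⟩ := ((Filter.eventually_ge_atTop (z₁+1)).and 
    (htop.eventually_ge_atTop 1)).exists
  have hiv := intermediate_value_Icc (show z₁ ≤ b by linarith) 
    (hFc.mono Set.Icc_subset_Ici_self)
  obtain ⟨t, ht, ht0⟩ := hiv (show (0:ℝ) ∈ Set.Icc (F z₁) (F b) from ⟨hneg.le, by linarith⟩)
  have htz : z₁ < t := by
    rcases ht.1.eq_or_lt with h | h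
    · rw [← h] at ht0; linarith
    · exact h
  refine ⟨t, ⟨htz, ht0⟩, ?_⟩
  rintro s ⟨hs, hs0⟩
  rcases lt_trichotomy s t with h | h | h
  · exact (huniq s t hs h hs0 ht0).elim
  · exact h
  · exact (huniq t s htz h ht0 hs0).elim

lemma aux_gint (m : ℝ) (I : ℝ → ℝ) 
    (hint : ∀ y : ℝ, 0 < y → IntegrableOn (fun η => η ^ m * I η) (Set.Ioo 0 y)) (hm : 0 < m)
    (y : ℝ) (hy : 0 < y) : IntegrableOn (fun η => η ^ m * (1 + I η)) (Set.Ioo 0 y) := by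
  have h1 : IntegrableOn (fun η : ℝ => η ^ m) (Set.Ioo 0 y) :=
    (ContinuousOn.integrableOn_Icc (Real.continuous_rpow_const hm.le).continuousOn).mono_set
      Set.Ioo_subset_Icc_self
  refine (h1.add (hint y hy)).congr (Filter.Eventually.of_forall fun x => ?_)
  simp only [Pi.add_apply]; ring

lemma aux_gint2 (m : ℝ) (I g : ℝ → ℝ) (C : ℝ)
    (hint : ∀ y : ℝ, 0 < y → IntegrableOn (fun η => η ^ m * I η) (Set.Ioo 0 y)) (hm : 0 < m)
    (hg : StrictMonoOn g (Set.Ioi 0)) (hgb : ∀ z, 0 < z → |g z| ≤ C * (1 + I z))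
    (y : ℝ) (hy : 0 < y) : IntegrableOn (fun η => η ^ m * g η) (Set.Ioo 0 y) := by
  refine Integrable.mono' ((aux_gint m I hint hm y hy).const_mul C) ?_ ?_
  · refine AEStronglyMeasurable.mul (Real.continuous_rpow_const hm.le).aestronglyMeasurable ?_
    exact (aemeasurable_restrict_of_monotoneOn measurableSet_Ioo
      (hg.monotoneOn.mono Set.Ioo_subset_Ioi_self)).aestronglyMeasurable
  · refine (ae_restrict_iff' measurableSet_Ioo).2 (Filter.Eventually.of_forall fun x hx => ?_)
    have hp := Real.rpow_pos_of_pos hx.1 m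
    rw [Real.norm_eq_abs, abs_mul, abs_of_pos hp]
    nlinarith [hgb x hx.1]

lemma aux_neg (m : ℝ) (hm : 0 < m) (I g h : ℝ → ℝ) (C zS : ℝ) (hC : 0 ≤ C)
    (hI_pos : ∀ y : ℝ, 0 < y → 0 < I y)
    (hI_anti : StrictAntiOn I (Set.Ioi 0))
    (hint : ∀ y : ℝ, 0 < y → IntegrableOn (fun η => η ^ m * I η) (Set.Ioo 0 y))
    (hg : StrictMonoOn g (Set.Ioi 0)) (hgb : ∀ z, 0 < z → |g z| ≤ C * (1 + I z))
    (hhc : ContinuousOn h (Set.Ioi 0))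
    (hhb : ∀ z, 0 < z → |h z| ≤ C * z * (1 + I z))
    (hhd : ∀ z, 0 < z → z ≠ zS → HasDerivAt h (g z + I z) z)
    (z : ℝ) (hz : 0 < z) (hhz : h z ≤ 0) :
    (∫ η in Set.Ioo 0 z, η ^ m * g η) + m * (∫ η in Set.Ioo 0 z, η ^ (m - 1) * h η) < 0 := by
  have i1 := aux_gint2 m I g C hint hm hg hgb z hz
  have iA := aux_gint m I hint hm z hz
  have i2 : IntegrableOn (fun η => η ^ (m - 1) * h η) (Set.Ioo 0 z) := by
    refine Integrable.mono' (iA.const_mul C) ?_ ?_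
    · refine (ContinuousOn.mul ?_ ?_).aestronglyMeasurable measurableSet_Ioo
      · intro x hx
        exact (Real.continuousAt_rpow_const x _ (Or.inl hx.1.ne')).continuousWithinAt
      · exact hhc.mono Set.Ioo_subset_Ioi_self
    · refine (ae_restrict_iff' measurableSet_Ioo).2 (Filter.Eventually.of_forall fun x hx => ?_)
      have hp := Real.rpow_pos_of_pos hx.1 (m-1)
      have hp2 : x ^ m = x ^ (m-1) * x := by
        rw [← Real.rpow_add_one hx.1.ne']; ring_nf
      rw [Real.norm_eq_abs, abs_mul, abs_of_pos hp, hp2]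
      nlinarith [hhb x hx.1]
  have i3 := hint z hz
  have hHc : ContinuousOn (fun η => η ^ m * h η) (Set.Icc 0 z) := by
    intro x hx
    rcases hx.1.eq_or_lt with h0 | h0
    · subst h0
      have hz0 : (0:ℝ) ^ m * h 0 = 0 := by rw [Real.zero_rpow hm.ne']; simp
      have hii : IntervalIntegrable (fun η => η ^ m * (1 + I η)) volume 0 z := by
        rwa [intervalIntegrable_iff_integrableOn_Ioo_of_le hz.le]
      have hA := intervalIntegral.continuousOn_primitive_interval' hii (a := 0) (by simp)
      rw [Set.uIcc_of_le hz.le] at hA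
      have hA0 := hA 0 hx
      unfold ContinuousWithinAt at hA0 ⊢
      simp only [intervalIntegral.integral_same] at hA0
      change Filter.Tendsto _ _ (nhds ((0:ℝ) ^ m * h 0))
      rw [hz0]
      have hA1 := hA0.const_mul (C * (m + 1))
      rw [mul_zero] at hA1
      refine squeeze_zero_norm' ?_ hA1
      filter_upwards [self_mem_nhdsWithin] with y hy
      rcases hy.1.eq_or_lt with hy0 | hy0
      · subst hy0; rw [hz0]; simp
      have hle : ∫ η in (0:ℝ)..y, η ^ m * (1 + I y) ≤ ∫ η in (0:ℝ)..y, η ^ m * (1 + I η) := by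
        apply intervalIntegral.integral_mono_on_of_le_Ioo hy0.le
        · exact ((Real.continuous_rpow_const hm.le).mul continuous_const).intervalIntegrable _ _
        · rw [intervalIntegrable_iff_integrableOn_Ioo_of_le hy0.le]
          exact iA.mono_set (Set.Ioo_subset_Ioo_right hy.2)
        · intro x hx
          have := hI_anti hx.1 (show y ∈ Set.Ioi 0 from hy0) hx.2
          have hp := Real.rpow_pos_of_pos hx.1 m
          nlinarith
      rw [intervalIntegral.integral_mul_const, integral_rpow (Or.inl (by linarith)),
        Real.zero_rpow (by linarith), sub_zero, Real.rpow_add_one hy0.ne'] at hle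
      have hp := Real.rpow_pos_of_pos hy0 m
      rw [Real.norm_eq_abs, abs_mul, abs_of_pos hp]
      calc y ^ m * |h y| ≤ y ^ m * (C * y * (1 + I y)) := by
            gcongr; exact hhb y hy0
        _ = C * (m+1) * (y ^ m * y / (m+1) * (1 + I y)) := by field_simp
        _ ≤ _ := by gcongr
    · refine ContinuousAt.continuousWithinAt ?_
      exact (Real.continuousAt_rpow_const x _ (Or.inl h0.ne')).mul 
        (hhc.continuousAt (Ioi_mem_nhds h0))
  have key := integral_eq_of_hasDerivAt_off_countable_of_le (fun η => η ^ m * h η)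
    (fun η => (η ^ m * g η + m * (η ^ (m-1) * h η)) + η ^ m * I η) hz.le (s := {zS})
    (Set.countable_singleton _) hHc (by
      intro x hx
      have hx0 : 0 < x := hx.1.1
      have d1 := Real.hasDerivAt_rpow_const (x := x) (p := m) (Or.inl hx0.ne')
      exact (d1.mul (hhd x hx0 hx.2)).congr_deriv (by ring)) (by
      rw [intervalIntegrable_iff_integrableOn_Ioo_of_le hz.le]
      exact (i1.add (i2.const_mul m)).add i3)
  have i12 : IntegrableOn (fun η => η ^ m * g η + m * (η ^ (m-1) * h η)) (Set.Ioo 0 z) :=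
    i1.add (i2.const_mul m)
  rw [intervalIntegral.integral_of_le hz.le, integral_Ioc_eq_integral_Ioo,
    integral_add i12 i3, integral_add i1 (i2.const_mul m),
    integral_const_mul] at key
  have hz0 : (0:ℝ) ^ m * h 0 = 0 := by rw [Real.zero_rpow hm.ne']; simp
  have hpos : 0 < ∫ η in Set.Ioo 0 z, η ^ m * I η := by
    rw [← integral_Ioc_eq_integral_Ioo, ← intervalIntegral.integral_of_le hz.le]
    apply intervalIntegral.intervalIntegral_pos_of_pos_on _ _ hz
    · rwa [intervalIntegrable_iff_integrableOn_Ioo_of_le hz.le]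
    · intro x hx
      exact mul_pos (Real.rpow_pos_of_pos hx.1 _) (hI_pos x hx.1)
  have hp := Real.rpow_pos_of_pos hz m
  simp only [hz0] at key
  nlinarith

set_option maxHeartbeats 1000000 in
/-- for every fixed 0 < z₁ ≤ ẑ, lim_{z₂→∞} φ₂(z₁,z₂) = ∞ and there is a unique
ϑ(z₁) ∈ (z₁,∞) with φ₂(z₁,ϑ(z₁)) = 0. -/
theorem stmt_15
    (δ r θ n₁ n₂ : ℝ)
    (hδ : 0 < δ) (hr : 0 < r) (hθ : θ ≠ 0)
    (hn₂0 : n₂ < 0) (hn₁1 : 1 < n₁)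
    (hroot₁ : θ ^ 2 / 2 * n₁ ^ 2 + (δ - r - θ ^ 2 / 2) * n₁ - δ = 0)
    (hroot₂ : θ ^ 2 / 2 * n₂ ^ 2 + (δ - r - θ ^ 2 / 2) * n₂ - δ = 0)
    (u u' I utld : ℝ → ℝ)
    (hu_mono : StrictMonoOn u (Set.Ici 0))
    (hu_conc : StrictConcaveOn ℝ (Set.Ici 0) u)
    (hu_cont : ContinuousOn u (Set.Ici 0))
    (hu_deriv : ∀ c : ℝ, 0 < c → HasDerivAt u (u' c) c)
    (hu'_cont : ContinuousOn u' (Set.Ioi 0))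
    (hu'_top : Filter.Tendsto u' Filter.atTop (nhds 0))
    (hu'_zero : Filter.Tendsto u' (nhdsWithin 0 (Set.Ioi 0)) Filter.atTop)
    (hI_pos : ∀ y : ℝ, 0 < y → 0 < I y)
    (hI_left : ∀ y : ℝ, 0 < y → u' (I y) = y)
    (hI_right : ∀ c : ℝ, 0 < c → I (u' c) = c)
    (hI_anti : StrictAntiOn I (Set.Ioi 0))
    (hI_cont : ContinuousOn I (Set.Ioi 0))
    (hI_zero : Filter.Tendsto I (nhdsWithin 0 (Set.Ioi 0)) Filter.atTop)
    (hI_top : Filter.Tendsto I Filter.atTop (nhds 0))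
    (hutld : ∀ y : ℝ, 0 < y → utld y = u (I y) - y * I y)
    (ε₁ ε₂ κ₁ κ₂ : ℝ)
    (hε₂ : 0 < ε₂) (hε₁₂ : ε₂ < ε₁)
    (hκ₁ : 0 < κ₁) (hκ₁₂ : κ₁ < κ₂) (hκ₂ : κ₂ < 1)
    (z_S : ℝ) (hzS_pos : 0 < z_S)
    (hzS_zero : (1 / z_S) * (utld (z_S / κ₁) - utld (z_S / κ₂) + z_S * (ε₁ - ε₂)) = 0)
    (hzS_uniq : ∀ y : ℝ, 0 < y →
      (1 / y) * (utld (y / κ₁) - utld (y / κ₂) + y * (ε₁ - ε₂)) = 0 → y = z_S)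
    (h : ℝ → ℝ)
    (hh₁ : ∀ z : ℝ, z_S < z → h z = utld (z / κ₁) - utld z + ε₁ * z)
    (hh₂ : ∀ z : ℝ, 0 < z → z ≤ z_S → h z = utld (z / κ₂) - utld z + ε₂ * z)
    (zhat : ℝ) (hzhat_pos : 0 < zhat) (hzhat_zero : h zhat = 0)
    (hzhat_uniq : ∀ z : ℝ, 0 < z → h z = 0 → z = zhat)
    (hI_int : ∀ y : ℝ, 0 < y →
      MeasureTheory.IntegrableOn (fun η => η ^ (-n₂) * I η) (Set.Ioo 0 y) MeasureTheory.volume)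
    (chat ehat : ℝ → ℝ)
    (hchat₁ : ∀ η : ℝ, z_S < η → chat η = (1 / κ₁) * I (η / κ₁))
    (hchat₂ : ∀ η : ℝ, 0 < η → η ≤ z_S → chat η = (1 / κ₂) * I (η / κ₂))
    (hehat₁ : ∀ η : ℝ, z_S < η → ehat η = ε₁)
    (hehat₂ : ∀ η : ℝ, 0 < η → η ≤ z_S → ehat η = ε₂)
    (φ₁ φ₂ : ℝ → ℝ → ℝ)
    (hφ₁ : ∀ z₁ z₂ : ℝ, 0 < z₁ → 0 < z₂ →
      φ₁ z₁ z₂ = (∫ η in Set.Ioi z₂, η ^ (-n₁) * (ehat η - chat η)) -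
        n₁ * ∫ η in Set.Ioi z₁, η ^ (-n₁ - 1) * h η)
    (hφ₂ : ∀ z₁ z₂ : ℝ, 0 < z₁ → 0 < z₂ →
      φ₂ z₁ z₂ = (∫ η in Set.Ioo 0 z₂, η ^ (-n₂) * (ehat η - chat η)) -
        n₂ * ∫ η in Set.Ioo 0 z₁, η ^ (-n₂ - 1) * h η)
    :
    ∀ z₁ : ℝ, 0 < z₁ → z₁ ≤ zhat →
      Filter.Tendsto (fun z₂ => φ₂ z₁ z₂) Filter.atTop Filter.atTop ∧
      ∃! t : ℝ, z₁ < t ∧ φ₂ z₁ t = 0 := by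
  intro z₁ hz₁ hz₁h
  have hκ₂0 : 0 < κ₂ := hκ₁.trans hκ₁₂
  have hκ₁1 : κ₁ < 1 := hκ₁₂.trans hκ₂
  have hU : ∀ a b : ℝ, 0 < a → 0 < b → utld b + (b - a) * I b ≤ utld a := by
    intro a b ha hb
    have := aux_tangent u hu_conc (I a) (I b) _ (hI_pos a ha) (hI_pos b hb) 
      (hu_deriv _ (hI_pos a ha))
    rw [hI_left a ha] at this
    rw [hutld a ha, hutld b hb]
    linarith
  have hUd := aux_deriv I utld hI_cont hU
  have hanti : ∀ a b : ℝ, 0 < a → a < b → I b < I a := fun a b ha hab =>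
    hI_anti ha (ha.trans hab) hab
  -- general facts for a fixed κ
  have gen_gb : ∀ κ ε z : ℝ, κ₁ ≤ κ → κ < 1 → 0 < ε → ε ≤ ε₁ → 0 < z → 
      |ε - (1 / κ) * I (z / κ)| ≤ (ε₁ + 1 / κ₁) * (1 + I z) := by
    intro κ ε z hk hk1 he he1 hz
    have hk0 : 0 < κ := by linarith
    have h1 : z < z / κ := by rw [lt_div_iff₀ hk0]; nlinarith
    have h2 := hanti z (z / κ) hz h1
    have h3 := hI_pos (z / κ) (hz.trans h1)
    have h4 : 1 / κ ≤ 1 / κ₁ := one_div_le_one_div_of_le hκ₁ hk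
    have h5 : 0 < 1 / κ := by positivity
    have h6 : (1 / κ) * I (z / κ) ≤ (1 / κ₁) * I z := by
      apply mul_le_mul h4 h2.le h3.le; positivity
    have h7 := mul_pos h5 h3
    rw [abs_le]
    constructor <;> nlinarith
  have gen_hb : ∀ κ ε z : ℝ, κ₁ ≤ κ → κ < 1 → 0 < ε → ε ≤ ε₁ → 0 < z → 
      |utld (z / κ) - utld z + ε * z| ≤ (ε₁ + 1 / κ₁) * z * (1 + I z) := by
    intro κ ε z hk hk1 he he1 hz
    have hk0 : 0 < κ := by linarith
    have h1 : z < z / κ := by rw [lt_div_iff₀ hk0]; nlinarith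
    have h3 := hI_pos (z / κ) (hz.trans h1)
    have h3' := hI_pos z hz
    have h4 : 1 / κ ≤ 1 / κ₁ := one_div_le_one_div_of_le hκ₁ hk
    have e1 := hU z (z / κ) hz (hz.trans h1)
    have e2 := hU (z / κ) z (hz.trans h1) hz
    have h5 : z / κ ≤ 1 / κ₁ * z := by 
      calc z / κ = 1 / κ * z := by ring
        _ ≤ _ := by gcongr
    have h6 : (z / κ) * I z ≤ (1 / κ₁ * z) * I z := by gcongr
    have h7 : 0 < (z / κ - z) * I (z / κ) := mul_pos (by linarith) h3
    have h8 : 0 < z * I z := mul_pos hz h3'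
    have h9 : ε * z ≤ ε₁ * z := by gcongr
    have h10 : 0 < ε * z := mul_pos he hz
    have h11 : 0 < ε₁ * (z * I z) := mul_pos (by linarith) h8
    have h12 : 0 < 1 / κ₁ * z := by positivity
    rw [abs_le]
    have h13 : (ε₁ + 1 / κ₁) * z * (1 + I z) 
      = ε₁ * z + 1 / κ₁ * z + ε₁ * (z * I z) + (1 / κ₁ * z) * I z := by ring
    have h14 : 0 < (1 / κ₁ * z) * I z := mul_pos h12 h3'
    rw [h13]
    have h15 : (z - z / κ) * I z = z * I z - (z / κ) * I z := by ring
    rw [h15] at e2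
    constructor <;> linarith
  have gen_d : ∀ κ ε z : ℝ, 0 < κ → 0 < z → 
      HasDerivAt (fun z => utld (z / κ) - utld z + ε * z) (ε - (1 / κ) * I (z / κ) + I z) z := by
    intro κ ε z hk hz
    have d1 := (hUd (z / κ) (by positivity)).comp z ((hasDerivAt_id z).div_const κ)
    have d2 := (d1.sub (hUd z hz)).add ((hasDerivAt_id z).const_mul ε)
    exact d2.congr_deriv (by ring)
  -- the jump
  have hjump0 : utld (z_S / κ₁) - utld (z_S / κ₂) + z_S * (ε₁ - ε₂) = 0 := by
    rcases mul_eq_zero.1 hzS_zero with h0 | h0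
    · exact absurd h0 (by positivity)
    · exact h0
  have hlt : z_S / κ₂ < z_S / κ₁ := by gcongr
  have hjump : ε₂ - (1 / κ₂) * I (z_S / κ₂) ≤ ε₁ - (1 / κ₁) * I (z_S / κ₁) := by
    have e1 := hU (z_S / κ₂) (z_S / κ₁) (by positivity) (by positivity)
    have e2 := hanti _ _ (show 0 < z_S / κ₂ by positivity) hlt
    have e3 : z_S * ((1 / κ₁ - 1 / κ₂) * I (z_S / κ₁)) ≤ z_S * (ε₁ - ε₂) := by
      have : z_S * ((1 / κ₁ - 1 / κ₂) * I (z_S / κ₁)) 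
        = (z_S / κ₁ - z_S / κ₂) * I (z_S / κ₁) := by ring
      rw [this]; linarith
    have e4 := le_of_mul_le_mul_left e3 hzS_pos
    have e5 : 1 / κ₂ * I (z_S / κ₁) ≤ 1 / κ₂ * I (z_S / κ₂) := by gcongr
    nlinarith
  have gmono : ∀ κ ε a b : ℝ, 0 < κ → 0 < a → a < b → 
      ε - (1 / κ) * I (a / κ) < ε - (1 / κ) * I (b / κ) := by
    intro κ ε a b hk ha hab
    have := hanti (a / κ) (b / κ) (by positivity) (by gcongr)
    have : (1 / κ) * I (b / κ) < (1 / κ) * I (a / κ) := by gcongr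
    linarith
  have hg1 : ∀ η, z_S < η → ehat η - chat η = ε₁ - (1 / κ₁) * I (η / κ₁) := by
    intro η hη; rw [hehat₁ η hη, hchat₁ η hη]
  have hg2 : ∀ η, 0 < η → η ≤ z_S → ehat η - chat η = ε₂ - (1 / κ₂) * I (η / κ₂) := by
    intro η h0 hη; rw [hehat₂ η h0 hη, hchat₂ η h0 hη]
  have hg : StrictMonoOn (fun η => ehat η - chat η) (Set.Ioi 0) := by
    intro a ha b hb hab
    have ha : 0 < a := ha
    simp only
    rcases le_or_gt b z_S with h1 | h1
    · rw [hg2 a ha (hab.le.trans h1), hg2 b hb h1]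
      exact gmono _ _ _ _ hκ₂0 ha hab
    · rw [hg1 b h1]
      rcases le_or_gt a z_S with h2 | h2
      · rw [hg2 a ha h2]
        have e1 := gmono κ₁ ε₁ z_S b hκ₁ hzS_pos h1
        rcases h2.eq_or_lt with h3 | h3
        · rw [h3]; linarith
        · linarith [gmono κ₂ ε₂ a z_S hκ₂0 ha h3]
      · rw [hg1 a h2]
        exact gmono _ _ _ _ hκ₁ ha hab
  have hgb : ∀ z, 0 < z → |ehat z - chat z| ≤ (ε₁ + 1 / κ₁) * (1 + I z) := by
    intro z hz
    rcases le_or_gt z z_S with h1 | h1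
    · rw [hg2 z hz h1]; exact gen_gb _ _ _ hκ₁₂.le hκ₂ hε₂ hε₁₂.le hz
    · rw [hg1 z h1]; exact gen_gb _ _ _ le_rfl hκ₁1 (by linarith) le_rfl hz
  have hhb : ∀ z, 0 < z → |h z| ≤ (ε₁ + 1 / κ₁) * z * (1 + I z) := by
    intro z hz
    rcases le_or_gt z z_S with h1 | h1
    · rw [hh₂ z hz h1]; exact gen_hb _ _ _ hκ₁₂.le hκ₂ hε₂ hε₁₂.le hz
    · rw [hh₁ z h1]; exact gen_hb _ _ _ le_rfl hκ₁1 (by linarith) le_rfl hz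
  have hhd : ∀ z, 0 < z → z ≠ z_S → HasDerivAt h (ehat z - chat z + I z) z := by
    intro z hz hne
    rcases lt_or_gt_of_ne hne with h1 | h1
    · rw [hg2 z hz h1.le]
      refine (gen_d κ₂ ε₂ z hκ₂0 hz).congr_of_eventuallyEq ?_
      filter_upwards [Ioo_mem_nhds hz h1] with x hx
      exact hh₂ x hx.1 hx.2.le
    · rw [hg1 z h1]
      refine (gen_d κ₁ ε₁ z hκ₁ hz).congr_of_eventuallyEq ?_
      filter_upwards [Ioi_mem_nhds h1] with x hx
      exact hh₁ x hx
  have hhc : ContinuousOn h (Set.Ioi 0) := by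
    intro z hz
    have hz : 0 < z := hz
    refine ContinuousAt.continuousWithinAt ?_
    by_cases hne : z = z_S
    · subst hne
      rw [continuousAt_iff_continuous_left_right]
      constructor
      · refine (gen_d κ₂ ε₂ z hκ₂0 hz).continuousAt.continuousWithinAt.congr_of_eventuallyEq 
          ?_ (hh₂ z hz le_rfl)
        filter_upwards [self_mem_nhdsWithin, mem_nhdsWithin_of_mem_nhds (Ioi_mem_nhds hz)] 
          with x hx hx2
        exact hh₂ x hx2 hx
      · have heq : h z = utld (z / κ₁) - utld z + ε₁ * z := by
          rw [hh₂ z hz le_rfl]; linarith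
        refine (gen_d κ₁ ε₁ z hκ₁ hz).continuousAt.continuousWithinAt.congr_of_eventuallyEq 
          ?_ heq
        filter_upwards [self_mem_nhdsWithin] with x hx
        rcases (show z ≤ x from hx).eq_or_lt with h1 | h1
        · rw [← h1]; exact heq
        · exact hh₁ x h1
    · exact (hhd z hz hne).continuousAt
  -- h ≤ 0 on (0, zhat]
  have hhz : h z₁ ≤ 0 := by
    by_contra hcon
    push Not at hcon
    have hlim : Filter.Tendsto (fun z => I (z / κ₂)) (nhdsWithin 0 (Set.Ioi 0)) Filter.atTop := by
      refine hI_zero.comp ?_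
      refine tendsto_nhdsWithin_iff.2 ⟨?_, ?_⟩
      · have : Filter.Tendsto (fun z : ℝ => z / κ₂) (nhds 0) (nhds (0 / κ₂)) :=
          (continuous_id.div_const κ₂).tendsto 0
        rw [zero_div] at this
        exact this.mono_left nhdsWithin_le_nhds
      · filter_upwards [self_mem_nhdsWithin] with x hx
        exact div_pos hx hκ₂0
    obtain ⟨w, hw1, hw0, hw2⟩ := ((hlim.eventually_ge_atTop (ε₂ / (1 / κ₂ - 1) + 1)).and 
      (Filter.Eventually.and (eventually_mem_nhdsWithin) 
        (mem_nhdsWithin_of_mem_nhds (Iio_mem_nhds (show 0 < min z₁ z_S from lt_min hz₁ hzS_pos))))).exists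
    have hw0 : 0 < w := hw0
    have hw2 : w < min z₁ z_S := hw2
    have hwz := hw2.trans_le (min_le_left _ _)
    have hk : 0 < 1 / κ₂ - 1 := by
      rw [sub_pos, lt_div_iff₀ hκ₂0]; linarith
    have hneg : h w < 0 := by
      rw [hh₂ w hw0 (hw2.le.trans (min_le_right _ _))]
      have e1 := hU w (w / κ₂) hw0 (by positivity)
      have e2 : ε₂ < (1 / κ₂ - 1) * I (w / κ₂) := by
        have : ε₂ / (1 / κ₂ - 1) < I (w / κ₂) := by linarith
        rw [div_lt_iff₀ hk] at this
        linarith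
      have e3 : (w / κ₂ - w) * I (w / κ₂) = w * ((1 / κ₂ - 1) * I (w / κ₂)) := by ring
      nlinarith
    obtain ⟨t, ht, ht0⟩ := intermediate_value_Icc hwz.le 
      (hhc.mono (fun x hx => hw0.trans_le hx.1)) (show (0:ℝ) ∈ Set.Icc (h w) (h z₁) from 
        ⟨hneg.le, hcon.le⟩)
    have := hzhat_uniq t (hw0.trans_le ht.1) ht0
    have h2 : t = z₁ := le_antisymm ht.2 (by linarith)
    rw [h2] at ht0
    linarith
  have hm : 0 < -n₂ := by linarith
  have hneg := aux_neg (-n₂) hm I (fun η => ehat η - chat η) h (ε₁ + 1 / κ₁) z_S 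
    (by have := hε₂.trans hε₁₂; positivity) hI_pos hI_anti hI_int hg hgb hhc hhb hhd z₁ hz₁ hhz
  -- eventual lower bound
  have hlim : Filter.Tendsto (fun z => ε₁ - (1 / κ₁) * I (z / κ₁)) Filter.atTop (nhds ε₁) := by
    have h1 : Filter.Tendsto (fun z : ℝ => I (z / κ₁)) Filter.atTop (nhds 0) :=
      hI_top.comp (Filter.tendsto_id.atTop_div_const hκ₁)
    have := (h1.const_mul (1 / κ₁)).const_sub ε₁
    simpa using this
  obtain ⟨N, hN⟩ := Filter.eventually_atTop.1 
    (hlim.eventually_const_le (show ε₁ / 2 < ε₁ by linarith))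
  refine aux_core (-n₂) hm (fun η => ehat η - chat η) hg 
    (aux_gint2 (-n₂) I _ _ hI_int hm hg hgb) (ε₁ / 2) (max (max 1 N) z_S) (by linarith) 
    (le_max_of_le_left (le_max_left _ _)) ?_ 
    (-n₂ * ∫ η in Set.Ioo 0 z₁, η ^ (-n₂ - 1) * h η) z₁ hz₁ (fun z => φ₂ z₁ z) ?_ ?_
  · intro η hη
    simp only [max_lt_iff] at hη
    rw [hg1 η hη.2]
    exact hN η hη.1.2.le
  · intro z hz
    rw [hφ₂ z₁ z hz₁ hz]; ring
  · rw [hφ₂ z₁ z₁ hz₁ hz₁]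
    linarith
end

section
/- There exists a unique pair (z_R, z_B) with 0 < z_R < ẑ and z_B > z_R such that φ₁(z_R, z_B) = 0 and φ₂(z_R, z_B) = 0. -/
open MeasureTheory

lemma aux_core_s16 (P1 P2 Q1 Q2 : ℝ → ℝ) (z0 zh : ℝ) (hz0 : 0 < z0) (hzh : 0 < zh)
    (Q1c : ContinuousOn Q1 (Set.Ioi 0)) (Q2c : ContinuousOn Q2 (Set.Ioi 0))
    (P1c : ContinuousOn P1 (Set.Ioi 0)) (P2c : ContinuousOn P2 (Set.Ioi 0))
    (Q1a : StrictAntiOn Q1 (Set.Ioc 0 zh)) (Q2a : StrictAntiOn Q2 (Set.Ioc 0 zh))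
    (Q2neg : ∀ a, 0 < a → a ≤ zh → Q2 a < 0)
    (P1a : StrictAntiOn P1 (Set.Ici z0)) (P2m : StrictMonoOn P2 (Set.Ici z0))
    (P2neg : ∀ b, 0 < b → b ≤ z0 → P2 b < 0) (P1pos : ∀ b, z0 ≤ b → 0 < P1 b)
    (P2unb : ∀ M, ∃ b, z0 ≤ b ∧ M ≤ P2 b)
    (d2 : ∀ a, 0 < a → a ≤ zh → P2 a + Q2 a < 0)
    (d1 : ∀ b, zh < b → P1 b + Q1 zh < 0)
    (q1 : ∃ a0, 0 < a0 ∧ a0 < zh ∧ 0 ≤ Q1 a0) :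
    ∃! p : ℝ × ℝ, 0 < p.1 ∧ p.1 < zh ∧ p.1 < p.2 ∧ P1 p.2 + Q1 p.1 = 0 ∧
      P2 p.2 + Q2 p.1 = 0 := by
  have hbig : ∀ a b, 0 < a → a ≤ zh → 0 < b → P2 b + Q2 a = 0 → z0 < b := by
    intro a b ha ha' hb he
    by_contra hc
    have := P2neg b hb (not_lt.1 hc)
    have := Q2neg a ha ha'
    linarith
  have hex : ∀ a, ∃ b, 0 < a → a ≤ zh → z0 ≤ b ∧ P2 b = - Q2 a := by
    intro a
    by_cases ha : 0 < a ∧ a ≤ zh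
    · obtain ⟨b, hb, hM⟩ := P2unb (- Q2 a)
      have h1 := intermediate_value_Icc hb (P2c.mono (fun x hx => lt_of_lt_of_le hz0 hx.1))
      have h2 : - Q2 a ∈ Set.Icc (P2 z0) (P2 b) := by
        refine ⟨?_, hM⟩
        have := P2neg z0 hz0 le_rfl
        have := Q2neg a ha.1 ha.2
        linarith
      obtain ⟨c, hc, hc'⟩ := h1 h2
      exact ⟨c, fun _ _ => ⟨hc.1, hc'⟩⟩
    · exact ⟨0, fun h1 h2 => absurd ⟨h1, h2⟩ ha⟩
  choose Z hZ using hex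
  have hZgt : ∀ a, 0 < a → a ≤ zh → a < Z a := by
    intro a ha ha'
    obtain ⟨h1, h2⟩ := hZ a ha ha'
    by_contra hc
    have hc := not_lt.1 hc
    have h3 : P2 (Z a) ≤ P2 a := P2m.monotoneOn h1 (h1.trans hc) hc
    have := d2 a ha ha'
    linarith
  have hZc : ContinuousOn Z (Set.Ioc 0 zh) := by
    intro a ha
    obtain ⟨h1, h2⟩ := hZ a ha.1 ha.2
    have hq : Filter.Tendsto (fun x => - Q2 x) (nhdsWithin a (Set.Ioc 0 zh)) (nhds (- Q2 a)) :=
      ((Q2c.mono (fun x hx => hx.1)) a ha).neg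
    have hself : ∀ᶠ x in nhdsWithin a (Set.Ioc 0 zh), x ∈ Set.Ioc 0 zh := self_mem_nhdsWithin
    refine tendsto_order.2 ⟨fun c hc => ?_, fun c hc => ?_⟩
    · by_cases hcz : c < z0
      · filter_upwards [hself] with x hx
        exact hcz.trans_le (hZ x hx.1 hx.2).1
      · have hcz := not_lt.1 hcz
        have h3 : P2 c < - Q2 a := h2 ▸ P2m hcz h1 hc
        filter_upwards [hself, (tendsto_order.1 hq).1 _ h3] with x hx hx'
        obtain ⟨h4, h5⟩ := hZ x hx.1 hx.2
        rw [← h5] at hx'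
        exact (P2m.lt_iff_lt hcz h4).1 hx'
    · have hcz : z0 ≤ c := h1.trans hc.le
      have h3 : - Q2 a < P2 c := h2 ▸ P2m h1 hcz hc
      filter_upwards [hself, (tendsto_order.1 hq).2 _ h3] with x hx hx'
      obtain ⟨h4, h5⟩ := hZ x hx.1 hx.2
      rw [← h5] at hx'
      exact (P2m.lt_iff_lt h4 hcz).1 hx'
  obtain ⟨a0, ha0, ha0', hq0⟩ := q1
  have hΦ : ContinuousOn (fun a => P1 (Z a) + Q1 a) (Set.Icc a0 zh) := by
    refine ContinuousOn.add (P1c.comp (hZc.mono ?_) ?_) (Q1c.mono ?_)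
    · exact fun x hx => ⟨ha0.trans_le hx.1, hx.2⟩
    · exact fun x hx => hz0.trans_le (hZ x (ha0.trans_le hx.1) hx.2).1
    · exact fun x hx => ha0.trans_le hx.1
  have hivt := intermediate_value_Icc' ha0'.le hΦ
  have hend := d1 (Z zh) (hZgt zh hzh le_rfl)
  have hstart : 0 < P1 (Z a0) + Q1 a0 := by
    have := P1pos (Z a0) (hZ a0 ha0 ha0'.le).1
    linarith
  obtain ⟨a, ha, hae⟩ := hivt ⟨hend.le, hstart.le⟩
  have hane : a ≠ zh := by
    rintro rfl
    simp only at hae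
    linarith
  have hapos : 0 < a := ha0.trans_le ha.1
  refine ⟨(a, Z a), ⟨hapos, lt_of_le_of_ne ha.2 hane, hZgt a hapos ha.2, hae, ?_⟩, ?_⟩
  · simp only [(hZ a hapos ha.2).2]; ring
  have key : ∀ a1 b1 a2 b2, 0 < a1 → a2 ≤ zh → a1 < b1 → a2 < b2 → P1 b1 + Q1 a1 = 0 →
      P2 b1 + Q2 a1 = 0 → P1 b2 + Q1 a2 = 0 → P2 b2 + Q2 a2 = 0 → ¬ a1 < a2 := by
    intro a1 b1 a2 b2 h1 h2 h3 h4 e1 e2 e3 e4 hlt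
    have m1 : a1 ∈ Set.Ioc 0 zh := ⟨h1, hlt.le.trans h2⟩
    have m2 : a2 ∈ Set.Ioc 0 zh := ⟨h1.trans hlt, h2⟩
    have k1 := hbig a1 b1 m1.1 m1.2 (h1.trans h3) e2
    have k2 := hbig a2 b2 m2.1 m2.2 (m2.1.trans h4) e4
    have l1 := Q1a m1 m2 hlt
    have l2 := Q2a m1 m2 hlt
    have l3 : P2 b1 < P2 b2 := by linarith
    have l4 := (P2m.lt_iff_lt k1.le k2.le).1 l3
    have l5 := P1a k1.le k2.le l4
    linarith
  rintro ⟨a', b'⟩ ⟨h1, h2, h3, h4, h5⟩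
  simp only at h1 h2 h3 h4 h5
  have e2 : P2 (Z a) + Q2 a = 0 := by simp only [(hZ a hapos ha.2).2]; ring
  have n1 := key a' b' a (Z a) h1 ha.2 h3 (hZgt a hapos ha.2) h4 h5 hae e2
  have n2 := key a (Z a) a' b' hapos h2.le (hZgt a hapos ha.2) h3 hae e2 h4 h5
  have : a' = a := le_antisymm (not_lt.1 n2) (not_lt.1 n1)
  subst this
  have k1 := hbig a' b' h1 h2.le (h1.trans h3) h5
  have k2 := (hZ a' h1 h2.le)
  have : b' = Z a' := P2m.injOn k1.le k2.1 (by linarith [k2.2])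
  rw [this]

lemma aux_tail_split (F : ℝ → ℝ) (hF : ∀ c, 0 < c → IntegrableOn F (Set.Ioi c)) (a b : ℝ)
    (ha : 0 < a) (hb : 0 < b) :
    (∫ x in Set.Ioi a, F x) = (∫ x in a..b, F x) + ∫ x in Set.Ioi b, F x := by
  have := intervalIntegral.integral_Ioi_sub_Ioi' (hF a ha) (hF b hb)
  linarith

lemma aux_ii (F : ℝ → ℝ) (hF : ∀ c, 0 < c → IntegrableOn F (Set.Ioi c)) (a b : ℝ)
    (ha : 0 < a) (hb : 0 < b) : IntervalIntegrable F volume a b := by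
  rw [intervalIntegrable_iff]
  exact (hF (min a b) (lt_min ha hb)).mono_set (fun x hx => hx.1)

lemma aux_iih (F : ℝ → ℝ) (hF : ∀ c, 0 < c → IntegrableOn F (Set.Ioo 0 c)) (a b : ℝ)
    (ha : 0 ≤ a) (hb : 0 ≤ b) : IntervalIntegrable F volume a b := by
  rw [intervalIntegrable_iff]
  exact (hF (max a b + 1) (by positivity)).mono_set (fun x hx =>
    ⟨lt_of_le_of_lt (le_min ha hb) hx.1, lt_of_le_of_lt hx.2 (lt_add_one _)⟩)

lemma aux_head_eq (F : ℝ → ℝ) (b : ℝ) (hb : 0 ≤ b) :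
    (∫ x in Set.Ioo 0 b, F x) = ∫ x in (0:ℝ)..b, F x := by
  rw [intervalIntegral.integral_of_le hb, integral_Ioc_eq_integral_Ioo]

lemma aux_head_split (F : ℝ → ℝ) (hF : ∀ c, 0 < c → IntegrableOn F (Set.Ioo 0 c)) (a b : ℝ)
    (ha : 0 < a) (hb : 0 < b) :
    (∫ x in Set.Ioo 0 b, F x) = (∫ x in Set.Ioo 0 a, F x) + ∫ x in a..b, F x := by
  rw [aux_head_eq F b hb.le, aux_head_eq F a ha.le]
  exact (intervalIntegral.integral_add_adjacent_intervals (aux_iih F hF 0 a le_rfl ha.le)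
    (aux_iih F hF a b ha.le hb.le)).symm

lemma aux_cont (F G : ℝ → ℝ) (s : ℝ) (hF : ∀ a b, 0 < a → 0 < b → IntervalIntegrable F volume a b)
    (hG : ∀ a b, 0 < a → 0 < b → G b = G a + s * ∫ x in a..b, F x) :
    ContinuousOn G (Set.Ioi 0) := by
  intro x hx
  have hx : 0 < x := hx
  have h1 := intervalIntegral.continuousOn_primitive_interval' (hF (x/2) (2*x) (by positivity)
    (by positivity)) (a := x) (by rw [Set.uIcc_of_le (by linarith)]; constructor <;> linarith)
  have h2 : Set.uIcc (x/2) (2*x) ∈ nhds x := by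
    rw [Set.uIcc_of_le (by linarith)]
    exact Icc_mem_nhds (by linarith) (by linarith)
  have h3 : ContinuousAt (fun b => G x + s * ∫ t in x..b, F t) x :=
    ((h1.continuousAt h2).const_mul s).const_add (G x)
  refine ContinuousAt.continuousWithinAt (h3.congr ?_)
  filter_upwards [lt_mem_nhds hx] with b hb
  exact (hG x b hx hb).symm

lemma aux_head_zero (F : ℝ → ℝ) (hF : ∀ c, 0 < c → IntegrableOn F (Set.Ioo 0 c)) :
    Filter.Tendsto (fun b => ∫ x in Set.Ioo 0 b, F x) (nhdsWithin 0 (Set.Ioi 0)) (nhds 0) := by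
  have h1 := intervalIntegral.continuousOn_primitive_interval' (aux_iih F hF 0 1 le_rfl zero_le_one)
    (a := 0) (by simp)
  have h2 := h1 0 (by simp)
  rw [ContinuousWithinAt, intervalIntegral.integral_same, Set.uIcc_of_le zero_le_one] at h2
  have h3 : nhdsWithin (0:ℝ) (Set.Ioi 0) ≤ nhdsWithin 0 (Set.Icc 0 1) := by
    rw [← nhdsWithin_Ioc_eq_nhdsGT (zero_lt_one)]
    exact nhdsWithin_mono _ Set.Ioc_subset_Icc_self
  refine (h2.mono_left h3).congr' ?_
  filter_upwards [self_mem_nhdsWithin] with b hb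
  exact (aux_head_eq F b (le_of_lt hb)).symm

lemma aux_dom (F E : ℝ → ℝ) (s : Set ℝ) (hs : MeasurableSet s) (hs0 : s ⊆ Set.Ioi 0)
    (hm : AEStronglyMeasurable F (volume.restrict (Set.Ioi 0)))
    (hb : ∀ x, 0 < x → |F x| ≤ E x) (hE : IntegrableOn E s) : IntegrableOn F s := by
  refine Integrable.mono' hE (hm.mono_measure (Measure.restrict_mono hs0 le_rfl)) ?_
  rw [ae_restrict_iff' hs]
  exact Filter.Eventually.of_forall (fun x hx => hb x (hs0 hx))

lemma aux_pow_meas (n : ℝ) :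
    ContinuousOn (fun x : ℝ => x ^ n) (Set.Ioi 0) :=
  fun x hx => (Real.continuousAt_rpow_const x n (Or.inl (ne_of_gt hx))).continuousWithinAt

lemma aux_ibp (h g I : ℝ → ℝ) (zS n a b : ℝ) (ha : 0 < a) (hb : 0 < b)
    (hhc : ContinuousOn h (Set.Ioi 0))
    (hder : ∀ x, 0 < x → x ≠ zS → HasDerivAt h (g x + I x) x)
    (hii : IntervalIntegrable (fun x => x ^ (-n) * g x + (- n) * (x ^ (-n-1) * h x) + x ^ (-n) * I x)
      volume a b) :
    (∫ x in a..b, (x ^ (-n) * g x + (- n) * (x ^ (-n-1) * h x) + x ^ (-n) * I x)) =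
      b ^ (-n) * h b - a ^ (-n) * h a := by
  have hsub : Set.uIcc a b ⊆ Set.Ioi 0 := fun x hx => lt_of_lt_of_le (lt_min ha hb) hx.1
  refine MeasureTheory.integral_eq_of_hasDerivAt_off_countable (fun x => x ^ (-n) * h x) _
    (Set.countable_singleton zS) ?_ ?_ hii
  · exact ((aux_pow_meas (-n)).mul hhc).mono hsub
  · intro x hx
    have hx0 : 0 < x := lt_trans (lt_min ha hb) hx.1.1
    have h1 := hder x hx0 hx.2
    have h2 := Real.hasDerivAt_rpow_const (x := x) (p := -n) (Or.inl hx0.ne')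
    refine (h2.mul h1).congr_deriv ?_
    ring

lemma aux_analysis (I g h : ℝ → ℝ) (A B zS zh n₁ n₂ : ℝ) (hA : 0 < A) (hB : 0 < B)
    (hn₂ : n₂ < 0) (hn₁ : 1 < n₁)
    (hIpos : ∀ y, 0 < y → 0 < I y) (hIanti : StrictAntiOn I (Set.Ioi 0))
    (hIc : ContinuousOn I (Set.Ioi 0))
    (hg : StrictMonoOn g (Set.Ioi 0)) (hgb : ∀ x, 0 < x → |g x| ≤ A + B * I x)
    (hhc : ContinuousOn h (Set.Ioi 0)) (hhb : ∀ x, 0 < x → |h x| ≤ x * (A + B * I x))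
    (hder : ∀ x, 0 < x → x ≠ zS → HasDerivAt h (g x + I x) x)
    (hk : StrictMonoOn (fun z => h z / z) (Set.Ioi 0))
    (hzh : 0 < zh) (hzh0 : h zh = 0)
    (hg0 : ∃ x, 0 < x ∧ g x ≤ 0) (hg1 : ∃ x, 0 < x ∧ 0 < g x)
    (hI_int : ∀ y : ℝ, 0 < y → IntegrableOn (fun η => η ^ (-n₂) * I η) (Set.Ioo 0 y) volume) :
    ∃! p : ℝ × ℝ, 0 < p.1 ∧ p.1 < zh ∧ p.1 < p.2 ∧
      ((∫ η in Set.Ioi p.2, η ^ (-n₁) * g η) +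
        (- n₁ * ∫ η in Set.Ioi p.1, η ^ (-n₁ - 1) * h η)) = 0 ∧
      ((∫ η in Set.Ioo 0 p.2, η ^ (-n₂) * g η) +
        (- n₂ * ∫ η in Set.Ioo 0 p.1, η ^ (-n₂ - 1) * h η)) = 0 := by
  -- signs of h
  have hneg : ∀ z, 0 < z → z < zh → h z < 0 := by
    intro z hz hlt
    have := hk (Set.mem_Ioi.2 hz) (Set.mem_Ioi.2 hzh) hlt
    simp only [hzh0, zero_div] at this
    by_contra hc
    have := div_nonneg (not_lt.1 hc) hz.le
    linarith
  have hpos : ∀ z, zh < z → 0 < h z := by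
    intro z hlt
    have := hk (Set.mem_Ioi.2 hzh) (Set.mem_Ioi.2 (hzh.trans hlt)) hlt
    simp only [hzh0, zero_div] at this
    rwa [div_pos_iff_of_pos_right (hzh.trans hlt)] at this
  -- z0
  obtain ⟨z0, hz0, gneg, gpos⟩ : ∃ z0, 0 < z0 ∧ (∀ x, 0 < x → x < z0 → g x < 0) ∧
      (∀ x, z0 < x → 0 < g x) := by
    obtain ⟨x0, hx0, hgx0⟩ := hg0
    obtain ⟨x1, hx1, hgx1⟩ := hg1
    set S : Set ℝ := {x | 0 < x ∧ 0 < g x} with hS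
    have hlb : ∀ x ∈ S, x0 ≤ x := by
      intro x hx
      by_contra hc
      have := hg (Set.mem_Ioi.2 hx.1) (Set.mem_Ioi.2 hx0) (not_le.1 hc)
      linarith [hx.2]
    have hne : S.Nonempty := ⟨x1, hx1, hgx1⟩
    have hbd : BddBelow S := ⟨x0, hlb⟩
    have hge : x0 ≤ sInf S := le_csInf hne hlb
    refine ⟨sInf S, by linarith, ?_, ?_⟩
    · intro x hx hlt
      have h1 := hg (Set.mem_Ioi.2 hx) (b := (x + sInf S)/2) (Set.mem_Ioi.2 (by linarith)) (by linarith)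
      have h2 : ¬ 0 < g ((x + sInf S)/2) := by
        intro hc
        have := csInf_le hbd (show (x + sInf S)/2 ∈ S from ⟨by linarith, hc⟩)
        linarith
      linarith
    · intro x hlt
      obtain ⟨y, hy, hyx⟩ := exists_lt_of_csInf_lt hne hlt
      exact hy.2.trans (hg (Set.mem_Ioi.2 hy.1) (Set.mem_Ioi.2 (hy.1.trans hyx)) hyx)
  -- measurability
  have mp : ∀ n : ℝ, AEStronglyMeasurable (fun x : ℝ => x ^ n) (volume.restrict (Set.Ioi 0)) :=
    fun n => (aux_pow_meas n).aestronglyMeasurable measurableSet_Ioi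
  have mg : AEStronglyMeasurable g (volume.restrict (Set.Ioi 0)) :=
    (aemeasurable_restrict_of_monotoneOn measurableSet_Ioi hg.monotoneOn).aestronglyMeasurable
  have mh : AEStronglyMeasurable h (volume.restrict (Set.Ioi 0)) :=
    hhc.aestronglyMeasurable measurableSet_Ioi
  have mI : AEStronglyMeasurable I (volume.restrict (Set.Ioi 0)) :=
    hIc.aestronglyMeasurable measurableSet_Ioi
  have bg : ∀ n x : ℝ, 0 < x → |x ^ (-n) * g x| ≤ x ^ (-n) * (A + B * I x) := by
    intro n x hx
    rw [abs_mul, abs_of_pos (Real.rpow_pos_of_pos hx _)]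
    exact mul_le_mul_of_nonneg_left (hgb x hx) (Real.rpow_nonneg hx.le _)
  have bh : ∀ n x : ℝ, 0 < x → |x ^ (-n-1) * h x| ≤ x ^ (-n) * (A + B * I x) := by
    intro n x hx
    rw [abs_mul, abs_of_pos (Real.rpow_pos_of_pos hx _)]
    refine (mul_le_mul_of_nonneg_left (hhb x hx) (Real.rpow_nonneg hx.le _)).trans_eq ?_
    rw [Real.rpow_sub_one hx.ne']
    field_simp
  have tI : ∀ c, 0 < c → IntegrableOn (fun x => x ^ (-n₁) * I x) (Set.Ioi c) := by
    intro c hc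
    have h0 := (integrableOn_Ioi_rpow_of_lt (show -n₁ < -1 by linarith) hc).mul_const (I c)
    refine Integrable.mono' h0 (((mp _).mul mI).mono_measure
      (Measure.restrict_mono (fun x hx => hc.trans hx) le_rfl)) ?_
    rw [ae_restrict_iff' measurableSet_Ioi]
    refine Filter.Eventually.of_forall (fun x hx => ?_)
    have hx0 : 0 < x := hc.trans hx
    have h1 := hIpos x hx0
    have h2 : 0 < x ^ (-n₁) := Real.rpow_pos_of_pos hx0 _
    rw [Real.norm_of_nonneg (by positivity)]
    exact mul_le_mul_of_nonneg_left (hIanti (Set.mem_Ioi.2 hc) (Set.mem_Ioi.2 hx0) hx).le h2.le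
  have tE : ∀ c, 0 < c → IntegrableOn (fun x => x ^ (-n₁) * (A + B * I x)) (Set.Ioi c) := by
    intro c hc
    have h0 := ((integrableOn_Ioi_rpow_of_lt (show -n₁ < -1 by linarith) hc).mul_const A).add
      ((tI c hc).mul_const B)
    refine h0.congr (Filter.Eventually.of_forall (fun x => ?_))
    simp only [Pi.add_apply]; ring
  have pint : ∀ c, 0 < c → IntegrableOn (fun x : ℝ => x ^ (-n₂)) (Set.Ioo 0 c) := by
    intro c hc
    exact (intervalIntegral.intervalIntegrable_rpow' (a := 0) (b := c)
      (show -1 < -n₂ by linarith)).1.mono_set Set.Ioo_subset_Ioc_self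
  have sE : ∀ c, 0 < c → IntegrableOn (fun x => x ^ (-n₂) * (A + B * I x)) (Set.Ioo 0 c) := by
    intro c hc
    have h0 := ((pint c hc).mul_const A).add ((hI_int c hc).mul_const B)
    refine h0.congr (Filter.Eventually.of_forall (fun x => ?_))
    simp only [Pi.add_apply]; ring
  have tg : ∀ c, 0 < c → IntegrableOn (fun x => x ^ (-n₁) * g x) (Set.Ioi c) := fun c hc =>
    aux_dom _ _ _ measurableSet_Ioi (fun x hx => hc.trans hx) ((mp _).mul mg) (bg n₁) (tE c hc)
  have th : ∀ c, 0 < c → IntegrableOn (fun x => x ^ (-n₁-1) * h x) (Set.Ioi c) := fun c hc =>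
    aux_dom _ _ _ measurableSet_Ioi (fun x hx => hc.trans hx) ((mp _).mul mh) (bh n₁) (tE c hc)
  have sg : ∀ c, 0 < c → IntegrableOn (fun x => x ^ (-n₂) * g x) (Set.Ioo 0 c) := fun c hc =>
    aux_dom _ _ _ measurableSet_Ioo (fun x hx => hx.1) ((mp _).mul mg) (bg n₂) (sE c hc)
  have sh : ∀ c, 0 < c → IntegrableOn (fun x => x ^ (-n₂-1) * h x) (Set.Ioo 0 c) := fun c hc =>
    aux_dom _ _ _ measurableSet_Ioo (fun x hx => hx.1) ((mp _).mul mh) (bh n₂) (sE c hc)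
  have itg := aux_ii _ tg
  have ith := aux_ii _ th
  have isg := aux_iih _ sg
  have ish := aux_iih _ sh
  have ptg := aux_tail_split _ tg
  have pth := aux_tail_split _ th
  have psg := aux_head_split _ sg
  have psh := aux_head_split _ sh
  have rp : ∀ n x : ℝ, 0 < x → 0 < x ^ n := fun n x hx => Real.rpow_pos_of_pos hx n
  have P2m : ∀ a b, z0 ≤ a → a < b → 0 < ∫ x in a..b, x ^ (-n₂) * g x := by
    intro a b ha hab
    refine intervalIntegral.intervalIntegral_pos_of_pos_on (isg a b (by linarith) (by linarith)) ?_ hab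
    intro x hx
    exact mul_pos (rp _ _ (by linarith [hx.1])) (gpos x (by linarith [hx.1]))
  have P1m : ∀ a b, z0 ≤ a → a < b → 0 < ∫ x in a..b, x ^ (-n₁) * g x := by
    intro a b ha hab
    refine intervalIntegral.intervalIntegral_pos_of_pos_on (itg a b (by linarith) (by linarith)) ?_ hab
    intro x hx
    exact mul_pos (rp _ _ (by linarith [hx.1])) (gpos x (by linarith [hx.1]))
  have Q1m : ∀ a b, 0 < a → a < b → b ≤ zh → 0 < ∫ x in a..b, -(x ^ (-n₁-1) * h x) := by
    intro a b ha hab hb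
    refine intervalIntegral.intervalIntegral_pos_of_pos_on (ith a b (by linarith) (by linarith)).neg ?_ hab
    intro x hx
    have := mul_pos (rp (-n₁-1) x (by linarith [hx.1])) (neg_pos.2 (hneg x (by linarith [hx.1]) (by linarith [hx.2])))
    linarith
  have Q2m : ∀ a b, 0 ≤ a → a < b → b ≤ zh → 0 < ∫ x in a..b, -(x ^ (-n₂-1) * h x) := by
    intro a b ha hab hb
    refine intervalIntegral.intervalIntegral_pos_of_pos_on (ish a b (by linarith) (by linarith)).neg ?_ hab
    intro x hx
    have := mul_pos (rp (-n₂-1) x (by linarith [hx.1])) (neg_pos.2 (hneg x (by linarith [hx.1]) (by linarith [hx.2])))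
    linarith
  simp only [intervalIntegral.integral_neg] at Q1m Q2m
  refine aux_core_s16 (fun b => ∫ η in Set.Ioi b, η ^ (-n₁) * g η)
    (fun b => ∫ η in Set.Ioo 0 b, η ^ (-n₂) * g η)
    (fun a => - n₁ * ∫ η in Set.Ioi a, η ^ (-n₁ - 1) * h η)
    (fun a => - n₂ * ∫ η in Set.Ioo 0 a, η ^ (-n₂ - 1) * h η) z0 zh hz0 hzh
    ?_ ?_ ?_ ?_ ?_ ?_ ?_ ?_ ?_ ?_ ?_ ?_ ?_ ?_ ?_
  · refine aux_cont _ _ n₁ ith (fun a b ha hb => ?_)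
    simp only [pth a b ha hb]; ring
  · refine aux_cont _ _ (-n₂) (fun a b ha hb => ish a b ha.le hb.le) (fun a b ha hb => ?_)
    simp only [psh a b ha hb]; ring
  · refine aux_cont _ _ (-1) itg (fun a b ha hb => ?_)
    simp only [ptg a b ha hb]; ring
  · refine aux_cont _ _ 1 (fun a b ha hb => isg a b ha.le hb.le) (fun a b ha hb => ?_)
    simp only [psg a b ha hb]; ring
  · intro a ha b hb hab
    have h1 := Q1m a b ha.1 hab hb.2
    simp only [pth a b ha.1 hb.1]
    nlinarith
  · intro a ha b hb hab
    have h1 := Q2m a b ha.1.le hab hb.2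
    simp only [psh a b ha.1 hb.1]
    nlinarith
  · intro a ha ha'
    have h1 := Q2m 0 a le_rfl ha ha'
    simp only [aux_head_eq _ a ha.le]
    nlinarith
  · intro a ha b hb hab
    have h1 := P1m a b ha hab
    simp only [ptg a b (hz0.trans_le ha) (hz0.trans_le hb)]
    linarith
  · intro a ha b hb hab
    have h1 := P2m a b ha hab
    simp only [psg a b (hz0.trans_le ha) (hz0.trans_le hb)]
    linarith
  · intro b hb hb'
    simp only [aux_head_eq _ b hb.le]
    have : 0 < ∫ x in (0:ℝ)..b, -(x ^ (-n₂) * g x) := by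
      refine intervalIntegral.intervalIntegral_pos_of_pos_on (isg 0 b le_rfl hb.le).neg ?_ hb
      intro x hx
      have := mul_pos (rp (-n₂) x hx.1) (neg_pos.2 (gneg x hx.1 (by linarith [hx.2])))
      linarith
    rw [intervalIntegral.integral_neg] at this
    linarith
  · intro b hb
    have h1 := P1m b (b+1) hb (by linarith)
    have hb0 : 0 < b := by linarith
    simp only [ptg b (b+1) hb0 (by linarith)]
    have : 0 ≤ ∫ η in Set.Ioi (b+1), η ^ (-n₁) * g η := by
      refine setIntegral_nonneg measurableSet_Ioi (fun x hx => ?_)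
      have hx : b + 1 < x := hx
      exact (mul_pos (rp _ _ (by linarith)) (gpos x (by linarith))).le
    linarith
  · -- unbounded
    intro M
    set b0 := z0 + 1 with hb0
    have hgb0 : 0 < g b0 := gpos b0 (by linarith)
    set P := ∫ η in Set.Ioo 0 b0, η ^ (-n₂) * g η with hP
    set L := |M - P| / g b0 with hL
    have hL0 : 0 ≤ L := by positivity
    refine ⟨b0 + L, by linarith, ?_⟩
    simp only [psg b0 (b0 + L) (by linarith) (by linarith)]
    have h1 : (∫ x in b0..(b0+L), g b0) ≤ ∫ x in b0..(b0+L), x ^ (-n₂) * g x := by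
      refine intervalIntegral.integral_mono_on (by linarith) (by simp) (isg _ _ (by linarith) (by linarith)) ?_
      intro x hx
      have h2 : g b0 ≤ g x := hg.monotoneOn (Set.mem_Ioi.2 (by linarith)) (Set.mem_Ioi.2 (by linarith [hx.1])) hx.1
      have h3 : 1 ≤ x ^ (-n₂) := Real.one_le_rpow (by linarith [hx.1]) (by linarith)
      nlinarith
    simp only [intervalIntegral.integral_const, smul_eq_mul] at h1
    have h2 : (b0 + L - b0) * g b0 = |M - P| := by rw [hL]; field_simp; ring
    rw [h2] at h1
    have := le_abs_self (M - P)
    linarith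
  · -- d2
    intro a ha ha'
    have sD : ∀ c, 0 < c → IntegrableOn (fun x => x ^ (-n₂) * g x + (- n₂) * (x ^ (-n₂-1) * h x) + x ^ (-n₂) * I x) (Set.Ioo 0 c) :=
      fun c hc => ((sg c hc).add ((sh c hc).const_mul (-n₂))).add (hI_int c hc)
    have e1 : (∫ x in Set.Ioo 0 a, (x ^ (-n₂) * g x + (- n₂) * (x ^ (-n₂-1) * h x) + x ^ (-n₂) * I x)) =
        ((∫ η in Set.Ioo 0 a, η ^ (-n₂) * g η) + - n₂ * ∫ η in Set.Ioo 0 a, η ^ (-n₂ - 1) * h η)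
         + ∫ η in Set.Ioo 0 a, η ^ (-n₂) * I η := by
      have e0 : IntegrableOn (fun x => x ^ (-n₂) * g x + (- n₂) * (x ^ (-n₂-1) * h x)) (Set.Ioo 0 a) :=
        (sg a ha).add ((sh a ha).const_mul (-n₂))
      rw [integral_add e0 (hI_int a ha),
        integral_add (sg a ha) ((sh a ha).const_mul (-n₂)), integral_const_mul]
    have hW : Filter.Tendsto (fun c : ℝ => c ^ (-n₂) * h c) (nhdsWithin 0 (Set.Ioi 0)) (nhds 0) := by
      have l1 := (aux_head_zero _ sE).const_mul (1 - n₂)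
      rw [mul_zero] at l1
      refine squeeze_zero_norm' ?_ l1
      filter_upwards [self_mem_nhdsWithin] with c hc
      have hc : 0 < c := hc
      have b1 : (∫ x in Set.Ioo 0 c, x ^ (-n₂) * (A + B * I c)) ≤ ∫ x in Set.Ioo 0 c, x ^ (-n₂) * (A + B * I x) := by
        refine setIntegral_mono_on ((pint c hc).mul_const _) (sE c hc) measurableSet_Ioo ?_
        intro x hx
        have := (hIanti (Set.mem_Ioi.2 hx.1) (Set.mem_Ioi.2 hc) hx.2).le
        have := rp (-n₂) x hx.1
        gcongr
      rw [integral_mul_const, aux_head_eq _ c hc.le, integral_rpow (Or.inl (by linarith)),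
        Real.zero_rpow (by linarith), sub_zero] at b1
      have b2 : (1 - n₂) * (c ^ (-n₂ + 1) / (-n₂ + 1) * (A + B * I c)) = c ^ (-n₂ + 1) * (A + B * I c) := by
        have : -n₂ + 1 ≠ 0 := by linarith
        field_simp; ring
      have b3 := mul_le_mul_of_nonneg_left b1 (show 0 ≤ 1 - n₂ by linarith)
      rw [b2] at b3
      refine le_trans ?_ b3
      rw [norm_mul, Real.norm_of_nonneg (rp _ _ hc).le, Real.rpow_add_one hc.ne', mul_assoc]
      exact mul_le_mul_of_nonneg_left (hhb c hc) (rp _ _ hc).le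
    have e2 : (∫ x in Set.Ioo 0 a, (x ^ (-n₂) * g x + (- n₂) * (x ^ (-n₂-1) * h x) + x ^ (-n₂) * I x)) = a ^ (-n₂) * h a := by
      have l2 := aux_head_zero _ sD
      have l3 := (l2.sub hW)
      rw [sub_zero] at l3
      have l4 : Filter.Tendsto (fun _ : ℝ => (∫ x in Set.Ioo 0 a, (x ^ (-n₂) * g x + (- n₂) * (x ^ (-n₂-1) * h x) + x ^ (-n₂) * I x)) - a ^ (-n₂) * h a)
          (nhdsWithin 0 (Set.Ioi 0)) (nhds 0) := by
        refine l3.congr' ?_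
        filter_upwards [self_mem_nhdsWithin] with c hc
        have hc : 0 < c := hc
        have := aux_ibp h g I zS n₂ c a hc ha hhc hder (aux_iih _ sD c a hc.le ha.le)
        rw [aux_head_split _ sD c a hc ha, this]
        ring
      have := tendsto_nhds_unique l4 tendsto_const_nhds
      linarith
    have e3 : 0 < ∫ η in Set.Ioo 0 a, η ^ (-n₂) * I η := by
      rw [aux_head_eq _ a ha.le]
      refine intervalIntegral.intervalIntegral_pos_of_pos_on (aux_iih _ hI_int 0 a le_rfl ha.le) ?_ ha
      exact fun x hx => mul_pos (rp _ _ hx.1) (hIpos x hx.1)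
    have e4 : h a ≤ 0 := by
      rcases ha'.lt_or_eq with hlt | heq
      · exact (hneg a ha hlt).le
      · rw [heq, hzh0]
    have := rp (-n₂) a ha
    nlinarith
  · -- d1
    intro b hb
    have hb0 : 0 < b := hzh.trans hb
    have tD : ∀ c, 0 < c → IntegrableOn (fun x => x ^ (-n₁) * g x + (- n₁) * (x ^ (-n₁-1) * h x) + x ^ (-n₁) * I x) (Set.Ioi c) :=
      fun c hc => ((tg c hc).add ((th c hc).const_mul (-n₁))).add (tI c hc)
    have e1 : (∫ x in Set.Ioi b, (x ^ (-n₁) * g x + (- n₁) * (x ^ (-n₁-1) * h x) + x ^ (-n₁) * I x)) =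
        ((∫ η in Set.Ioi b, η ^ (-n₁) * g η) + - n₁ * ∫ η in Set.Ioi b, η ^ (-n₁ - 1) * h η)
         + ∫ η in Set.Ioi b, η ^ (-n₁) * I η := by
      have e0 : IntegrableOn (fun x => x ^ (-n₁) * g x + (- n₁) * (x ^ (-n₁-1) * h x)) (Set.Ioi b) :=
        (tg b hb0).add ((th b hb0).const_mul (-n₁))
      rw [integral_add e0 (tI b hb0),
        integral_add (tg b hb0) ((th b hb0).const_mul (-n₁)), integral_const_mul]
    have hW : Filter.Tendsto (fun c : ℝ => c ^ (-n₁) * h c) Filter.atTop (nhds 0) := by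
      have l1 := (tendsto_rpow_neg_atTop (show 0 < n₁ - 1 by linarith)).mul_const (A + B * I b)
      rw [zero_mul] at l1
      refine squeeze_zero_norm' ?_ l1
      filter_upwards [Filter.eventually_gt_atTop b] with c hc
      have hc0 : 0 < c := hb0.trans hc
      rw [norm_mul, Real.norm_of_nonneg (rp _ _ hc0).le, show -(n₁ - 1) = -n₁ + 1 by ring,
        Real.rpow_add_one hc0.ne', mul_assoc]
      refine mul_le_mul_of_nonneg_left ((hhb c hc0).trans ?_) (rp _ _ hc0).le
      have := (hIanti (Set.mem_Ioi.2 hb0) (Set.mem_Ioi.2 hc0) hc).le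
      gcongr
    have e2 : (∫ x in Set.Ioi b, (x ^ (-n₁) * g x + (- n₁) * (x ^ (-n₁-1) * h x) + x ^ (-n₁) * I x)) = - (b ^ (-n₁) * h b) := by
      have l2 := intervalIntegral_tendsto_integral_Ioi b (tD b hb0) Filter.tendsto_id
      have l3 := hW.sub_const (b ^ (-n₁) * h b)
      rw [zero_sub] at l3
      refine tendsto_nhds_unique l2 (l3.congr' ?_)
      filter_upwards [Filter.eventually_gt_atTop b] with c hc
      have hc0 : 0 < c := hb0.trans hc
      exact (aux_ibp h g I zS n₁ b c hb0 hc0 hhc hder (aux_ii _ tD b c hb0 hc0)).symm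
    have e3 : 0 ≤ ∫ η in Set.Ioi b, η ^ (-n₁) * I η := by
      refine setIntegral_nonneg measurableSet_Ioi (fun x hx => ?_)
      have hx0 : 0 < x := hb0.trans hx
      exact (mul_pos (rp _ _ hx0) (hIpos x hx0)).le
    have e4 : 0 < b ^ (-n₁) * h b := mul_pos (rp _ _ hb0) (hpos b hb)
    have e5 : 0 ≤ ∫ x in zh..b, x ^ (-n₁-1) * h x := by
      refine intervalIntegral.integral_nonneg hb.le (fun x hx => ?_)
      rcases hx.1.lt_or_eq with hlt | heq
      · exact (mul_pos (rp _ _ (by linarith)) (hpos x hlt)).le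
      · rw [← heq, hzh0, mul_zero]
    simp only [pth zh b hzh hb0]
    nlinarith
  · -- q1
    set m := zh / 2 with hm
    have hm0 : 0 < m := by positivity
    have hmz : m < zh := by rw [hm]; linarith
    have hhm := hneg m hm0 hmz
    set c := - (h m / m) with hc
    have hc0 : 0 < c := by
      have := div_neg_of_neg_of_pos hhm hm0
      linarith
    have hlow : ∀ a, 0 < a → a < m → c * ((a ^ (1 - n₁) - m ^ (1 - n₁)) / (n₁ - 1)) ≤
        ∫ x in a..m, -(x ^ (-n₁-1) * h x) := by
      intro a ha ham
      have i1 : (∫ x in a..m, c * x ^ (-n₁)) = c * ((a ^ (1 - n₁) - m ^ (1 - n₁)) / (n₁ - 1)) := by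
        rw [intervalIntegral.integral_const_mul, integral_rpow]
        · rw [show -n₁ + 1 = 1 - n₁ by ring, show n₁ - 1 = -(1 - n₁) by ring, div_neg, ← neg_div, neg_sub]
        · refine Or.inr ⟨by linarith, ?_⟩
          rw [Set.uIcc_of_le ham.le]
          intro hx
          linarith [hx.1]
      rw [← i1]
      refine intervalIntegral.integral_mono_on ham.le ?_ (ith a m ha hm0).neg ?_
      · refine ((aux_pow_meas (-n₁)).mono ?_).intervalIntegrable.const_mul c
        rw [Set.uIcc_of_le ham.le]
        exact fun x hx => ha.trans_le hx.1
      · intro x hx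
        have hx0 : 0 < x := ha.trans_le hx.1
        have k1 : h x / x ≤ h m / m := hk.monotoneOn (Set.mem_Ioi.2 hx0) (Set.mem_Ioi.2 hm0) hx.2
        have k2 : -(x ^ (-n₁-1) * h x) = -(h x / x) * x ^ (-n₁) := by
          rw [Real.rpow_sub_one hx0.ne']; ring
        rw [k2]
        exact mul_le_mul_of_nonneg_right (by linarith) (rp _ _ hx0).le
    set T := ∫ η in Set.Ioi m, η ^ (-n₁ - 1) * h η with hT
    have hlim : Filter.Tendsto (fun a : ℝ => a ^ (1 - n₁)) (nhdsWithin 0 (Set.Ioi 0)) Filter.atTop :=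
      tendsto_rpow_neg_nhdsGT_zero (by linarith)
    have hev := hlim.eventually_ge_atTop (|T| * (n₁ - 1) / c + m ^ (1 - n₁))
    have hev2 : ∀ᶠ a in nhdsWithin (0:ℝ) (Set.Ioi 0), a < m := 
      Filter.Eventually.filter_mono nhdsWithin_le_nhds (gt_mem_nhds hm0)
    have hev3 : ∀ᶠ a in nhdsWithin (0:ℝ) (Set.Ioi 0), 0 < a := self_mem_nhdsWithin
    obtain ⟨a, h1, h2, h3⟩ := (hev.and (hev2.and hev3)).exists
    refine ⟨a, h3, h2.trans hmz, ?_⟩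
    have h4 := hlow a h3 h2
    rw [intervalIntegral.integral_neg] at h4
    have h5 : |T| ≤ c * ((a ^ (1 - n₁) - m ^ (1 - n₁)) / (n₁ - 1)) := by
      have h6 : 0 < n₁ - 1 := by linarith
      have h7 : |T| * (n₁ - 1) / c ≤ a ^ (1 - n₁) - m ^ (1 - n₁) := by linarith
      rw [div_le_iff₀ hc0] at h7
      rw [← mul_div_assoc, le_div_iff₀ h6]
      linarith
    simp only [pth a m h3 hm0]
    have := le_abs_self T
    nlinarith

lemma aux_glue (p q F : ℝ → ℝ) (c : ℝ) (hc : 0 < c) (hp : StrictMonoOn p (Set.Ioi 0))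
    (hq : StrictMonoOn q (Set.Ioi 0)) (hpq : p c ≤ q c)
    (h1 : ∀ x, c < x → F x = q x) (h2 : ∀ x, 0 < x → x ≤ c → F x = p x) :
    StrictMonoOn F (Set.Ioi 0) := by
  intro x hx y hy hxy
  rcases le_or_gt y c with hyc | hyc
  · rw [h2 y hy hyc, h2 x hx (hxy.le.trans hyc)]
    exact hp hx hy hxy
  · rw [h1 y hyc]
    rcases le_or_gt x c with hxc | hxc
    · rw [h2 x hx hxc]
      have a1 := hp.monotoneOn hx (Set.mem_Ioi.2 hc) hxc
      have a2 := hq (Set.mem_Ioi.2 hc) hy hyc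
      linarith
    · rw [h1 x hxc]
      exact hq hx hy hxy

lemma aux_tangent_s16 (u u' I utld : ℝ → ℝ)
    (hu_conc : StrictConcaveOn ℝ (Set.Ici 0) u)
    (hu_deriv : ∀ c : ℝ, 0 < c → HasDerivAt u (u' c) c)
    (hI_pos : ∀ y : ℝ, 0 < y → 0 < I y)
    (hI_left : ∀ y : ℝ, 0 < y → u' (I y) = y)
    (hutld : ∀ y : ℝ, 0 < y → utld y = u (I y) - y * I y) (y z : ℝ) (hy : 0 < y) (hz : 0 < z) :
    utld y - (z - y) * I y ≤ utld z := by
  -- u (I y) ≤ u (I z) + z * (I y - I z)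
  have key : u (I y) ≤ u (I z) + z * (I y - I z) := by
    have d := hu_deriv (I z) (hI_pos z hz)
    rw [hI_left z hz] at d
    have m1 : I y ∈ Set.Ici (0:ℝ) := (hI_pos y hy).le
    have m2 : I z ∈ Set.Ici (0:ℝ) := (hI_pos z hz).le
    rcases lt_trichotomy (I y) (I z) with hlt | heq | hgt
    · have := hu_conc.concaveOn.le_slope_of_hasDerivAt m1 m2 hlt d
      rw [slope_def_field, le_div_iff₀ (by linarith)] at this
      linarith
    · rw [heq]; simp
    · have := hu_conc.concaveOn.slope_le_of_hasDerivAt m2 m1 hgt d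
      rw [slope_def_field, div_le_iff₀ (by linarith)] at this
      linarith
  rw [hutld y hy, hutld z hz]
  linarith

lemma aux_deriv_s16 (I utld : ℝ → ℝ) (hI_cont : ContinuousOn I (Set.Ioi 0))
    (ht : ∀ y z, 0 < y → 0 < z → utld y - (z - y) * I y ≤ utld z) (y : ℝ) (hy : 0 < y) :
    HasDerivAt utld (- I y) y := by
  rw [hasDerivAt_iff_isLittleO, Asymptotics.isLittleO_iff]
  intro c hc
  have hIc := hI_cont.continuousAt (Ioi_mem_nhds hy)
  have h1 := Metric.continuousAt_iff'.1 hIc c hc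
  filter_upwards [h1, lt_mem_nhds hy] with z hz hz0
  have a1 := ht y z hy hz0
  have a2 := ht z y hz0 hy
  rw [Real.dist_eq] at hz
  have a3 : |utld z - utld y - (z - y) * (- I y)| ≤ |(I z - I y) * (z - y)| := by
    rw [abs_of_nonneg (by linarith)]
    refine le_trans ?_ (neg_le_abs _)
    linarith
  rw [abs_mul] at a3
  simp only [Real.norm_eq_abs, smul_eq_mul]
  exact a3.trans (mul_le_mul_of_nonneg_right hz.le (abs_nonneg _))

lemma aux_div_deriv (I utld : ℝ → ℝ) (hd : ∀ y, 0 < y → HasDerivAt utld (- I y) y)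
    (κ z : ℝ) (hκ : 0 < κ) (hz : 0 < z) :
    HasDerivAt (fun z => utld (z / κ)) (- ((1 / κ) * I (z / κ))) z := by
  have h1 : HasDerivAt (fun z : ℝ => z / κ) (1 / κ) z := (hasDerivAt_id z).div_const κ
  have h2 := (hd (z / κ) (div_pos hz hκ)).comp z h1
  refine h2.congr_deriv ?_
  ring

lemma aux_ratio (u I utld : ℝ → ℝ)
    (hu_mono : StrictMonoOn u (Set.Ici 0))
    (hI_pos : ∀ y : ℝ, 0 < y → 0 < I y)
    (hI_anti : StrictAntiOn I (Set.Ioi 0))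
    (hutld : ∀ y : ℝ, 0 < y → utld y = u (I y) - y * I y)
    (hd : ∀ y, 0 < y → HasDerivAt utld (- I y) y)
    (κ κ' ε : ℝ) (hκ : 0 < κ) (hκκ : κ < κ') :
    StrictMonoOn (fun z => (utld (z / κ) - utld (z / κ') + ε * z) / z) (Set.Ioi 0) := by
  have hκ' : 0 < κ' := hκ.trans hκκ
  have hD : ∀ z, 0 < z → HasDerivAt (fun z => (utld (z / κ) - utld (z / κ') + ε * z) / z)
      ((u (I (z / κ')) - u (I (z / κ))) / z ^ 2) z := by
    intro z hz
    have h1 := aux_div_deriv I utld hd κ z hκ hz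
    have h2 := aux_div_deriv I utld hd κ' z hκ' hz
    have h3 := (((h1.sub h2).add ((hasDerivAt_id z).const_mul ε)).div (hasDerivAt_id z) hz.ne')
    refine h3.congr_deriv ?_
    simp only [id, Pi.add_apply, Pi.sub_apply]
    rw [hutld _ (div_pos hz hκ), hutld _ (div_pos hz hκ')]
    congr 1
    ring
  refine strictMonoOn_of_deriv_pos (convex_Ioi 0) (fun z hz => (hD z hz).continuousAt.continuousWithinAt) ?_
  intro z hz
  rw [interior_Ioi] at hz
  have hz : 0 < z := hz
  rw [(hD z hz).deriv]
  have p1 := div_pos hz hκ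
  have p2 := div_pos hz hκ'
  have h4 : z / κ' < z / κ := div_lt_div_of_pos_left hz hκ hκκ
  have h5 := hI_anti (Set.mem_Ioi.2 p2) (Set.mem_Ioi.2 p1) h4
  have h6 := hu_mono (Set.mem_Ici.2 (hI_pos _ p1).le) (Set.mem_Ici.2 (hI_pos _ p2).le) h5
  exact div_pos (by linarith) (by positivity)

lemma aux_bounds (I utld : ℝ → ℝ) 
    (hI_pos : ∀ y : ℝ, 0 < y → 0 < I y)
    (hI_anti : StrictAntiOn I (Set.Ioi 0))
    (ht : ∀ y z, 0 < y → 0 < z → utld y - (z - y) * I y ≤ utld z)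
    (κ₁ ε₁ κ ε : ℝ) (hκ₁ : 0 < κ₁) (hκκ : κ₁ ≤ κ) (hκ : κ < 1) (hε : 0 < ε) (hεε : ε ≤ ε₁)
    (x : ℝ) (hx : 0 < x) :
    |utld (x / κ) - utld x + ε * x| ≤ x * (ε₁ + 1 / κ₁ * I x) ∧
    |ε - (1 / κ) * I (x / κ)| ≤ ε₁ + 1 / κ₁ * I x := by
  have hκ0 : 0 < κ := hκ₁.trans_le hκκ
  have hlt : x < x / κ := by rw [lt_div_iff₀ hκ0]; nlinarith
  have hp : 0 < x / κ := hx.trans hlt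
  have hIl := hI_anti (Set.mem_Ioi.2 hx) (Set.mem_Ioi.2 hp) hlt
  have i1 := hI_pos x hx
  have i2 := hI_pos _ hp
  have t1 := ht x (x / κ) hx hp
  have t2 := ht (x / κ) x hp hx
  have hk1 : 1 / κ ≤ 1 / κ₁ := one_div_le_one_div_of_le hκ₁ hκκ
  have hk0 : 0 < 1 / κ := by positivity
  have hxk : x / κ = x * (1 / κ) := by ring
  have m1 : 1 / κ * I x ≤ 1 / κ₁ * I x := mul_le_mul_of_nonneg_right hk1 i1.le
  have m2 : 1 / κ * I (x / κ) ≤ 1 / κ * I x := mul_le_mul_of_nonneg_left hIl.le hk0.le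
  have m3 : 0 < 1 / κ * I (x / κ) := by positivity
  constructor
  · have m4 : (x / κ - x) * I x ≤ x * (1 / κ₁ * I x) := by
      have : (x / κ - x) * I x = x * (1 / κ * I x) - x * I x := by ring
      have := mul_le_mul_of_nonneg_left m1 hx.le
      have := mul_pos hx i1
      linarith
    have m5 : 0 ≤ (x / κ - x) * I (x / κ) := mul_nonneg (by linarith) i2.le
    have m6 : ε * x ≤ ε₁ * x := mul_le_mul_of_nonneg_right hεε hx.le
    have m7 : 0 < ε * x := by positivity
    have m8 : 0 ≤ x * (1 / κ₁ * I x) := by positivity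
    rw [abs_le]
    constructor <;> linarith
  · rw [abs_le]
    constructor <;> linarith




/-- there exists a unique pair (z_R, z_B) with 0 < z_R < ẑ, z_B > z_R,
φ₁(z_R,z_B) = 0 and φ₂(z_R,z_B) = 0. -/
theorem stmt_16
    (δ r θ n₁ n₂ : ℝ)
    (hδ : 0 < δ) (hr : 0 < r) (hθ : θ ≠ 0)
    (hn₂0 : n₂ < 0) (hn₁1 : 1 < n₁)
    (hroot₁ : θ ^ 2 / 2 * n₁ ^ 2 + (δ - r - θ ^ 2 / 2) * n₁ - δ = 0)
    (hroot₂ : θ ^ 2 / 2 * n₂ ^ 2 + (δ - r - θ ^ 2 / 2) * n₂ - δ = 0)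
    (u u' I utld : ℝ → ℝ)
    (hu_mono : StrictMonoOn u (Set.Ici 0))
    (hu_conc : StrictConcaveOn ℝ (Set.Ici 0) u)
    (hu_cont : ContinuousOn u (Set.Ici 0))
    (hu_deriv : ∀ c : ℝ, 0 < c → HasDerivAt u (u' c) c)
    (hu'_cont : ContinuousOn u' (Set.Ioi 0))
    (hu'_top : Filter.Tendsto u' Filter.atTop (nhds 0))
    (hu'_zero : Filter.Tendsto u' (nhdsWithin 0 (Set.Ioi 0)) Filter.atTop)
    (hI_pos : ∀ y : ℝ, 0 < y → 0 < I y)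
    (hI_left : ∀ y : ℝ, 0 < y → u' (I y) = y)
    (hI_right : ∀ c : ℝ, 0 < c → I (u' c) = c)
    (hI_anti : StrictAntiOn I (Set.Ioi 0))
    (hI_cont : ContinuousOn I (Set.Ioi 0))
    (hI_zero : Filter.Tendsto I (nhdsWithin 0 (Set.Ioi 0)) Filter.atTop)
    (hI_top : Filter.Tendsto I Filter.atTop (nhds 0))
    (hutld : ∀ y : ℝ, 0 < y → utld y = u (I y) - y * I y)
    (ε₁ ε₂ κ₁ κ₂ : ℝ)
    (hε₂ : 0 < ε₂) (hε₁₂ : ε₂ < ε₁)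
    (hκ₁ : 0 < κ₁) (hκ₁₂ : κ₁ < κ₂) (hκ₂ : κ₂ < 1)
    (z_S : ℝ) (hzS_pos : 0 < z_S)
    (hzS_zero : (1 / z_S) * (utld (z_S / κ₁) - utld (z_S / κ₂) + z_S * (ε₁ - ε₂)) = 0)
    (hzS_uniq : ∀ y : ℝ, 0 < y →
      (1 / y) * (utld (y / κ₁) - utld (y / κ₂) + y * (ε₁ - ε₂)) = 0 → y = z_S)
    (h : ℝ → ℝ)
    (hh₁ : ∀ z : ℝ, z_S < z → h z = utld (z / κ₁) - utld z + ε₁ * z)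
    (hh₂ : ∀ z : ℝ, 0 < z → z ≤ z_S → h z = utld (z / κ₂) - utld z + ε₂ * z)
    (zhat : ℝ) (hzhat_pos : 0 < zhat) (hzhat_zero : h zhat = 0)
    (hzhat_uniq : ∀ z : ℝ, 0 < z → h z = 0 → z = zhat)
    (hI_int : ∀ y : ℝ, 0 < y →
      MeasureTheory.IntegrableOn (fun η => η ^ (-n₂) * I η) (Set.Ioo 0 y) MeasureTheory.volume)
    (chat ehat : ℝ → ℝ)
    (hchat₁ : ∀ η : ℝ, z_S < η → chat η = (1 / κ₁) * I (η / κ₁))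
    (hchat₂ : ∀ η : ℝ, 0 < η → η ≤ z_S → chat η = (1 / κ₂) * I (η / κ₂))
    (hehat₁ : ∀ η : ℝ, z_S < η → ehat η = ε₁)
    (hehat₂ : ∀ η : ℝ, 0 < η → η ≤ z_S → ehat η = ε₂)
    (φ₁ φ₂ : ℝ → ℝ → ℝ)
    (hφ₁ : ∀ z₁ z₂ : ℝ, 0 < z₁ → 0 < z₂ →
      φ₁ z₁ z₂ = (∫ η in Set.Ioi z₂, η ^ (-n₁) * (ehat η - chat η)) -
        n₁ * ∫ η in Set.Ioi z₁, η ^ (-n₁ - 1) * h η)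
    (hφ₂ : ∀ z₁ z₂ : ℝ, 0 < z₁ → 0 < z₂ →
      φ₂ z₁ z₂ = (∫ η in Set.Ioo 0 z₂, η ^ (-n₂) * (ehat η - chat η)) -
        n₂ * ∫ η in Set.Ioo 0 z₁, η ^ (-n₂ - 1) * h η)
    :
    ∃! p : ℝ × ℝ, 0 < p.1 ∧ p.1 < zhat ∧ p.1 < p.2 ∧ φ₁ p.1 p.2 = 0 ∧ φ₂ p.1 p.2 = 0 := by

  have ht := aux_tangent_s16 u u' I utld hu_conc hu_deriv hI_pos hI_left hutld
  have hd := aux_deriv_s16 I utld hI_cont ht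
  have hκ₂0 : 0 < κ₂ := hκ₁.trans hκ₁₂
  have hκ₁1 : κ₁ < 1 := hκ₁₂.trans hκ₂
  have hS : utld (z_S / κ₁) - utld (z_S / κ₂) + z_S * (ε₁ - ε₂) = 0 := by
    rcases mul_eq_zero.1 hzS_zero with h1 | h1
    · exact absurd h1 (by positivity)
    · exact h1
  have hder1 : ∀ κ ε z, 0 < κ → 0 < z →
      HasDerivAt (fun z => utld (z / κ) - utld z + ε * z) (ε - 1 / κ * I (z / κ) + I z) z := by
    intro κ ε z hκ hz
    have h3 := (((aux_div_deriv I utld hd κ z hκ hz).sub (hd z hz)).add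
      ((hasDerivAt_id z).const_mul ε))
    refine h3.congr_deriv ?_
    ring
  have hgmono : ∀ κ ε, 0 < κ → StrictMonoOn (fun z => ε - 1 / κ * I (z / κ)) (Set.Ioi 0) := by
    intro κ ε hκ x hx y hy hxy
    have hx : 0 < x := hx
    have hy : 0 < y := hy
    have h1 := hI_anti (Set.mem_Ioi.2 (div_pos hx hκ)) (Set.mem_Ioi.2 (div_pos hy hκ))
      (div_lt_div_of_pos_right hxy hκ)
    have h2 := mul_lt_mul_of_pos_left h1 (one_div_pos.2 hκ)
    simp only
    linarith
  have hder : ∀ x, 0 < x → x ≠ z_S → HasDerivAt h ((ehat x - chat x) + I x) x := by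
    intro x hx hne
    rcases lt_or_gt_of_ne hne with hlt | hgt
    · rw [hehat₂ x hx hlt.le, hchat₂ x hx hlt.le]
      refine (hder1 κ₂ ε₂ x hκ₂0 hx).congr_of_eventuallyEq ?_
      filter_upwards [lt_mem_nhds hx, gt_mem_nhds hlt] with z h1 h2
      exact hh₂ z h1 h2.le
    · rw [hehat₁ x hgt, hchat₁ x hgt]
      refine (hder1 κ₁ ε₁ x hκ₁ hx).congr_of_eventuallyEq ?_
      filter_upwards [lt_mem_nhds hgt] with z h1
      exact hh₁ z h1
  have hhc : ContinuousOn h (Set.Ioi 0) := by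
    intro x hx
    have hx : 0 < x := hx
    refine ContinuousAt.continuousWithinAt ?_
    by_cases hne : x = z_S
    · subst hne
      refine continuousAt_iff_continuous_left'_right'.2 ⟨?_, ?_⟩
      · refine (hder1 κ₂ ε₂ x hκ₂0 hx).continuousAt.continuousWithinAt.congr_of_eventuallyEq ?_
          (hh₂ x hx le_rfl)
        filter_upwards [self_mem_nhdsWithin, mem_nhdsWithin_of_mem_nhds (lt_mem_nhds hx)] with z h1 h2
        exact hh₂ z h2 (le_of_lt h1)
      · refine (hder1 κ₁ ε₁ x hκ₁ hx).continuousAt.continuousWithinAt.congr_of_eventuallyEq ?_ ?_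
        · filter_upwards [self_mem_nhdsWithin] with z h1
          exact hh₁ z h1
        · rw [hh₂ x hx le_rfl]; linarith
    · exact (hder x hx hne).continuousAt
  have hg : StrictMonoOn (fun x => ehat x - chat x) (Set.Ioi 0) := by
    refine aux_glue _ _ _ z_S hzS_pos (hgmono κ₂ ε₂ hκ₂0) (hgmono κ₁ ε₁ hκ₁) ?_ ?_ ?_
    · have p1 := div_pos hzS_pos hκ₁
      have p2 := div_pos hzS_pos hκ₂0
      rw [hutld _ p1, hutld _ p2] at hS
      have h4 : z_S / κ₂ < z_S / κ₁ := div_lt_div_of_pos_left hzS_pos hκ₁ hκ₁₂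
      have h5 := hI_anti (Set.mem_Ioi.2 p2) (Set.mem_Ioi.2 p1) h4
      have h6 := hu_mono (Set.mem_Ici.2 (hI_pos _ p1).le) (Set.mem_Ici.2 (hI_pos _ p2).le) h5
      have h7 : 0 < z_S * ((ε₁ - 1 / κ₁ * I (z_S / κ₁)) - (ε₂ - 1 / κ₂ * I (z_S / κ₂))) := by
        have : z_S * ((ε₁ - 1 / κ₁ * I (z_S / κ₁)) - (ε₂ - 1 / κ₂ * I (z_S / κ₂))) =
          u (I (z_S / κ₂)) - u (I (z_S / κ₁)) + ((u (I (z_S / κ₁)) - z_S / κ₁ * I (z_S / κ₁) -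
          (u (I (z_S / κ₂)) - z_S / κ₂ * I (z_S / κ₂)) + z_S * (ε₁ - ε₂))) := by ring
        rw [this, hS]
        linarith
      have := (mul_pos_iff_of_pos_left hzS_pos).1 h7
      linarith
    · intro x hx
      simp only [hehat₁ x hx, hchat₁ x hx]
    · intro x hx hx'
      simp only [hehat₂ x hx hx', hchat₂ x hx hx']
  have hk : StrictMonoOn (fun z => h z / z) (Set.Ioi 0) := by
    have r1 := aux_ratio u I utld hu_mono hI_pos hI_anti hutld hd κ₁ 1 ε₁ hκ₁ hκ₁1
    have r2 := aux_ratio u I utld hu_mono hI_pos hI_anti hutld hd κ₂ 1 ε₂ hκ₂0 hκ₂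
    simp only [div_one] at r1 r2
    refine aux_glue _ _ _ z_S hzS_pos r2 r1 ?_ ?_ ?_
    · refine div_le_div_of_nonneg_right ?_ hzS_pos.le
      linarith
    · intro x hx
      simp only [hh₁ x hx]
    · intro x hx hx'
      simp only [hh₂ x hx hx']
  have hbd : ∀ x, 0 < x → |h x| ≤ x * (ε₁ + 1 / κ₁ * I x) ∧
      |ehat x - chat x| ≤ ε₁ + 1 / κ₁ * I x := by
    intro x hx
    rcases le_or_gt x z_S with hle | hgt
    · rw [hh₂ x hx hle, hehat₂ x hx hle, hchat₂ x hx hle]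
      exact aux_bounds I utld hI_pos hI_anti ht κ₁ ε₁ κ₂ ε₂ hκ₁ hκ₁₂.le hκ₂ hε₂ hε₁₂.le x hx
    · rw [hh₁ x hgt, hehat₁ x hgt, hchat₁ x hgt]
      exact aux_bounds I utld hI_pos hI_anti ht κ₁ ε₁ κ₁ ε₁ hκ₁ le_rfl hκ₁1 (hε₂.trans hε₁₂) le_rfl x hx
  have hg0 : ∃ x, 0 < x ∧ ehat x - chat x ≤ 0 := by
    have e1 := hI_zero.eventually_ge_atTop (ε₂ * κ₂)
    have e2 : ∀ᶠ a in nhdsWithin (0:ℝ) (Set.Ioi 0), a < z_S :=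
      Filter.Eventually.filter_mono nhdsWithin_le_nhds (gt_mem_nhds hzS_pos)
    have e3 : ∀ᶠ a in nhdsWithin (0:ℝ) (Set.Ioi 0), 0 < a := self_mem_nhdsWithin
    obtain ⟨y, h1, h2, h3⟩ := (e1.and (e2.and e3)).exists
    have hx : 0 < y * κ₂ := by positivity
    have hx' : y * κ₂ ≤ z_S := by nlinarith
    refine ⟨y * κ₂, hx, ?_⟩
    rw [hehat₂ _ hx hx', hchat₂ _ hx hx', mul_div_cancel_right₀ _ hκ₂0.ne', sub_nonpos,
      one_div, ← div_eq_inv_mul, le_div_iff₀ hκ₂0]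
    exact h1
  have hg1 : ∃ x, 0 < x ∧ 0 < ehat x - chat x := by
    have hpos : 0 < ε₁ * κ₁ := mul_pos (hε₂.trans hε₁₂) hκ₁
    have e1 := (tendsto_order.1 hI_top).2 _ hpos
    obtain ⟨y, h1, h2⟩ := (e1.and (Filter.eventually_gt_atTop (z_S / κ₁))).exists
    have hx' : z_S < y * κ₁ := (div_lt_iff₀ hκ₁).1 h2
    refine ⟨y * κ₁, hzS_pos.trans hx', ?_⟩
    rw [hehat₁ _ hx', hchat₁ _ hx', mul_div_cancel_right₀ _ hκ₁.ne', sub_pos,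
      one_div, ← div_eq_inv_mul, div_lt_iff₀ hκ₁]
    exact h1
  have main := aux_analysis I (fun x => ehat x - chat x) h ε₁ (1 / κ₁) z_S zhat n₁ n₂
    (hε₂.trans hε₁₂) (by positivity) hn₂0 hn₁1 hI_pos hI_anti hI_cont hg
    (fun x hx => (hbd x hx).2) hhc (fun x hx => (hbd x hx).1) hder hk hzhat_pos hzhat_zero hg0 hg1 hI_int
  have heq : ∀ p : ℝ × ℝ, (0 < p.1 ∧ p.1 < zhat ∧ p.1 < p.2 ∧ φ₁ p.1 p.2 = 0 ∧ φ₂ p.1 p.2 = 0) ↔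
      (0 < p.1 ∧ p.1 < zhat ∧ p.1 < p.2 ∧
      ((∫ η in Set.Ioi p.2, η ^ (-n₁) * (ehat η - chat η)) +
        (- n₁ * ∫ η in Set.Ioi p.1, η ^ (-n₁ - 1) * h η)) = 0 ∧
      ((∫ η in Set.Ioo 0 p.2, η ^ (-n₂) * (ehat η - chat η)) +
        (- n₂ * ∫ η in Set.Ioo 0 p.1, η ^ (-n₂ - 1) * h η)) = 0) := by
    intro p
    refine and_congr_right (fun h1 => and_congr_right (fun _ => and_congr_right (fun h2 => ?_)))
    rw [hφ₁ p.1 p.2 h1 (h1.trans h2), hφ₂ p.1 p.2 h1 (h1.trans h2), neg_mul, neg_mul,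
      ← sub_eq_add_neg, ← sub_eq_add_neg]
  exact (existsUnique_congr heq).2 main
end

section
/- The function Q is continuously differentiable on (0,∞), twice continuously differentiable on (0,∞)\{z_R}, and for every z ∈ (0,∞) with z ≠ z_R it satisfies the Hamilton–Jacobi–Bellman quasi-variational inequality max{ min{ (θ²/2)z²Q″(z) + (δ−r)zQ′(z) − δQ(z) + ũ(z) + h(z), −Q′(z) }, J_R(z) − Q(z) } = 0. -/
open MeasureTheory

namespace QVI

open Set Filter Topology

structure Good (n₁ n₂ s : ℝ) (G g : ℝ → ℝ) : Prop where
  cont : ContinuousOn G (Ioi 0)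
  der : ∀ x, 0 < x → x ≠ s → HasDerivAt G (g x) x
  i1 : ∀ y, 0 < y → IntegrableOn (fun x => x ^ (-n₂ - 1) * G x) (Ioo 0 y)
  i2 : ∀ y, 0 < y → IntegrableOn (fun x => x ^ (-n₂) * g x) (Ioo 0 y)
  l0 : Tendsto (fun x => x ^ (-n₂) * G x) (𝓝[>] 0) (𝓝 0)
  j1 : ∀ y, 0 < y → IntegrableOn (fun x => x ^ (-n₁ - 1) * G x) (Ioi y)
  j2 : ∀ y, 0 < y → IntegrableOn (fun x => x ^ (-n₁) * g x) (Ioi y)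
  l1 : Tendsto (fun x => x ^ (-n₁) * G x) atTop (𝓝 0)

lemma rpow_cont (a : ℝ) : ContinuousOn (fun x : ℝ => x ^ a) (Ioi 0) := fun x hx =>
  (Real.continuousAt_rpow_const x a (Or.inl (ne_of_gt hx))).continuousWithinAt

lemma ii_of_Ioo {f : ℝ → ℝ} (hf : ∀ y, 0 < y → IntegrableOn f (Ioo 0 y)) {a b : ℝ}
    (ha : 0 ≤ a) (hb : 0 ≤ b) : IntervalIntegrable f volume a b := by
  have key : ∀ b, 0 ≤ b → IntervalIntegrable f volume 0 b := by
    intro b hb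
    rcases hb.eq_or_lt with rfl | hb
    · exact IntervalIntegrable.refl
    · rw [intervalIntegrable_iff_integrableOn_Ioo_of_le hb.le]
      exact hf b hb
  exact (key a ha).symm.trans (key b hb)

lemma ii_of_Ioi {f : ℝ → ℝ} (hf : ∀ y, 0 < y → IntegrableOn f (Ioi y)) {a b : ℝ}
    (ha : 0 < a) (hb : 0 < b) : IntervalIntegrable f volume a b := by
  have h2 : 0 < min a b / 2 := by positivity
  have := hf _ h2
  rw [intervalIntegrable_iff]
  refine this.mono_set ?_
  intro x hx
  have h3 := hx.1
  have : 0 < min a b := lt_min ha hb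
  simp only [mem_Ioi]
  linarith

lemma Ioo_eq {f : ℝ → ℝ} {z : ℝ} (hz : 0 ≤ z) : ∫ x in Ioo 0 z, f x = ∫ x in (0:ℝ)..z, f x := by
  rw [intervalIntegral.integral_of_le hz, integral_Ioc_eq_integral_Ioo]

lemma split0 {f : ℝ → ℝ} (hf : ∀ y, 0 < y → IntegrableOn f (Ioo 0 y)) {a b : ℝ}
    (ha : 0 < a) (hb : 0 < b) : ∫ x in Ioo 0 b, f x = (∫ x in Ioo 0 a, f x) + ∫ x in a..b, f x := by
  rw [Ioo_eq ha.le, Ioo_eq hb.le, intervalIntegral.integral_add_adjacent_intervals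
    (ii_of_Ioo hf le_rfl ha.le) (ii_of_Ioo hf ha.le hb.le)]

lemma split1 {f : ℝ → ℝ} (hf : ∀ y, 0 < y → IntegrableOn f (Ioi y)) {a b : ℝ}
    (ha : 0 < a) (hb : 0 < b) : ∫ x in Ioi b, f x = (∫ x in Ioi a, f x) - ∫ x in a..b, f x := by
  rcases le_total a b with h | h
  · rw [← intervalIntegral.integral_Ioi_sub_Ioi (hf a ha) h]; ring
  · rw [intervalIntegral.integral_symm, ← intervalIntegral.integral_Ioi_sub_Ioi (hf b hb) h]; ring

lemma ftc {f : ℝ → ℝ} (hf : ContinuousOn f (Ioi 0)) {a z : ℝ} (ha : 0 < a) (hz : 0 < z) :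
    HasDerivAt (fun z => ∫ x in a..z, f x) (f z) z := by
  have hsub : uIcc a z ⊆ Ioi 0 := by
    intro x hx
    exact lt_of_lt_of_le (lt_min ha hz) hx.1
  refine intervalIntegral.integral_hasDerivAt_right (hf.mono hsub).intervalIntegrable ?_
    (hf.continuousAt (Ioi_mem_nhds hz))
  exact hf.stronglyMeasurableAtFilter isOpen_Ioi z hz

lemma rpow_der (a : ℝ) {x : ℝ} (hx : 0 < x) : HasDerivAt (fun x : ℝ => x ^ a) (a * x ^ (a - 1)) x :=
  Real.hasDerivAt_rpow_const (Or.inl hx.ne')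

section
variable {n₁ n₂ s : ℝ} {G g : ℝ → ℝ}

lemma Good.parts0 (H : Good n₁ n₂ s G g) (hn₂ : n₂ < 0) {z : ℝ} (hz : 0 < z) :
    n₂ * ∫ x in Ioo 0 z, x ^ (-n₂ - 1) * G x
      = -(z ^ (-n₂) * G z) + ∫ x in Ioo 0 z, x ^ (-n₂) * g x := by
  have e1 := ii_of_Ioo H.i1 le_rfl hz.le
  have e2 := ii_of_Ioo H.i2 le_rfl hz.le
  have := integral_eq_of_hasDerivAt_off_countable (fun x => x ^ (-n₂) * G x)
    (fun x => -n₂ * (x ^ (-n₂ - 1) * G x) + x ^ (-n₂) * g x) (a := 0) (b := z) (s := {s})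
    (countable_singleton s) ?_ ?_ ((e1.const_mul _).add e2)
  · rw [intervalIntegral.integral_add (e1.const_mul _) e2, intervalIntegral.integral_const_mul,
      Real.zero_rpow (by linarith), ← Ioo_eq hz.le, ← Ioo_eq hz.le] at this
    linarith
  · rw [uIcc_of_le hz.le]
    intro x hx
    rcases hx.1.eq_or_lt with h0 | h0
    · subst h0
      have : ContinuousWithinAt (fun x => x ^ (-n₂) * G x) (Ioi 0) 0 := by
        unfold ContinuousWithinAt
        simp only
        rw [Real.zero_rpow (by linarith), zero_mul]
        exact H.l0
      have h2 := this.insert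
      refine h2.mono ?_
      intro y hy
      rcases hy.1.eq_or_lt with h | h
      · left; exact h.symm
      · right; exact h
    · exact (((rpow_cont _).mul H.cont).continuousAt (Ioi_mem_nhds h0)).continuousWithinAt
  · intro x hx
    have hx0 : 0 < x := by
      have := hx.1.1
      rwa [min_eq_left hz.le] at this
    have := (rpow_der (-n₂) hx0).mul (H.der x hx0 hx.2)
    refine this.congr_deriv ?_
    ring

lemma Good.ibp (H : Good n₁ n₂ s G g) {a z : ℝ} (ha : 0 < a) (hz : 0 < z) :
    ∫ x in a..z, (-n₁ * (x ^ (-n₁ - 1) * G x) + x ^ (-n₁) * g x)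
      = z ^ (-n₁) * G z - a ^ (-n₁) * G a := by
  have e1 := ii_of_Ioi H.j1 ha hz
  have e2 := ii_of_Ioi H.j2 ha hz
  refine integral_eq_of_hasDerivAt_off_countable (fun x => x ^ (-n₁) * G x)
    (fun x => -n₁ * (x ^ (-n₁ - 1) * G x) + x ^ (-n₁) * g x) (a := a) (b := z) (s := {s})
    (countable_singleton s) ?_ ?_ ((e1.const_mul _).add e2)
  · refine ((rpow_cont _).mul H.cont).mono ?_
    intro x hx
    exact lt_of_lt_of_le (lt_min ha hz) hx.1
  · intro x hx
    have hx0 : 0 < x := lt_trans (lt_min ha hz) hx.1.1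
    have := (rpow_der (-n₁) hx0).mul (H.der x hx0 hx.2)
    refine this.congr_deriv ?_
    ring

lemma Good.parts1 (H : Good n₁ n₂ s G g) {z : ℝ} (hz : 0 < z) :
    n₁ * ∫ x in Ioi z, x ^ (-n₁ - 1) * G x
      = z ^ (-n₁) * G z + ∫ x in Ioi z, x ^ (-n₁) * g x := by
  have h1 : IntegrableOn (fun x => -n₁ * (x ^ (-n₁ - 1) * G x) + x ^ (-n₁) * g x) (Ioi z) :=
    ((H.j1 z hz).const_mul _).add (H.j2 z hz)
  have h2 := intervalIntegral_tendsto_integral_Ioi z h1 tendsto_id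
  have h3 : Tendsto (fun b => b ^ (-n₁) * G b - z ^ (-n₁) * G z) atTop
      (𝓝 (0 - z ^ (-n₁) * G z)) := H.l1.sub_const _
  have h4 := tendsto_nhds_unique (h2.congr' (by
    filter_upwards [eventually_gt_atTop 0] with b hb
    exact H.ibp hz hb)) h3
  rw [integral_add ((H.j1 z hz).const_mul _) (H.j2 z hz), integral_const_mul] at h4
  linarith

lemma Good.add {G' g' : ℝ → ℝ} (H : Good n₁ n₂ s G g) (H' : Good n₁ n₂ s G' g') :
    Good n₁ n₂ s (fun x => G x + G' x) (fun x => g x + g' x) where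
  cont := H.cont.add H'.cont
  der x hx hs := (H.der x hx hs).add (H'.der x hx hs)
  i1 y hy := by simp_rw [mul_add]; exact (H.i1 y hy).add (H'.i1 y hy)
  i2 y hy := by simp_rw [mul_add]; exact (H.i2 y hy).add (H'.i2 y hy)
  l0 := by simp_rw [mul_add]; simpa using H.l0.add H'.l0
  j1 y hy := by simp_rw [mul_add]; exact (H.j1 y hy).add (H'.j1 y hy)
  j2 y hy := by simp_rw [mul_add]; exact (H.j2 y hy).add (H'.j2 y hy)
  l1 := by simp_rw [mul_add]; simpa using H.l1.add H'.l1

lemma Good.neg (H : Good n₁ n₂ s G g)  :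
    Good n₁ n₂ s (fun x => - G x) (fun x => - g x) where
  cont := H.cont.neg
  der x hx hs := (H.der x hx hs).neg
  i1 y hy := by simp_rw [mul_neg]; exact (H.i1 y hy).neg
  i2 y hy := by simp_rw [mul_neg]; exact (H.i2 y hy).neg
  l0 := by simp_rw [mul_neg]; simpa using H.l0.neg
  j1 y hy := by simp_rw [mul_neg]; exact (H.j1 y hy).neg
  j2 y hy := by simp_rw [mul_neg]; exact (H.j2 y hy).neg
  l1 := by simp_rw [mul_neg]; simpa using H.l1.neg

lemma rpow_int0 {a : ℝ} (ha : -1 < a) {y : ℝ} (hy : 0 < y) :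
    IntegrableOn (fun x : ℝ => x ^ a) (Ioo 0 y) := by
  rw [← intervalIntegrable_iff_integrableOn_Ioo_of_le hy.le]
  exact intervalIntegral.intervalIntegrable_rpow' ha

lemma rpow_lim0 {a : ℝ} (ha : 0 < a) : Tendsto (fun x : ℝ => x ^ a) (𝓝[>] 0) (𝓝 0) := by
  have := (Real.continuousAt_rpow_const 0 a (Or.inr ha.le)).tendsto
  rw [Real.zero_rpow ha.ne'] at this
  exact this.mono_left nhdsWithin_le_nhds

lemma Good.lin (hn₁ : 1 < n₁) (hn₂ : n₂ < 0) (e : ℝ) :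
    Good n₁ n₂ s (fun x => e * x) (fun _ => e) where
  cont := by fun_prop
  der x hx hs := by simpa using (hasDerivAt_id x).const_mul e
  i1 y hy := by
    refine IntegrableOn.congr_fun (f := fun x => x ^ (-n₂) * e)
      ((rpow_int0 (show -1 < -n₂ by linarith) hy).mul_const e) ?_ measurableSet_Ioo
    intro x hx
    have := hx.1
    simp only
    rw [Real.rpow_sub_one this.ne']; field_simp
  i2 y hy := (rpow_int0 (by linarith) hy).mul_const e
  l0 := by
    have h1 := (rpow_lim0 (show 0 < -n₂ + 1 by linarith)).mul_const e
    rw [zero_mul] at h1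
    refine h1.congr' ?_
    filter_upwards [self_mem_nhdsWithin] with x hx
    rw [Real.rpow_add_one (ne_of_gt hx)]; ring
  j1 y hy := by
    refine IntegrableOn.congr_fun (f := fun x => x ^ (-n₁) * e)
      ((integrableOn_Ioi_rpow_of_lt (show -n₁ < -1 by linarith) hy).mul_const e) ?_
      measurableSet_Ioi
    intro x hx
    have : 0 < x := hy.trans hx
    simp only
    rw [Real.rpow_sub_one this.ne']; field_simp
  j2 y hy := (integrableOn_Ioi_rpow_of_lt (by linarith) hy).mul_const e
  l1 := by
    have h1 := (tendsto_rpow_neg_atTop (show 0 < n₁ - 1 by linarith)).mul_const e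
    rw [zero_mul] at h1
    refine h1.congr' ?_
    filter_upwards [eventually_gt_atTop 0] with x hx
    rw [show -(n₁ - 1) = -n₁ + 1 by ring, Real.rpow_add_one (ne_of_gt hx)]; ring

lemma pw_int {F F₁ F₂ : ℝ → ℝ} {A : Set ℝ} (hA : MeasurableSet A) (hA0 : A ⊆ Ioi 0)
    (h1 : ∀ x, s < x → F x = F₁ x) (h2 : ∀ x, 0 < x → x ≤ s → F x = F₂ x)
    (k1 : IntegrableOn F₁ A) (k2 : IntegrableOn F₂ A) : IntegrableOn F A := by
  have : A = (A ∩ Iic s) ∪ (A ∩ Ioi s) := by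
    rw [← inter_union_distrib_left, Iic_union_Ioi, inter_univ]
  rw [this]
  refine IntegrableOn.union ?_ ?_
  · refine (k2.mono_set inter_subset_left).congr_fun ?_ (hA.inter measurableSet_Iic)
    intro x hx
    exact (h2 x (hA0 hx.1) hx.2).symm
  · refine (k1.mono_set inter_subset_left).congr_fun ?_ (hA.inter measurableSet_Ioi)
    intro x hx
    exact (h1 x hx.2).symm

lemma Good.pw {G₁ g₁ G₂ g₂ : ℝ → ℝ} (hs : 0 < s) (H₁ : Good n₁ n₂ s G₁ g₁) (H₂ : Good n₁ n₂ s G₂ g₂)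
    (h1 : ∀ x, s < x → G x = G₁ x) (h2 : ∀ x, 0 < x → x ≤ s → G x = G₂ x)
    (k1 : ∀ x, s < x → g x = g₁ x) (k2 : ∀ x, 0 < x → x ≤ s → g x = g₂ x)
    (heq : G₁ s = G₂ s) : Good n₁ n₂ s G g where
  cont := by
    have h1' : ∀ x, s ≤ x → G x = G₁ x := by
      intro x hx
      rcases hx.eq_or_lt with rfl | hx
      · rw [h2 _ hs le_rfl, heq]
      · exact h1 x hx
    have e1 : ContinuousOn G (Ici s) := (H₁.cont.mono (fun x hx => hs.trans_le hx)).congr h1'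
    have e2 : ContinuousOn G (Ioc 0 s) :=
      (H₂.cont.mono (fun x hx => hx.1)).congr (fun x hx => h2 x hx.1 hx.2)
    intro x hx
    have hx : 0 < x := hx
    rcases lt_trichotomy x s with hxs | hxs | hxs
    · exact (e2.continuousAt (Ioc_mem_nhds hx hxs)).continuousWithinAt
    · subst hxs
      have f1 := e1 x self_mem_Ici
      have f2 := e2 x ⟨hx, le_rfl⟩
      refine (f2.union f1).mono ?_
      intro y hy
      rcases le_total y x with h | h
      · left; exact ⟨hy, h⟩
      · right; exact h
    · exact (e1.continuousAt (Ici_mem_nhds hxs)).continuousWithinAt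
  der x hx hxs := by
    rcases lt_or_gt_of_ne hxs with h | h
    · rw [k2 x hx h.le]
      refine (H₂.der x hx hxs).congr_of_eventuallyEq ?_
      filter_upwards [Ioo_mem_nhds hx h] with y hy
      exact h2 y hy.1 hy.2.le
    · rw [k1 x h]
      refine (H₁.der x hx hxs).congr_of_eventuallyEq ?_
      filter_upwards [Ioi_mem_nhds h] with y hy
      exact h1 y hy
  i1 y hy := pw_int measurableSet_Ioo (fun x hx => hx.1) (fun x hx => by rw [h1 x hx])
    (fun x hx hx' => by rw [h2 x hx hx']) (H₁.i1 y hy) (H₂.i1 y hy)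
  i2 y hy := pw_int measurableSet_Ioo (fun x hx => hx.1) (fun x hx => by rw [k1 x hx])
    (fun x hx hx' => by rw [k2 x hx hx']) (H₁.i2 y hy) (H₂.i2 y hy)
  j1 y hy := pw_int measurableSet_Ioi (fun x hx => hy.trans hx) (fun x hx => by rw [h1 x hx])
    (fun x hx hx' => by rw [h2 x hx hx']) (H₁.j1 y hy) (H₂.j1 y hy)
  j2 y hy := pw_int measurableSet_Ioi (fun x hx => hy.trans hx) (fun x hx => by rw [k1 x hx])
    (fun x hx hx' => by rw [k2 x hx hx']) (H₁.j2 y hy) (H₂.j2 y hy)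
  l0 := by
    refine H₂.l0.congr' ?_
    filter_upwards [Ioo_mem_nhdsGT hs] with x hx
    rw [h2 x hx.1 hx.2.le]
  l1 := by
    refine H₁.l1.congr' ?_
    filter_upwards [eventually_gt_atTop s] with x hx
    rw [h1 x hx]

end

lemma base {n₁ n₂ s m : ℝ} {V v : ℝ → ℝ} (hn₁ : 1 < n₁) (hn₂ : n₂ < 0)
    (hV : ∀ x, 0 < x → HasDerivAt V (-v x) x) (hv0 : ∀ x, 0 < x → 0 < v x)
    (hva : AntitoneOn v (Ioi 0)) (hvc : ContinuousOn v (Ioi 0)) (hm : ∀ x, 0 < x → m ≤ V x)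
    (hi : ∀ y, 0 < y → IntegrableOn (fun x => x ^ (-n₂) * v x) (Ioo 0 y)) :
    Good n₁ n₂ s V (fun x => - v x) := by
  have hVc : ContinuousOn V (Ioi 0) := fun x hx => (hV x hx).continuousAt.continuousWithinAt
  have hVa : AntitoneOn V (Ioi 0) := by
    refine antitoneOn_of_deriv_nonpos (convex_Ioi 0) hVc ?_ ?_
    · intro x hx
      rw [interior_Ioi] at hx
      exact (hV x hx).differentiableAt.differentiableWithinAt
    · intro x hx
      rw [interior_Ioi] at hx
      rw [(hV x hx).deriv]
      linarith [hv0 x hx]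
  set S : ℝ → ℝ := fun y => ∫ x in (0:ℝ)..y, x ^ (-n₂) * v x with hS
  have hSd : ∀ x, 0 < x → HasDerivAt S (x ^ (-n₂) * v x) x := by
    intro x hx
    have := (ftc ((rpow_cont (-n₂)).mul hvc) hx hx).const_add (S x)
    refine this.congr_of_eventuallyEq ?_
    filter_upwards [Ioi_mem_nhds hx] with z hz
    exact (intervalIntegral.integral_add_adjacent_intervals
      (ii_of_Ioo hi le_rfl hx.le) (ii_of_Ioo hi hx.le (le_of_lt hz))).symm
  have hS0 : S 0 = 0 := by simp [hS]
  have hSc : ∀ y, 0 < y → ContinuousOn S (Icc 0 y) := by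
    intro y hy
    have := intervalIntegral.continuousOn_primitive_interval (μ := volume) (a := 0) (b := y)
      (f := fun x => x ^ (-n₂) * v x) (by
        rw [uIcc_of_le hy.le, integrableOn_Icc_iff_integrableOn_Ioo]; exact hi y hy)
    rwa [uIcc_of_le hy.le] at this
  have hSl : Tendsto S (𝓝[>] 0) (𝓝 0) := by
    have := (hSc 1 one_pos) 0 ⟨le_rfl, zero_le_one⟩
    unfold ContinuousWithinAt at this
    rw [hS0] at this
    refine this.mono_left ?_
    rw [← nhdsWithin_Ioo_eq_nhdsGT one_pos]
    exact nhdsWithin_mono _ Ioo_subset_Icc_self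
  have hSn : ∀ y, 0 < y → 0 ≤ S y := by
    intro y hy
    refine intervalIntegral.integral_nonneg hy.le ?_
    intro x hx
    rcases hx.1.eq_or_lt with h | h
    · rw [← h, Real.zero_rpow (by linarith), zero_mul]
    · exact mul_nonneg (Real.rpow_nonneg hx.1 _) (hv0 x h).le
  have key : ∀ x y, 0 < x → x ≤ y → x ^ (-n₂) * V x ≤ S y + x ^ (-n₂) * V y := by
    intro x y hx hxy
    have mono : MonotoneOn (fun t => S t + x ^ (-n₂) * V t) (Icc x y) := by
      have hd : ∀ t, x ≤ t → HasDerivAt (fun t => S t + x ^ (-n₂) * V t)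
          (t ^ (-n₂) * v t + x ^ (-n₂) * (- v t)) t := fun t ht =>
        (hSd t (hx.trans_le ht)).add ((hV t (hx.trans_le ht)).const_mul _)
      refine monotoneOn_of_deriv_nonneg (convex_Icc x y) ?_ ?_ ?_
      · exact fun t ht => (hd t ht.1).continuousAt.continuousWithinAt
      · intro t ht
        rw [interior_Icc] at ht
        exact (hd t ht.1.le).differentiableAt.differentiableWithinAt
      · intro t ht
        rw [interior_Icc] at ht
        rw [(hd t ht.1.le).deriv]
        have h1 : x ^ (-n₂) ≤ t ^ (-n₂) := Real.rpow_le_rpow hx.le ht.1.le (by linarith)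
        have h2 := hv0 t (hx.trans ht.1)
        nlinarith
    have := mono ⟨le_rfl, hxy⟩ ⟨hxy, le_rfl⟩ hxy
    simp only at this
    linarith [hSn x hx]
  have l0 : Tendsto (fun x => x ^ (-n₂) * V x) (𝓝[>] 0) (𝓝 0) := by
    have hp := rpow_lim0 (show 0 < -n₂ by linarith)
    rw [Metric.tendsto_nhds]
    intro e he
    have h1 : ∀ᶠ y in 𝓝[>] 0, S y < e / 2 := hSl.eventually_lt_const (by positivity)
    obtain ⟨y, hy1, hy0⟩ := (h1.and self_mem_nhdsWithin).exists
    have hy0 : 0 < y := hy0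
    have hl := hp.mul_const (V y)
    have hl2 := hp.mul_const m
    rw [zero_mul] at hl hl2
    filter_upwards [hl.eventually_lt_const (show 0 < e / 2 by positivity),
      hl2.eventually_const_lt (show -e < 0 by linarith), Ioo_mem_nhdsGT hy0] with x a b hx
    rw [Real.dist_eq, sub_zero, abs_lt]
    have k1 := key x y hx.1 hx.2.le
    have k2 : x ^ (-n₂) * m ≤ x ^ (-n₂) * V x :=
      mul_le_mul_of_nonneg_left (hm x hx.1) (Real.rpow_nonneg hx.1.le _)
    constructor <;> linarith
  refine ⟨hVc, fun x hx _ => hV x hx, ?_, ?_, l0, ?_, ?_, ?_⟩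
  · intro y hy
    have hint : IntegrableOn (fun x => -n₂ * x ^ (-n₂ - 1) * (V x - m)) (Ioc 0 y) := by
      refine intervalIntegral.integrableOn_deriv_of_nonneg
        (g := fun x => x ^ (-n₂) * (V x - m) + S x) ?_ ?_ ?_
      · refine ContinuousOn.add ?_ (hSc y hy)
        intro x hx
        rcases hx.1.eq_or_lt with h0 | h0
        · subst h0
          have : ContinuousWithinAt (fun x => x ^ (-n₂) * (V x - m)) (Ioi 0) 0 := by
            unfold ContinuousWithinAt
            simp only
            rw [Real.zero_rpow (by linarith), zero_mul]
            have := l0.sub ((rpow_lim0 (show 0 < -n₂ by linarith)).mul_const m)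
            simp only [zero_mul, sub_zero] at this
            refine this.congr ?_
            intro x; ring
          refine this.insert.mono ?_
          intro y hy
          rcases hy.1.eq_or_lt with h | h
          · left; exact h.symm
          · right; exact h
        · exact (((rpow_cont _).mul (hVc.sub continuousOn_const)).continuousAt
            (Ioi_mem_nhds h0)).continuousWithinAt
      · intro x hx
        have := ((rpow_der (-n₂) hx.1).mul ((hV x hx.1).sub_const m)).add (hSd x hx.1)
        refine this.congr_deriv ?_
        ring
      · intro x hx
        have := hm x hx.1
        have h2 : 0 ≤ x ^ (-n₂ - 1) := Real.rpow_nonneg hx.1.le _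
        exact mul_nonneg (mul_nonneg (by linarith) h2) (by linarith)
    have h2 := ((hint.mono_set Ioo_subset_Ioc_self).const_mul ((-n₂)⁻¹)).add
      ((rpow_int0 (show -1 < -n₂ - 1 by linarith) hy).mul_const m)
    refine IntegrableOn.congr_fun h2 ?_ measurableSet_Ioo
    intro x hx
    have : n₂ ≠ 0 := hn₂.ne
    simp only [Pi.add_apply]
    field_simp
    ring
  · intro y hy
    simp_rw [mul_neg]; exact (hi y hy).neg
  · intro y hy
    have hr : IntegrableOn (fun x : ℝ => x ^ (-n₁ - 1)) (Ioi y) :=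
      integrableOn_Ioi_rpow_of_lt (by linarith) hy
    have h2 : IntegrableOn (fun x => V x * x ^ (-n₁ - 1)) (Ioi y) := by
      refine Integrable.bdd_mul (c := |m| + |V y|) hr ?_ ?_
      · exact (hVc.mono (fun x hx => hy.trans hx)).aestronglyMeasurable measurableSet_Ioi
      · refine (ae_restrict_mem measurableSet_Ioi).mono ?_
        intro x hx
        have a1 := hm x (hy.trans hx)
        have a2 := hVa hy (hy.trans hx : 0 < x) (le_of_lt hx)
        rw [Real.norm_eq_abs, abs_le]
        constructor <;> linarith [neg_abs_le m, le_abs_self (V y), abs_nonneg m, abs_nonneg (V y)]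
    simpa only [mul_comm] using h2
  · intro y hy
    have hr : IntegrableOn (fun x : ℝ => x ^ (-n₁)) (Ioi y) :=
      integrableOn_Ioi_rpow_of_lt (by linarith) hy
    have h2 : IntegrableOn (fun x => (-v x) * x ^ (-n₁)) (Ioi y) := by
      refine Integrable.bdd_mul (c := v y) hr ?_ ?_
      · exact (hvc.neg.mono (fun x hx => hy.trans hx)).aestronglyMeasurable measurableSet_Ioi
      · refine (ae_restrict_mem measurableSet_Ioi).mono ?_
        intro x hx
        have a1 := hv0 x (hy.trans hx)
        have a2 := hva hy (hy.trans hx : 0 < x) (le_of_lt hx)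
        rw [norm_neg, Real.norm_eq_abs, abs_of_pos a1]
        exact a2
    simpa only [mul_comm] using h2
  · have hp := tendsto_rpow_neg_atTop (show 0 < n₁ by linarith)
    have t1 := hp.mul_const m
    have t2 := hp.mul_const (V 1)
    rw [zero_mul] at t1 t2
    refine tendsto_of_tendsto_of_tendsto_of_le_of_le' t1 t2 ?_ ?_
    · filter_upwards [eventually_gt_atTop 0] with x hx
      exact mul_le_mul_of_nonneg_left (hm x hx) (Real.rpow_nonneg hx.le _)
    · filter_upwards [eventually_gt_atTop 1] with x hx
      have h0 : (0:ℝ) < x := by linarith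
      exact mul_le_mul_of_nonneg_left (hVa (one_pos : (0:ℝ) < 1) h0 hx.le)
        (Real.rpow_nonneg h0.le _)


lemma derI {f : ℝ → ℝ} (hc : ContinuousOn f (Ioi 0)) (hf : ∀ y, 0 < y → IntegrableOn f (Ioi y))
    {z : ℝ} (hz : 0 < z) : HasDerivAt (fun z => ∫ x in Ioi z, f x) (-f z) z := by
  have := (ftc hc hz hz).const_sub (∫ x in Ioi z, f x)
  refine this.congr_of_eventuallyEq ?_
  filter_upwards [Ioi_mem_nhds hz] with y hy
  exact split1 hf hz hy

lemma derO {f : ℝ → ℝ} (hc : ContinuousOn f (Ioi 0)) (hf : ∀ y, 0 < y → IntegrableOn f (Ioo 0 y))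
    {z : ℝ} (hz : 0 < z) : HasDerivAt (fun z => ∫ x in Ioo 0 z, f x) (f z) z := by
  have := (ftc hc hz hz).const_add (∫ x in Ioo 0 z, f x)
  refine this.congr_of_eventuallyEq ?_
  filter_upwards [Ioi_mem_nhds hz] with y hy
  exact split0 hf hz hy

lemma term_der {n k : ℝ} {A G : ℝ → ℝ} {z : ℝ} (hz : 0 < z)
    (hA : HasDerivAt A (k * (z ^ (-n - 1) * G z)) z) :
    HasDerivAt (fun z => z ^ n * A z) ((n * (z ^ n * A z) + k * G z) / z) z := by
  refine ((rpow_der n hz).mul hA).congr_deriv ?_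
  have : z ^ n ≠ 0 := (Real.rpow_pos_of_pos hz n).ne'
  rw [Real.rpow_sub_one hz.ne', Real.rpow_sub_one hz.ne', Real.rpow_neg hz.le]
  field_simp

section
variable {n₁ n₂ c δ r θ : ℝ} {A B G F : ℝ → ℝ}

lemma F_der (hA : ∀ z, 0 < z → HasDerivAt A (-c * (z ^ (-n₁ - 1) * G z)) z)
    (hB : ∀ z, 0 < z → HasDerivAt B (c * (z ^ (-n₂ - 1) * G z)) z)
    (hF : ∀ z, 0 < z → F z = z ^ n₁ * A z + z ^ n₂ * B z) {z : ℝ} (hz : 0 < z) :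
    HasDerivAt F ((n₁ * (z ^ n₁ * A z) + n₂ * (z ^ n₂ * B z)) / z) z := by
  have h1 : HasDerivAt F ((n₁ * (z ^ n₁ * A z) + -c * G z) / z +
      (n₂ * (z ^ n₂ * B z) + c * G z) / z) z := by
    refine ((term_der hz (hA z hz)).add (term_der hz (hB z hz))).congr_of_eventuallyEq ?_
    filter_upwards [Ioi_mem_nhds hz] with y hy
    exact hF y hy
  refine h1.congr_deriv ?_
  field_simp
  ring

lemma F_der2 (hA : ∀ z, 0 < z → HasDerivAt A (-c * (z ^ (-n₁ - 1) * G z)) z)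
    (hB : ∀ z, 0 < z → HasDerivAt B (c * (z ^ (-n₂ - 1) * G z)) z) {z : ℝ} (hz : 0 < z) :
    HasDerivAt (fun z => (n₁ * (z ^ n₁ * A z) + n₂ * (z ^ n₂ * B z)) / z)
      ((n₁ * (n₁ - 1) * (z ^ n₁ * A z) + n₂ * (n₂ - 1) * (z ^ n₂ * B z)
        - c * (n₁ - n₂) * G z) / z ^ 2) z := by
  refine ((((term_der hz (hA z hz)).const_mul n₁).add
    ((term_der hz (hB z hz)).const_mul n₂)).div (hasDerivAt_id z) hz.ne').congr_deriv ?_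
  simp only [Pi.add_apply, id]
  field_simp
  ring

lemma F_cont2 (hA : ∀ z, 0 < z → HasDerivAt A (-c * (z ^ (-n₁ - 1) * G z)) z)
    (hB : ∀ z, 0 < z → HasDerivAt B (c * (z ^ (-n₂ - 1) * G z)) z)
    (hG : ContinuousOn G (Ioi 0)) {z : ℝ} (hz : 0 < z) :
    ContinuousAt (fun z => (n₁ * (n₁ - 1) * (z ^ n₁ * A z) + n₂ * (n₂ - 1) * (z ^ n₂ * B z)
        - c * (n₁ - n₂) * G z) / z ^ 2) z := by
  have h1 := (term_der hz (hA z hz)).continuousAt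
  have h2 := (term_der hz (hB z hz)).continuousAt
  have h3 := hG.continuousAt (Ioi_mem_nhds hz)
  exact (((h1.const_mul _).add (h2.const_mul _)).sub (h3.const_mul _)).div
    (continuousAt_id.pow 2) (by simp [hz.ne'])

lemma F_ode (hθ : θ ≠ 0) (hn : n₁ - n₂ ≠ 0) (hc : c = 2 / (θ ^ 2 * (n₁ - n₂)))
    (hroot₁ : θ ^ 2 / 2 * n₁ ^ 2 + (δ - r - θ ^ 2 / 2) * n₁ - δ = 0)
    (hroot₂ : θ ^ 2 / 2 * n₂ ^ 2 + (δ - r - θ ^ 2 / 2) * n₂ - δ = 0) (a b G : ℝ) {z : ℝ}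
    (hz : 0 < z) :
    θ ^ 2 / 2 * z ^ 2 * ((n₁ * (n₁ - 1) * a + n₂ * (n₂ - 1) * b
        - c * (n₁ - n₂) * G) / z ^ 2) + (δ - r) * z * ((n₁ * a + n₂ * b) / z) - δ * (a + b) = - G := by
  have e : c * (n₁ - n₂) * θ ^ 2 = 2 := by rw [hc]; field_simp
  have e1 : θ ^ 2 / 2 * z ^ 2 * ((n₁ * (n₁ - 1) * a + n₂ * (n₂ - 1) * b
        - c * (n₁ - n₂) * G) / z ^ 2) = θ ^ 2 / 2 * ((n₁ * (n₁ - 1) * a + n₂ * (n₂ - 1) * b)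
        - c * (n₁ - n₂) * G) := by field_simp
  have e2 : (δ - r) * z * ((n₁ * a + n₂ * b) / z) = (δ - r) * (n₁ * a + n₂ * b) := by field_simp
  rw [e1, e2]
  linear_combination a * hroot₁ + b * hroot₂ - G / 2 * e

end

lemma mvt {f f' : ℝ → ℝ} {a b : ℝ} (hab : a < b) (hd : ∀ x ∈ Icc a b, HasDerivAt f (f' x) x)
    (h : f a < f b) : ∃ x ∈ Ioo a b, 0 < f' x := by
  obtain ⟨x, hx, e⟩ := exists_hasDerivAt_eq_slope f f' hab
    (fun x hx => (hd x hx).continuousAt.continuousWithinAt)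
    (fun x hx => hd x (Ioo_subset_Icc_self hx))
  refine ⟨x, hx, ?_⟩
  rw [e]
  exact div_pos (by linarith) (by linarith)

lemma glue_der {f p q : ℝ → ℝ} {a b x d : ℝ} (ha : a < x) (hb : x < b)
    (hp : ∀ y, a < y → y ≤ x → f y = p y) (hq : ∀ y, x ≤ y → y < b → f y = q y)
    (dp : HasDerivAt p d x) (dq : HasDerivAt q d x) : HasDerivAt f d x := by
  have h1 : HasDerivWithinAt f d (Iic x) x := by
    refine dp.hasDerivWithinAt.congr_of_eventuallyEq ?_ (hp x ha le_rfl)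
    filter_upwards [self_mem_nhdsWithin, mem_nhdsWithin_of_mem_nhds (Ioi_mem_nhds ha)] with y h h'
    exact hp y h' h
  have h2 : HasDerivWithinAt f d (Ici x) x := by
    refine dq.hasDerivWithinAt.congr_of_eventuallyEq ?_ (hq x le_rfl hb)
    filter_upwards [self_mem_nhdsWithin, mem_nhdsWithin_of_mem_nhds (Iio_mem_nhds hb)] with y h h'
    exact hq y h h'
  have := h1.union h2
  rwa [Iic_union_Ici, hasDerivWithinAt_univ] at this

lemma glue_cont {f p q : ℝ → ℝ} {a b x : ℝ} (ha : a < x) (hb : x < b)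
    (hp : ∀ y, a < y → y ≤ x → f y = p y) (hq : ∀ y, x ≤ y → y < b → f y = q y)
    (dp : ContinuousAt p x) (dq : ContinuousAt q x) : ContinuousAt f x := by
  have h1 : ContinuousWithinAt f (Iic x) x := by
    refine dp.continuousWithinAt.congr_of_eventuallyEq ?_ (hp x ha le_rfl)
    filter_upwards [self_mem_nhdsWithin, mem_nhdsWithin_of_mem_nhds (Ioi_mem_nhds ha)] with y h h'
    exact hp y h' h
  have h2 : ContinuousWithinAt f (Ici x) x := by
    refine dq.continuousWithinAt.congr_of_eventuallyEq ?_ (hq x le_rfl hb)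
    filter_upwards [self_mem_nhdsWithin, mem_nhdsWithin_of_mem_nhds (Iio_mem_nhds hb)] with y h h'
    exact hq y h h'
  have := h1.union h2
  rwa [Iic_union_Ici, continuousWithinAt_univ] at this


set_option maxHeartbeats 2000000 in
lemma core
    {δ r θ n₁ n₂ s c zhat : ℝ}
    (hθ : θ ≠ 0) (hδ : 0 < δ)
    (hn₂0 : n₂ < 0) (hn₁1 : 1 < n₁)
    (hroot₁ : θ ^ 2 / 2 * n₁ ^ 2 + (δ - r - θ ^ 2 / 2) * n₁ - δ = 0)
    (hroot₂ : θ ^ 2 / 2 * n₂ ^ 2 + (δ - r - θ ^ 2 / 2) * n₂ - δ = 0)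
    (hc : c = 2 / (θ ^ 2 * (n₁ - n₂)))
    {ut I h g : ℝ → ℝ}
    (HU : Good n₁ n₂ s ut (fun x => - I x)) (hI : ∀ x, 0 < x → 0 < I x)
    (HG : Good n₁ n₂ s (fun x => ut x + h x) g) (gm : MonotoneOn g (Ioi 0))
    (hneg : ∀ x, 0 < x → x < zhat → h x < 0) (hpos : ∀ x, zhat < x → 0 < h x)
    (hz0 : h zhat = 0)
    {J_R : ℝ → ℝ}
    (hJR : ∀ y : ℝ, 0 < y → J_R y = c *
      (y ^ n₂ * (∫ η in Set.Ioo 0 y, η ^ (-n₂ - 1) * ut η) +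
       y ^ n₁ * ∫ η in Set.Ioi y, η ^ (-n₁ - 1) * ut η))
    {z_R z_B : ℝ} (hzR_pos : 0 < z_R) (hzR_lt : z_R < zhat) (hzRB : z_R < z_B)
    (hφ₁ : (∫ η in Set.Ioi z_B, η ^ (-n₁) * g η) -
        n₁ * ∫ η in Set.Ioi z_R, η ^ (-n₁ - 1) * h η = 0)
    (hφ₂ : (∫ η in Set.Ioo 0 z_B, η ^ (-n₂) * g η) -
        n₂ * ∫ η in Set.Ioo 0 z_R, η ^ (-n₂ - 1) * h η = 0)
    {E₁ E₂ : ℝ}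
    (hE₁ : E₁ = -c * ∫ η in Set.Ioi z_R, η ^ (-n₁ - 1) * h η)
    (hE₂ : E₂ = -c * ∫ η in Set.Ioo 0 z_R, η ^ (-n₂ - 1) * h η)
    {Ψ : ℝ → ℝ}
    (hΨ : ∀ z : ℝ, 0 < z → Ψ z = c *
      (z ^ n₂ * (∫ η in Set.Ioo 0 z, η ^ (-n₂ - 1) * h η) +
       z ^ n₁ * ∫ η in Set.Ioi z, η ^ (-n₁ - 1) * h η))
    {Q : ℝ → ℝ}
    (hQ₁ : ∀ z : ℝ, 0 < z → z ≤ z_R → Q z = J_R z)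
    (hQ₂ : ∀ z : ℝ, z_R ≤ z → z ≤ z_B → Q z = E₁ * z ^ n₁ + E₂ * z ^ n₂ + Ψ z + J_R z)
    (hQ₃ : ∀ z : ℝ, z_B ≤ z → Q z = E₁ * z_B ^ n₁ + E₂ * z_B ^ n₂ + Ψ z_B + J_R z_B)
    :
    ∃ Q' Q'' : ℝ → ℝ,
      (∀ z : ℝ, 0 < z → HasDerivAt Q (Q' z) z) ∧
      ContinuousOn Q' (Set.Ioi 0) ∧
      (∀ z : ℝ, 0 < z → z ≠ z_R → HasDerivAt Q' (Q'' z) z) ∧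
      ContinuousOn Q'' (Set.Ioi 0 \ {z_R}) ∧
      ∀ z : ℝ, 0 < z → z ≠ z_R →
        max (min (θ ^ 2 / 2 * z ^ 2 * Q'' z + (δ - r) * z * Q' z - δ * Q z + ut z + h z)
            (-Q' z))
          (J_R z - Q z) = 0 := by
  have hzB : 0 < z_B := hzR_pos.trans hzRB
  have hd : 0 < n₁ - n₂ := by linarith
  have hc0 : 0 < c := by rw [hc]; have := sq_pos_of_ne_zero hθ; positivity
  obtain ⟨gh, HH⟩ : ∃ gh, Good n₁ n₂ s h gh := by
    have := HG.add HU.neg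
    simp only [add_neg_cancel_comm] at this
    exact ⟨_, this⟩
  -- coefficient functions
  set AJ : ℝ → ℝ := fun z => c * ∫ η in Ioi z, η ^ (-n₁ - 1) * ut η with hAJ
  set BJ : ℝ → ℝ := fun z => c * ∫ η in Ioo 0 z, η ^ (-n₂ - 1) * ut η with hBJ
  set AP : ℝ → ℝ := fun z => -c * ∫ η in z_R..z, η ^ (-n₁ - 1) * h η with hAP
  set BP : ℝ → ℝ := fun z => c * ∫ η in z_R..z, η ^ (-n₂ - 1) * h η with hBP
  have dAJ : ∀ z, 0 < z → HasDerivAt AJ (-c * (z ^ (-n₁ - 1) * ut z)) z := fun z hz =>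
    ((derI ((rpow_cont _).mul HU.cont) HU.j1 hz).const_mul c).congr_deriv (by
      simp only [Pi.mul_apply]; ring)
  have dBJ : ∀ z, 0 < z → HasDerivAt BJ (c * (z ^ (-n₂ - 1) * ut z)) z := fun z hz =>
    ((derO ((rpow_cont _).mul HU.cont) HU.i1 hz).const_mul c)
  have dAP : ∀ z, 0 < z → HasDerivAt AP (-c * (z ^ (-n₁ - 1) * h z)) z := fun z hz =>
    ((ftc ((rpow_cont _).mul HH.cont) hzR_pos hz).const_mul (-c))
  have dBP : ∀ z, 0 < z → HasDerivAt BP (c * (z ^ (-n₂ - 1) * h z)) z := fun z hz =>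
    ((ftc ((rpow_cont _).mul HH.cont) hzR_pos hz).const_mul c)
  set AM : ℝ → ℝ := fun z => AJ z + AP z with hAM
  set BM : ℝ → ℝ := fun z => BJ z + BP z with hBM
  have dAM : ∀ z, 0 < z → HasDerivAt AM (-c * (z ^ (-n₁ - 1) * (ut z + h z))) z := fun z hz =>
    ((dAJ z hz).add (dAP z hz)).congr_deriv (by ring)
  have dBM : ∀ z, 0 < z → HasDerivAt BM (c * (z ^ (-n₂ - 1) * (ut z + h z))) z := fun z hz =>
    ((dBJ z hz).add (dBP z hz)).congr_deriv (by ring)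
  set P : ℝ → ℝ := fun z => z ^ n₁ * AP z + z ^ n₂ * BP z with hP
  set M : ℝ → ℝ := fun z => z ^ n₁ * AM z + z ^ n₂ * BM z with hM
  have hJ : ∀ z, 0 < z → J_R z = z ^ n₁ * AJ z + z ^ n₂ * BJ z := fun z hz => by
    rw [hJR z hz]; ring
  have hMJP : ∀ z, 0 < z → M z = J_R z + P z := fun z hz => by
    rw [hJ z hz]; simp only [hM, hP, hAM, hBM]; ring
  have hmid : ∀ z, 0 < z → E₁ * z ^ n₁ + E₂ * z ^ n₂ + Ψ z + J_R z = M z := fun z hz => by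
    rw [hMJP z hz, hΨ z hz, hE₁, hE₂, split0 HH.i1 hzR_pos hz, split1 HH.j1 hzR_pos hz]
    simp only [hP, hAP, hBP]; ring
  set J1 : ℝ → ℝ := fun z => (n₁ * (z ^ n₁ * AJ z) + n₂ * (z ^ n₂ * BJ z)) / z with hJ1
  set M1 : ℝ → ℝ := fun z => (n₁ * (z ^ n₁ * AM z) + n₂ * (z ^ n₂ * BM z)) / z with hM1
  set J2 : ℝ → ℝ := fun z => (n₁ * (n₁ - 1) * (z ^ n₁ * AJ z) + n₂ * (n₂ - 1) * (z ^ n₂ * BJ z)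
        - c * (n₁ - n₂) * ut z) / z ^ 2 with hJ2
  set M2 : ℝ → ℝ := fun z => (n₁ * (n₁ - 1) * (z ^ n₁ * AM z) + n₂ * (n₂ - 1) * (z ^ n₂ * BM z)
        - c * (n₁ - n₂) * (ut z + h z)) / z ^ 2 with hM2
  have dJ : ∀ z, 0 < z → HasDerivAt J_R (J1 z) z := fun z hz => F_der dAJ dBJ hJ hz
  have dM : ∀ z, 0 < z → HasDerivAt M (M1 z) z := fun z hz =>
    F_der (G := fun z => ut z + h z) dAM dBM (fun _ _ => rfl) hz
  have dJ1 : ∀ z, 0 < z → HasDerivAt J1 (J2 z) z := fun z hz => F_der2 dAJ dBJ hz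
  have dM1 : ∀ z, 0 < z → HasDerivAt M1 (M2 z) z := fun z hz =>
    F_der2 (G := fun z => ut z + h z) dAM dBM hz
  have cJ2 : ∀ z, 0 < z → ContinuousAt J2 z := fun z hz => F_cont2 dAJ dBJ HU.cont hz
  have cM2 : ∀ z, 0 < z → ContinuousAt M2 z := fun z hz =>
    F_cont2 (G := fun z => ut z + h z) dAM dBM HG.cont hz
  have odeJ : ∀ z, 0 < z → θ ^ 2 / 2 * z ^ 2 * J2 z + (δ - r) * z * J1 z - δ * J_R z = - ut z := by
    intro z hz; rw [hJ z hz]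
    exact F_ode hθ hd.ne' hc hroot₁ hroot₂ _ _ _ hz
  have odeM : ∀ z, 0 < z →
      θ ^ 2 / 2 * z ^ 2 * M2 z + (δ - r) * z * M1 z - δ * M z = - (ut z + h z) := by
    intro z hz
    exact F_ode hθ hd.ne' hc hroot₁ hroot₂ _ _ _ hz
  -- J1 negative
  have rp : ∀ (n z : ℝ), 0 < z → z ^ n * z ^ (-n) = 1 := fun n z hz => by
    rw [← Real.rpow_add hz]; simp
  have J1neg : ∀ z, 0 < z → J1 z < 0 := by
    intro z hz
    have p0 := HU.parts0 hn₂0 hz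
    have p1 := HU.parts1 hz
    have q1 := rp n₁ z hz
    have q2 := rp n₂ z hz
    refine div_neg_of_neg_of_pos ?_ hz
    have x0 : ∫ x in Ioo 0 z, x ^ (-n₂) * -I x ≤ 0 := by
      refine setIntegral_nonpos measurableSet_Ioo ?_
      intro x hx
      have := hI x hx.1
      have := Real.rpow_pos_of_pos hx.1 (-n₂)
      nlinarith
    have x1 : ∫ x in Ioi z, x ^ (-n₁) * -I x < 0 := by
      have : 0 < ∫ x in Ioi z, x ^ (-n₁) * I x := by
        rw [setIntegral_pos_iff_support_of_nonneg_ae]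
        · have : Function.support (fun x => x ^ (-n₁) * I x) ∩ Ioi z = Ioi z := by
            rw [inter_eq_right]
            intro x hx
            have hx0 : 0 < x := hz.trans hx
            exact (mul_pos (Real.rpow_pos_of_pos hx0 _) (hI x hx0)).ne'
          rw [this]; simp
        · refine (ae_restrict_mem measurableSet_Ioi).mono ?_
          intro x hx
          have hx0 : 0 < x := hz.trans hx
          exact (mul_pos (Real.rpow_pos_of_pos hx0 _) (hI x hx0)).le
        · have := (HU.j2 z hz).neg
          refine IntegrableOn.congr_fun this ?_ measurableSet_Ioi
          intro x hx
          simp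
      simp_rw [mul_neg]
      rw [integral_neg]; linarith
    have r1 := Real.rpow_pos_of_pos hz n₁
    have r2 := Real.rpow_pos_of_pos hz n₂
    have : n₁ * (z ^ n₁ * AJ z) + n₂ * (z ^ n₂ * BJ z) =
      c * (z ^ n₁ * (∫ x in Ioi z, x ^ (-n₁) * -I x) + z ^ n₂ * ∫ x in Ioo 0 z, x ^ (-n₂) * -I x) := by
      simp only [hAJ, hBJ]
      linear_combination c * z ^ n₁ * p1 + c * z ^ n₂ * p0 + c * ut z * q1 - c * ut z * q2
    rw [this]
    have y0 : z ^ n₂ * (∫ x in Ioo 0 z, x ^ (-n₂) * -I x) ≤ 0 :=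
      mul_nonpos_of_nonneg_of_nonpos r2.le x0
    have y1 : z ^ n₁ * (∫ x in Ioi z, x ^ (-n₁) * -I x) < 0 := mul_neg_of_pos_of_neg r1 x1
    exact mul_neg_of_pos_of_neg hc0 (by linarith)
  -- by-parts representation of the middle branch
  set m₁ : ℝ → ℝ := fun z => ∫ x in z..z_B, x ^ (-n₁) * g x with hm₁
  set m₂ : ℝ → ℝ := fun z => ∫ x in z..z_B, x ^ (-n₂) * g x with hm₂
  have rA : ∀ z, 0 < z → n₁ * (z ^ n₁ * AM z) = c * ((ut z + h z) + z ^ n₁ * m₁ z) := by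
    intro z hz
    have p1 := HG.parts1 hz
    have q1 := rp n₁ z hz
    have e1 : ∫ x in Ioi z, x ^ (-n₁ - 1) * (ut x + h x) =
        (∫ x in Ioi z, x ^ (-n₁ - 1) * ut x) + ∫ x in Ioi z, x ^ (-n₁ - 1) * h x := by
      rw [← integral_add (HU.j1 z hz) (HH.j1 z hz)]; simp_rw [mul_add]
    have e2 := split1 HH.j1 hzR_pos hz
    have e3 := split1 HG.j2 hz hzB
    simp only [hAM, hAJ, hAP, hm₁]
    rw [e1] at p1
    linear_combination c * z ^ n₁ * p1 + c * (ut z + h z) * q1 - c * z ^ n₁ * n₁ * e2 - c * z ^ n₁ * e3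
      + c * z ^ n₁ * hφ₁
  have rB : ∀ z, 0 < z → n₂ * (z ^ n₂ * BM z) = -c * ((ut z + h z) + z ^ n₂ * m₂ z) := by
    intro z hz
    have p1 := HG.parts0 hn₂0 hz
    have q1 := rp n₂ z hz
    have e1 : ∫ x in Ioo 0 z, x ^ (-n₂ - 1) * (ut x + h x) =
        (∫ x in Ioo 0 z, x ^ (-n₂ - 1) * ut x) + ∫ x in Ioo 0 z, x ^ (-n₂ - 1) * h x := by
      rw [← integral_add (HU.i1 z hz) (HH.i1 z hz)]; simp_rw [mul_add]
    have e2 := split0 HH.i1 hzR_pos hz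
    have e3 := split0 HG.i2 hz hzB
    simp only [hBM, hBJ, hBP, hm₂]
    rw [e1] at p1
    linear_combination c * z ^ n₂ * p1 - c * (ut z + h z) * q1 - c * z ^ n₂ * n₂ * e2 - c * z ^ n₂ * e3
      + c * z ^ n₂ * hφ₂
  have m1B : m₁ z_B = 0 := by simp [hm₁]
  have m2B : m₂ z_B = 0 := by simp [hm₂]
  have M1B : M1 z_B = 0 := by
    simp only [hM1]; rw [rA _ hzB, rB _ hzB, m1B, m2B]; ring
  have M2B : M2 z_B = 0 := by
    have a := rA _ hzB
    have b := rB _ hzB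
    rw [m1B] at a
    rw [m2B] at b
    simp only [hM2]
    rw [div_eq_zero_iff]
    left
    linear_combination (n₁ - 1) * a + (n₂ - 1) * b
  have hPR : P z_R = 0 := by simp [hP, hAP, hBP]
  have M1R : M1 z_R = J1 z_R := by simp [hM1, hJ1, hAM, hBM, hAP, hBP]
  have hgi : ∀ a b, 0 < a → 0 < b → IntervalIntegrable (fun x => x ^ (-n₁) * g x) volume a b :=
    fun a b ha hb => ii_of_Ioi HG.j2 ha hb
  have hm1s : ∀ a b, 0 < a → 0 < b → m₁ a = (∫ x in a..b, x ^ (-n₁) * g x) + m₁ b := by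
    intro a b ha hb
    simp only [hm₁]
    rw [intervalIntegral.integral_add_adjacent_intervals (hgi a b ha hb) (hgi b _ hb hzB)]
  have int_pos : ∀ a b, 0 < a → a ≤ b → 0 ≤ g a → 0 ≤ ∫ x in a..b, x ^ (-n₁) * g x := by
    intro a b ha hab hg
    refine intervalIntegral.integral_nonneg hab ?_
    intro x hx
    have hx0 : 0 < x := ha.trans_le hx.1
    exact mul_nonneg (Real.rpow_nonneg hx0.le _) (hg.trans (gm ha hx0 hx.1))
  have int_neg : ∀ a b, 0 < a → a ≤ b → g b ≤ 0 → ∫ x in a..b, x ^ (-n₁) * g x ≤ 0 := by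
    intro a b ha hab hg
    have : 0 ≤ ∫ x in a..b, -(x ^ (-n₁) * g x) := by
      refine intervalIntegral.integral_nonneg hab ?_
      intro x hx
      have hx0 : 0 < x := ha.trans_le hx.1
      have := gm hx0 (ha.trans_le hab : 0 < b) hx.2
      have := Real.rpow_nonneg hx0.le (-n₁)
      nlinarith
    rw [intervalIntegral.integral_neg] at this
    linarith
  -- the function v
  set v : ℝ → ℝ := fun z => z ^ (-n₂) * (n₁ * (z ^ n₁ * AM z) + n₂ * (z ^ n₂ * BM z)) with hv
  set v' : ℝ → ℝ := fun z => (z ^ (-n₂) / z * (n₁ - n₂) * c * z ^ n₁) * m₁ z with hv'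
  have dv : ∀ z, 0 < z → HasDerivAt v (v' z) z := by
    intro z hz
    have t1 := term_der (G := fun z => ut z + h z) hz (dAM z hz)
    have t2 := term_der (G := fun z => ut z + h z) hz (dBM z hz)
    refine ((rpow_der (-n₂) hz).mul ((t1.const_mul n₁).add (t2.const_mul n₂))).congr_deriv ?_
    have a := rA z hz
    simp only [hv', Pi.add_apply]
    rw [Real.rpow_sub_one hz.ne']
    field_simp
    linear_combination (n₁ - n₂) * a
  have v'c : ∀ z, 0 < z → 0 < (z ^ (-n₂) / z * (n₁ - n₂) * c * z ^ n₁) := by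
    intro z hz
    have := Real.rpow_pos_of_pos hz n₁
    have := Real.rpow_pos_of_pos hz (-n₂)
    positivity
  have vM : ∀ z, 0 < z → v z = z ^ (-n₂) * z * M1 z := by
    intro z hz; simp only [hv, hM1]; field_simp
  have vR : v z_R < 0 := by
    rw [vM _ hzR_pos, M1R]
    have := Real.rpow_pos_of_pos hzR_pos (-n₂)
    exact mul_neg_of_pos_of_neg (by positivity) (J1neg _ hzR_pos)
  have vB : v z_B = 0 := by rw [vM _ hzB, M1B, mul_zero]
  have gB : 0 < g z_B := by
    obtain ⟨x, hx, hx'⟩ := mvt (f := v) hzRB (fun x hx => dv x (hzR_pos.trans_le hx.1))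
      (by rw [vB]; exact vR)
    have hx0 : 0 < x := hzR_pos.trans hx.1
    have : 0 < m₁ x := pos_of_mul_pos_right hx' (v'c x hx0).le
    by_contra hcon
    have := int_neg x z_B hx0 hx.2.le (not_lt.mp hcon)
    simp only [hm₁] at *
    linarith
  have vneg : ∀ z, z_R ≤ z → z ≤ z_B → v z ≤ 0 := by
    intro z h1 h2
    by_contra hcon
    push Not at hcon
    have l1 : z_R < z := lt_of_le_of_ne h1 (by rintro rfl; linarith)
    have l2 : z < z_B := lt_of_le_of_ne h2 (by rintro rfl; linarith)
    have hz0 : 0 < z := hzR_pos.trans l1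
    obtain ⟨x, hx, hx'⟩ := mvt (f := v) l1 (fun x hx => dv x (hzR_pos.trans_le hx.1)) (by linarith)
    obtain ⟨y, hy, hy'⟩ := mvt (f := fun z => - v z) l2
      (fun x hx => (dv x (hz0.trans_le hx.1)).neg) (by linarith)
    have hx0 : 0 < x := hzR_pos.trans hx.1
    have hy0 : 0 < y := hz0.trans hy.1
    have mx : 0 < m₁ x := pos_of_mul_pos_right hx' (v'c x hx0).le
    have my : m₁ y < 0 := by
      have : 0 < (y ^ (-n₂) / y * (n₁ - n₂) * c * y ^ n₁) * (- m₁ y) := by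
        simp only [hv'] at hy'; linarith
      have := pos_of_mul_pos_right this (v'c y hy0).le
      linarith
    have gy : g y ≤ 0 := by
      by_contra hg
      have := int_pos y z_B hy0 hy.2.le (not_le.mp hg).le
      simp only [hm₁] at my
      linarith
    have hxy : x ≤ y := (hx.2.trans hy.1).le
    have := int_neg x y hx0 hxy gy
    have := hm1s x y hx0 hy0
    linarith
  have M1neg : ∀ z, z_R ≤ z → z ≤ z_B → M1 z ≤ 0 := by
    intro z h1 h2
    have hz0 : 0 < z := hzR_pos.trans_le h1
    have := vneg z h1 h2
    rw [vM z hz0] at this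
    have hp : 0 < z ^ (-n₂) * z := mul_pos (Real.rpow_pos_of_pos hz0 _) hz0
    by_contra hcon
    have := mul_pos hp (not_le.mp hcon)
    linarith
  -- P nonneg
  set q : ℝ → ℝ := fun z => z ^ (-n₁) * (z ^ n₁ * AP z + z ^ n₂ * BP z) with hq
  have dq : ∀ z, 0 < z → HasDerivAt q (-(z ^ (-n₁) / z * (n₁ - n₂) * z ^ n₂ * BP z)) z := by
    intro z hz
    have t1 := term_der (G := h) hz (dAP z hz)
    have t2 := term_der (G := h) hz (dBP z hz)
    refine ((rpow_der (-n₁) hz).mul (t1.add t2)).congr_deriv ?_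
    simp only [Pi.add_apply]
    rw [Real.rpow_sub_one hz.ne']
    field_simp
    ring
  have q'c : ∀ z, 0 < z → 0 < (z ^ (-n₁) / z * (n₁ - n₂) * z ^ n₂) := by
    intro z hz
    have := Real.rpow_pos_of_pos hz n₂
    have := Real.rpow_pos_of_pos hz (-n₁)
    positivity
  have hhi : ∀ a b, 0 < a → 0 < b → IntervalIntegrable (fun x => x ^ (-n₂ - 1) * h x) volume a b :=
    fun a b ha hb => ii_of_Ioo HH.i1 ha.le hb.le
  have qneg : ∀ z, z_R ≤ z → z ≤ z_B → 0 ≤ q z := by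
    intro z h1 h2
    by_contra hcon
    push Not at hcon
    have qR : q z_R = 0 := by
      change z_R ^ (-n₁) * P z_R = 0
      rw [hPR, mul_zero]
    have l1 : z_R < z := lt_of_le_of_ne h1 (by rintro rfl; linarith)
    have hz0' : 0 < z := hzR_pos.trans l1
    obtain ⟨x, hx, hx'⟩ := mvt (f := fun z => - q z) l1
      (fun x hx => (dq x (hzR_pos.trans_le hx.1)).neg) (by linarith)
    have hx0 : 0 < x := hzR_pos.trans hx.1
    rw [neg_neg] at hx'
    have bx : 0 < BP x := pos_of_mul_pos_right hx' (q'c x hx0).le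
    have xz : zhat < x := by
      by_contra hle
      push Not at hle
      have : 0 ≤ ∫ η in z_R..x, -(η ^ (-n₂ - 1) * h η) := by
        refine intervalIntegral.integral_nonneg hx.1.le ?_
        intro y hy
        have hy0 : 0 < y := hzR_pos.trans_le hy.1
        have r := Real.rpow_nonneg hy0.le (-n₂ - 1)
        have : h y ≤ 0 := by
          rcases (hy.2.trans hle).eq_or_lt with e | e
          · rw [e, hz0]
          · exact (hneg y hy0 e).le
        nlinarith
      rw [intervalIntegral.integral_neg] at this
      have b2 : (0:ℝ) < ∫ η in z_R..x, η ^ (-n₂ - 1) * h η := pos_of_mul_pos_right bx hc0.le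
      linarith
    have bmono : ∀ y, x ≤ y → 0 < BP y := by
      intro y hxy
      have hy0 : 0 < y := hx0.trans_le hxy
      have e : BP y = BP x + c * ∫ η in x..y, η ^ (-n₂ - 1) * h η := by
        simp only [hBP]
        rw [← intervalIntegral.integral_add_adjacent_intervals (hhi z_R x hzR_pos hx0)
          (hhi x y hx0 hy0)]
        ring
      have : 0 ≤ ∫ η in x..y, η ^ (-n₂ - 1) * h η := by
        refine intervalIntegral.integral_nonneg hxy ?_
        intro t ht
        have ht0 : 0 < t := hx0.trans_le ht.1
        exact mul_nonneg (Real.rpow_nonneg ht0.le _) (hpos t (xz.trans_le ht.1)).le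
      rw [e]
      have := mul_nonneg hc0.le this
      linarith
    have qB : q z_B < 0 := by
      rcases h2.eq_or_lt with e | l2
      · rw [← e]; exact hcon
      · by_contra hq0
        obtain ⟨y, hy, hy'⟩ := mvt (f := q) l2
          (fun x hx => dq x (hz0'.trans_le hx.1)) (by linarith)
        have := mul_pos (q'c y (hz0'.trans hy.1)) (bmono y (hx.2.trans hy.1).le)
        linarith
    have bB := bmono z_B (hx.2.le.trans h2)
    have PB : z_B ^ n₁ * AP z_B + z_B ^ n₂ * BP z_B < 0 := by
      by_contra hcc
      have := mul_nonneg (Real.rpow_nonneg hzB.le (-n₁)) (not_lt.mp hcc)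
      simp only [hq] at qB
      linarith
    have hJB := J1neg z_B hzB
    have key : M1 z_B - J1 z_B = (n₁ * (z_B ^ n₁ * AP z_B) + n₂ * (z_B ^ n₂ * BP z_B)) / z_B := by
      simp only [hM1, hJ1, hAM, hBM]; ring
    have k2 : (n₁ * (z_B ^ n₁ * AP z_B) + n₂ * (z_B ^ n₂ * BP z_B)) / z_B < 0 := by
      refine div_neg_of_neg_of_pos ?_ hzB
      have := mul_pos (Real.rpow_pos_of_pos hzB n₂) bB
      nlinarith
    rw [M1B] at key
    linarith
  have Pn : ∀ z, z_R ≤ z → z ≤ z_B → 0 ≤ P z := by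
    intro z h1 h2
    have hz0 : 0 < z := hzR_pos.trans_le h1
    have := qneg z h1 h2
    by_contra hcc
    have h3 : q z = z ^ (-n₁) * P z := rfl
    have := mul_neg_of_pos_of_neg (Real.rpow_pos_of_pos hz0 (-n₁)) (not_le.mp hcc)
    linarith
  -- G beyond z_B
  have Gmono : ∀ z, z_B ≤ z → ut z_B + h z_B ≤ ut z + h z := by
    intro z hz
    have hz0 : 0 < z := hzB.trans_le hz
    have hgint : IntervalIntegrable g volume z_B z := by
      refine MonotoneOn.intervalIntegrable ?_
      refine gm.mono ?_
      intro x hx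
      exact lt_of_lt_of_le (lt_min hzB hz0) hx.1
    have := integral_eq_of_hasDerivAt_off_countable (fun x => ut x + h x) g (a := z_B) (b := z)
      (s := {s}) (countable_singleton s) ?_ ?_ hgint
    · have h2 : 0 ≤ ∫ x in z_B..z, g x := by
        refine intervalIntegral.integral_nonneg hz ?_
        intro x hx
        exact gB.le.trans (gm hzB (hzB.trans_le hx.1 : 0 < x) hx.1)
      linarith
    · refine HG.cont.mono ?_
      intro x hx
      exact lt_of_lt_of_le (lt_min hzB hz0) hx.1
    · intro x hx
      exact HG.der x (lt_trans (lt_min hzB hz0) hx.1.1) hx.2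
  have Janti : ∀ z, z_B ≤ z → J_R z ≤ J_R z_B := by
    intro z hz
    rcases hz.eq_or_lt with e | l
    · rw [e]
    · by_contra hcc
      obtain ⟨x, hx, hx'⟩ := mvt (f := J_R) l (fun x hx => dJ x (hzB.trans_le hx.1))
        (not_le.mp hcc)
      have := J1neg x (hzB.trans hx.1)
      linarith
  -- Q
  have Qm : ∀ z, z_R ≤ z → z ≤ z_B → Q z = M z := fun z h1 h2 => by
    rw [hQ₂ z h1 h2, hmid z (hzR_pos.trans_le h1)]
  have Qr : ∀ z, z_B ≤ z → Q z = M z_B := fun z h1 => by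
    rw [hQ₃ z h1, hmid z_B hzB]
  set Q1 : ℝ → ℝ := fun z => if z ≤ z_R then J1 z else if z ≤ z_B then M1 z else 0 with hQ1
  set Q2 : ℝ → ℝ := fun z => if z ≤ z_R then J2 z else if z ≤ z_B then M2 z else 0 with hQ2
  have Q1l : ∀ z, z ≤ z_R → Q1 z = J1 z := fun z hz => by simp only [hQ1, if_pos hz]
  have Q1m : ∀ z, z_R ≤ z → z ≤ z_B → Q1 z = M1 z := fun z h1 h2 => by
    rcases h1.eq_or_lt with e | l
    · rw [← e, M1R, Q1l _ le_rfl]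
    · simp only [hQ1, if_neg (not_le.mpr l), if_pos h2]
  have Q1r : ∀ z, z_B ≤ z → Q1 z = 0 := fun z h1 => by
    rcases h1.eq_or_lt with e | l
    · rw [← e, Q1m _ hzRB.le le_rfl, M1B]
    · simp only [hQ1, if_neg (not_le.mpr l), if_neg (not_le.mpr (hzRB.trans l))]
  have Q2l : ∀ z, z ≤ z_R → Q2 z = J2 z := fun z hz => by simp only [hQ2, if_pos hz]
  have Q2m : ∀ z, z_R < z → z ≤ z_B → Q2 z = M2 z := fun z l h2 => by
    simp only [hQ2, if_neg (not_le.mpr l), if_pos h2]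
  have Q2r : ∀ z, z_B ≤ z → Q2 z = 0 := fun z h1 => by
    rcases h1.eq_or_lt with e | l
    · rw [← e, Q2m _ hzRB le_rfl, M2B]
    · simp only [hQ2, if_neg (not_le.mpr l), if_neg (not_le.mpr (hzRB.trans l))]
  have zcont : ∀ x : ℝ, HasDerivAt (fun _ : ℝ => (0:ℝ)) 0 x := fun x => hasDerivAt_const x 0
  have D1 : ∀ z : ℝ, 0 < z → HasDerivAt Q (Q1 z) z := by
    intro z hz
    rcases lt_trichotomy z z_R with l | l | l
    · rw [Q1l z l.le]
      exact glue_der hz l (fun y h1 h2 => hQ₁ y h1 (h2.trans l.le))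
        (fun y h1 h2 => hQ₁ y (hz.trans_le h1) h2.le) (dJ z hz) (dJ z hz)
    · rw [l]
      refine glue_der hzR_pos hzRB (fun y h1 h2 => hQ₁ y h1 h2)
        (fun y h1 h2 => Qm y h1 h2.le) ?_ ?_
      · rw [Q1l _ le_rfl]; exact dJ _ hzR_pos
      · rw [Q1m _ le_rfl hzRB.le]; exact dM _ hzR_pos
    rcases lt_trichotomy z z_B with k | k | k
    · rw [Q1m z l.le k.le]
      exact glue_der l k (fun y h1 h2 => Qm y h1.le (h2.trans k.le))
        (fun y h1 h2 => Qm y (l.le.trans h1) h2.le) (dM z hz) (dM z hz)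
    · rw [k, Q1r _ le_rfl]
      refine glue_der hzRB (lt_add_one z_B) (fun y h1 h2 => Qm y h1.le h2)
        (fun y h1 h2 => Qr y h1) ?_ (hasDerivAt_const _ _)
      have := dM z_B hzB
      rwa [M1B] at this
    · rw [Q1r z k.le]
      exact glue_der k (lt_add_one z) (fun y h1 h2 => Qr y h1.le)
        (fun y h1 h2 => Qr y (k.le.trans h1)) (hasDerivAt_const _ _) (hasDerivAt_const _ _)
  have D2 : ∀ z : ℝ, 0 < z → z ≠ z_R → HasDerivAt Q1 (Q2 z) z := by
    intro z hz hne
    rcases lt_or_gt_of_ne hne with l | l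
    · rw [Q2l z l.le]
      exact glue_der hz l (fun y h1 h2 => Q1l y (h2.trans l.le))
        (fun y h1 h2 => Q1l y h2.le) (dJ1 z hz) (dJ1 z hz)
    rcases lt_trichotomy z z_B with k | k | k
    · rw [Q2m z l k.le]
      exact glue_der l k (fun y h1 h2 => Q1m y h1.le (h2.trans k.le))
        (fun y h1 h2 => Q1m y (l.le.trans h1) h2.le) (dM1 z hz) (dM1 z hz)
    · rw [k, Q2r _ le_rfl]
      refine glue_der hzRB (lt_add_one z_B) (fun y h1 h2 => Q1m y h1.le h2)
        (fun y h1 h2 => Q1r y h1) ?_ (hasDerivAt_const _ _)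
      have := dM1 z_B hzB
      rwa [M2B] at this
    · rw [Q2r z k.le]
      exact glue_der k (lt_add_one z) (fun y h1 h2 => Q1r y h1.le)
        (fun y h1 h2 => Q1r y (k.le.trans h1)) (hasDerivAt_const _ _) (hasDerivAt_const _ _)
  refine ⟨Q1, Q2, D1, ?_, D2, ?_, ?_⟩
  · intro z hz
    have hz : 0 < z := hz
    refine ContinuousAt.continuousWithinAt ?_
    by_cases hne : z = z_R
    · rw [hne]
      exact glue_cont hzR_pos hzRB (fun y h1 h2 => Q1l y h2)
        (fun y h1 h2 => Q1m y h1 h2.le) (dJ1 _ hzR_pos).continuousAt (dM1 _ hzR_pos).continuousAt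
    · exact (D2 z hz hne).continuousAt
  · rintro z ⟨hz, hne⟩
    have hz : 0 < z := hz
    have hne : z ≠ z_R := hne
    refine ContinuousAt.continuousWithinAt ?_
    rcases lt_or_gt_of_ne hne with l | l
    · exact glue_cont hz l (fun y h1 h2 => Q2l y (h2.trans l.le))
        (fun y h1 h2 => Q2l y h2.le) (cJ2 z hz) (cJ2 z hz)
    rcases lt_trichotomy z z_B with k | k | k
    · exact glue_cont l k (fun y h1 h2 => Q2m y h1 (h2.trans k.le))
        (fun y h1 h2 => Q2m y (l.trans_le h1) h2.le) (cM2 z hz) (cM2 z hz)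
    · rw [k]
      exact glue_cont hzRB (lt_add_one z_B) (fun y h1 h2 => Q2m y h1 h2)
        (fun y h1 h2 => Q2r y h1) (cM2 z_B hzB) continuousAt_const
    · exact glue_cont k (lt_add_one z) (fun y h1 h2 => Q2r y h1.le)
        (fun y h1 h2 => Q2r y (k.le.trans h1)) continuousAt_const continuousAt_const
  · intro z hz hne
    rcases lt_or_gt_of_ne hne with l | l
    · rw [Q2l z l.le, Q1l z l.le, hQ₁ z hz l.le, odeJ z hz, sub_self]
      refine max_eq_right ((min_le_left _ _).trans ?_)
      linarith [hneg z hz (l.trans hzR_lt)]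
    rcases le_total z z_B with k | k
    · rw [Q2m z l k, Q1m z l.le k, Qm z l.le k, odeM z hz, hMJP z hz]
      rw [show -(ut z + h z) + ut z + h z = 0 by ring,
        min_eq_left (by linarith [M1neg z l.le k])]
      exact max_eq_left (by linarith [Pn z l.le k])
    · rw [Q2r z k, Q1r z k, Qr z k]
      have o := odeM z_B hzB
      rw [M1B, M2B] at o
      have := Gmono z k
      rw [neg_zero, min_eq_right (by linarith)]
      refine max_eq_left ?_
      rw [hMJP z_B hzB]
      linarith [Pn z_B hzRB.le le_rfl, Janti z k]


section
variable {u u' I ut : ℝ → ℝ}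

lemma tang (hu_conc : ConcaveOn ℝ (Ici 0) u)
    (hu_deriv : ∀ c : ℝ, 0 < c → HasDerivAt u (u' c) c) {a c : ℝ} (ha : 0 < a) (hc : 0 ≤ c) :
    u c - u a ≤ u' a * (c - a) := by
  rcases lt_trichotomy c a with l | l | l
  · have := hu_conc.le_slope_of_hasDerivAt (x := c) (y := a) hc ha.le l (hu_deriv a ha)
    rw [slope_def_field, le_div_iff₀ (by linarith)] at this
    linarith
  · rw [l]; simp
  · have := hu_conc.slope_le_of_hasDerivAt (x := a) (y := c) ha.le hc l (hu_deriv a ha)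
    rw [slope_def_field, div_le_iff₀ (by linarith)] at this
    linarith

lemma ut_der (hsub : ∀ y y0, 0 < y → 0 < y0 → -I y0 * (y - y0) ≤ ut y - ut y0)
    (hI_cont : ContinuousOn I (Ioi 0)) {y : ℝ} (hy : 0 < y) : HasDerivAt ut (-I y) y := by
  rw [hasDerivAt_iff_isLittleO, Asymptotics.isLittleO_iff]
  intro e he
  have hc : ContinuousAt I y := hI_cont.continuousAt (Ioi_mem_nhds hy)
  have := Metric.tendsto_nhds.mp hc.tendsto e he
  filter_upwards [this, Ioi_mem_nhds hy] with x hx hx0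
  have hx0 : 0 < x := hx0
  have h1 := hsub x y hx0 hy
  have h2 := hsub y x hy hx0
  rw [Real.dist_eq] at hx
  have h0 : 0 ≤ ut x - ut y - (x - y) * (-I y) := by linarith
  rw [Real.norm_eq_abs, Real.norm_eq_abs, smul_eq_mul, abs_of_nonneg h0]
  have h3 : ut x - ut y - (x - y) * (-I y) ≤ -((I x - I y) * (x - y)) := by linarith
  refine h3.trans ((neg_le_abs _).trans ?_)
  rw [abs_mul]
  exact mul_le_mul_of_nonneg_right hx.le (abs_nonneg _)

lemma w_mono (hut : ∀ x, 0 < x → HasDerivAt ut (-I x) x)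
    (hutld : ∀ y : ℝ, 0 < y → ut y = u (I y) - y * I y)
    (hI_pos : ∀ y : ℝ, 0 < y → 0 < I y)
    (hu_mono : StrictMonoOn u (Set.Ici 0))
    (hI_anti : StrictAntiOn I (Set.Ioi 0)) {κ e : ℝ} (hκ : 0 < κ) (hκ1 : κ < 1) :
    StrictMonoOn (fun z => (ut (z / κ) - ut z + e * z) / z) (Ioi 0) := by
  have hd : ∀ z, 0 < z → HasDerivAt (fun z => (ut (z / κ) - ut z + e * z) / z)
      ((u (I z) - u (I (z / κ))) / z ^ 2) z := by
    intro z hz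
    have hzk : 0 < z / κ := by positivity
    have h1 : HasDerivAt (fun z => ut (z / κ)) (-I (z / κ) * (1 / κ)) z :=
      (hut (z / κ) hzk).comp z ((hasDerivAt_id z).div_const κ)
    refine (((h1.sub (hut z hz)).add ((hasDerivAt_id z).const_mul e)).div
      (hasDerivAt_id z) hz.ne').congr_deriv ?_
    simp only [Pi.add_apply, Pi.sub_apply, id]
    rw [hutld z hz, hutld _ hzk]
    field_simp
    ring
  intro x hx y hy hxy
  have hx : 0 < x := hx
  obtain ⟨t, ht, et⟩ := exists_hasDerivAt_eq_slope _ _ hxy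
    (fun t ht => (hd t (hx.trans_le ht.1)).continuousAt.continuousWithinAt)
    (fun t ht => hd t (hx.trans ht.1))
  have ht0 : 0 < t := hx.trans ht.1
  have htk : 0 < t / κ := by positivity
  have h1 : I (t / κ) < I t := hI_anti ht0 htk (by rw [lt_div_iff₀ hκ]; nlinarith)
  have h2 := hu_mono (hI_pos _ htk).le (hI_pos _ ht0).le h1
  have h3 : 0 < (u (I t) - u (I (t / κ))) / t ^ 2 := div_pos (by linarith) (by positivity)
  rw [et] at h3
  have := (div_pos_iff_of_pos_right (show 0 < y - x by linarith)).mp h3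
  simp only
  linarith

end

end QVI

/-- Q is C¹ on (0,∞), C² on (0,∞)\{z_R}, and for z > 0 with z ≠ z_R it satisfies
max{ min{ (θ²/2)z²Q″ + (δ−r)zQ′ − δQ + ũ + h, −Q′ }, J_R − Q } = 0. -/
theorem stmt_17
    (δ r θ n₁ n₂ : ℝ)
    (hδ : 0 < δ) (hr : 0 < r) (hθ : θ ≠ 0)
    (hn₂0 : n₂ < 0) (hn₁1 : 1 < n₁)
    (hroot₁ : θ ^ 2 / 2 * n₁ ^ 2 + (δ - r - θ ^ 2 / 2) * n₁ - δ = 0)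
    (hroot₂ : θ ^ 2 / 2 * n₂ ^ 2 + (δ - r - θ ^ 2 / 2) * n₂ - δ = 0)
    (u u' I utld : ℝ → ℝ)
    (hu_mono : StrictMonoOn u (Set.Ici 0))
    (hu_conc : StrictConcaveOn ℝ (Set.Ici 0) u)
    (hu_cont : ContinuousOn u (Set.Ici 0))
    (hu_deriv : ∀ c : ℝ, 0 < c → HasDerivAt u (u' c) c)
    (hu'_cont : ContinuousOn u' (Set.Ioi 0))
    (hu'_top : Filter.Tendsto u' Filter.atTop (nhds 0))
    (hu'_zero : Filter.Tendsto u' (nhdsWithin 0 (Set.Ioi 0)) Filter.atTop)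
    (hI_pos : ∀ y : ℝ, 0 < y → 0 < I y)
    (hI_left : ∀ y : ℝ, 0 < y → u' (I y) = y)
    (hI_right : ∀ c : ℝ, 0 < c → I (u' c) = c)
    (hI_anti : StrictAntiOn I (Set.Ioi 0))
    (hI_cont : ContinuousOn I (Set.Ioi 0))
    (hI_zero : Filter.Tendsto I (nhdsWithin 0 (Set.Ioi 0)) Filter.atTop)
    (hI_top : Filter.Tendsto I Filter.atTop (nhds 0))
    (hutld : ∀ y : ℝ, 0 < y → utld y = u (I y) - y * I y)
    (ε₁ ε₂ κ₁ κ₂ : ℝ)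
    (hε₂ : 0 < ε₂) (hε₁₂ : ε₂ < ε₁)
    (hκ₁ : 0 < κ₁) (hκ₁₂ : κ₁ < κ₂) (hκ₂ : κ₂ < 1)
    (z_S : ℝ) (hzS_pos : 0 < z_S)
    (hzS_zero : (1 / z_S) * (utld (z_S / κ₁) - utld (z_S / κ₂) + z_S * (ε₁ - ε₂)) = 0)
    (hzS_uniq : ∀ y : ℝ, 0 < y →
      (1 / y) * (utld (y / κ₁) - utld (y / κ₂) + y * (ε₁ - ε₂)) = 0 → y = z_S)
    (h : ℝ → ℝ)
    (hh₁ : ∀ z : ℝ, z_S < z → h z = utld (z / κ₁) - utld z + ε₁ * z)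
    (hh₂ : ∀ z : ℝ, 0 < z → z ≤ z_S → h z = utld (z / κ₂) - utld z + ε₂ * z)
    (zhat : ℝ) (hzhat_pos : 0 < zhat) (hzhat_zero : h zhat = 0)
    (hzhat_uniq : ∀ z : ℝ, 0 < z → h z = 0 → z = zhat)
    (hI_int : ∀ y : ℝ, 0 < y →
      MeasureTheory.IntegrableOn (fun η => η ^ (-n₂) * I η) (Set.Ioo 0 y) MeasureTheory.volume)
    (chat ehat : ℝ → ℝ)
    (hchat₁ : ∀ η : ℝ, z_S < η → chat η = (1 / κ₁) * I (η / κ₁))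
    (hchat₂ : ∀ η : ℝ, 0 < η → η ≤ z_S → chat η = (1 / κ₂) * I (η / κ₂))
    (hehat₁ : ∀ η : ℝ, z_S < η → ehat η = ε₁)
    (hehat₂ : ∀ η : ℝ, 0 < η → η ≤ z_S → ehat η = ε₂)
    (φ₁ φ₂ : ℝ → ℝ → ℝ)
    (hφ₁ : ∀ z₁ z₂ : ℝ, 0 < z₁ → 0 < z₂ →
      φ₁ z₁ z₂ = (∫ η in Set.Ioi z₂, η ^ (-n₁) * (ehat η - chat η)) -
        n₁ * ∫ η in Set.Ioi z₁, η ^ (-n₁ - 1) * h η)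
    (hφ₂ : ∀ z₁ z₂ : ℝ, 0 < z₁ → 0 < z₂ →
      φ₂ z₁ z₂ = (∫ η in Set.Ioo 0 z₂, η ^ (-n₂) * (ehat η - chat η)) -
        n₂ * ∫ η in Set.Ioo 0 z₁, η ^ (-n₂ - 1) * h η)
    (J_R : ℝ → ℝ)
    (hJR : ∀ y : ℝ, 0 < y → J_R y = (2 / (θ ^ 2 * (n₁ - n₂))) *
      (y ^ n₂ * (∫ η in Set.Ioo 0 y, η ^ (-n₂ - 1) * utld η) +
       y ^ n₁ * ∫ η in Set.Ioi y, η ^ (-n₁ - 1) * utld η))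
    (z_R z_B : ℝ) (hzR_pos : 0 < z_R) (hzR_lt : z_R < zhat) (hzRB : z_R < z_B)
    (hφ₁RB : φ₁ z_R z_B = 0) (hφ₂RB : φ₂ z_R z_B = 0)
    (E₁ E₂ : ℝ)
    (hE₁ : E₁ = -(2 / (θ ^ 2 * (n₁ - n₂))) * ∫ η in Set.Ioi z_R, η ^ (-n₁ - 1) * h η)
    (hE₂ : E₂ = -(2 / (θ ^ 2 * (n₁ - n₂))) * ∫ η in Set.Ioo 0 z_R, η ^ (-n₂ - 1) * h η)
    (Ψ : ℝ → ℝ)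
    (hΨ : ∀ z : ℝ, 0 < z → Ψ z = (2 / (θ ^ 2 * (n₁ - n₂))) *
      (z ^ n₂ * (∫ η in Set.Ioo 0 z, η ^ (-n₂ - 1) * h η) +
       z ^ n₁ * ∫ η in Set.Ioi z, η ^ (-n₁ - 1) * h η))
    (Q : ℝ → ℝ)
    (hQ₁ : ∀ z : ℝ, 0 < z → z ≤ z_R → Q z = J_R z)
    (hQ₂ : ∀ z : ℝ, z_R ≤ z → z ≤ z_B → Q z = E₁ * z ^ n₁ + E₂ * z ^ n₂ + Ψ z + J_R z)
    (hQ₃ : ∀ z : ℝ, z_B ≤ z → Q z = E₁ * z_B ^ n₁ + E₂ * z_B ^ n₂ + Ψ z_B + J_R z_B)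
    :
    ∃ Q' Q'' : ℝ → ℝ,
      (∀ z : ℝ, 0 < z → HasDerivAt Q (Q' z) z) ∧
      ContinuousOn Q' (Set.Ioi 0) ∧
      (∀ z : ℝ, 0 < z → z ≠ z_R → HasDerivAt Q' (Q'' z) z) ∧
      ContinuousOn Q'' (Set.Ioi 0 \ {z_R}) ∧
      ∀ z : ℝ, 0 < z → z ≠ z_R →
        max (min (θ ^ 2 / 2 * z ^ 2 * Q'' z + (δ - r) * z * Q' z - δ * Q z + utld z + h z)
            (-Q' z))
          (J_R z - Q z) = 0 := by
  have hsub : ∀ y y0, 0 < y → 0 < y0 → -I y0 * (y - y0) ≤ utld y - utld y0 := by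
    intro y y0 hy hy0
    have := QVI.tang hu_conc.concaveOn hu_deriv (hI_pos y hy) (hI_pos y0 hy0).le
    rw [hI_left y hy] at this
    rw [hutld y hy, hutld y0 hy0]
    linarith
  have hlow : ∀ y, 0 < y → u 0 ≤ utld y := by
    intro y hy
    have := QVI.tang hu_conc.concaveOn hu_deriv (hI_pos y hy) (le_refl (0:ℝ))
    rw [hI_left y hy] at this
    rw [hutld y hy]
    linarith
  have hut : ∀ x, 0 < x → HasDerivAt utld (-I x) x := fun x hx => QVI.ut_der hsub hI_cont hx
  have HU : QVI.Good n₁ n₂ z_S utld (fun x => - I x) :=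
    QVI.base hn₁1 hn₂0 hut hI_pos hI_anti.antitoneOn hI_cont hlow hI_int
  have HK : ∀ κ e : ℝ, 0 < κ → κ < 1 → QVI.Good n₁ n₂ z_S (fun x => utld (x / κ) + e * x)
      (fun x => -((1 / κ) * I (x / κ)) + e) := by
    intro κ e hκ hκ1
    have hdp : ∀ x, 0 < x → 0 < x / κ := fun x hx => div_pos hx hκ
    have hvc : ContinuousOn (fun x => (1 / κ) * I (x / κ)) (Set.Ioi 0) :=
      continuousOn_const.mul (hI_cont.comp (by fun_prop) hdp)
    refine QVI.Good.add (QVI.base (m := u 0) hn₁1 hn₂0 ?_ ?_ ?_ hvc ?_ ?_)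
      (QVI.Good.lin hn₁1 hn₂0 e)
    · intro x hx
      have := (hut (x / κ) (hdp x hx)).comp x ((hasDerivAt_id x).div_const κ)
      exact this.congr_deriv (by ring)
    · intro x hx
      exact mul_pos (by positivity) (hI_pos _ (hdp x hx))
    · intro x hx y hy hxy
      exact mul_le_mul_of_nonneg_left (hI_anti.antitoneOn (hdp x hx) (hdp y hy)
        (div_le_div_of_nonneg_right hxy hκ.le)) (by positivity)
    · intro x hx
      exact hlow _ (hdp x hx)
    · intro y hy
      refine MeasureTheory.Integrable.mono' ((hI_int y hy).const_mul (1 / κ)) ?_ ?_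
      · exact (((QVI.rpow_cont (-n₂)).mul hvc).mono (fun x hx => hx.1)).aestronglyMeasurable
          measurableSet_Ioo
      · refine (ae_restrict_mem measurableSet_Ioo).mono ?_
        intro x hx
        have hx0 : 0 < x := hx.1
        have a1 := Real.rpow_pos_of_pos hx0 (-n₂)
        have a2 := hI_pos _ (hdp x hx0)
        have a3 : I (x / κ) ≤ I x := hI_anti.antitoneOn hx0 (hdp x hx0) (by
          rw [le_div_iff₀ hκ]; nlinarith)
        have a4 : 0 < 1 / κ := by positivity
        rw [Real.norm_eq_abs, abs_of_pos (by positivity)]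
        calc x ^ (-n₂) * (1 / κ * I (x / κ)) = 1 / κ * (x ^ (-n₂) * I (x / κ)) := by ring
          _ ≤ 1 / κ * (x ^ (-n₂) * I x) := by gcongr
  have hκ₂0 : 0 < κ₂ := hκ₁.trans hκ₁₂
  have hκ₁1 : κ₁ < 1 := hκ₁₂.trans hκ₂
  have hS : utld (z_S / κ₁) - utld (z_S / κ₂) + z_S * (ε₁ - ε₂) = 0 := by
    rcases mul_eq_zero.mp hzS_zero with e | e
    · exact absurd e (by positivity)
    · exact e
  have HG : QVI.Good n₁ n₂ z_S (fun x => utld x + h x) (fun x => ehat x - chat x) := by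
    refine QVI.Good.pw hzS_pos (HK κ₁ ε₁ hκ₁ hκ₁1) (HK κ₂ ε₂ hκ₂0 hκ₂) ?_ ?_ ?_ ?_ ?_
    · intro x hx
      simp only [hh₁ x hx]; ring
    · intro x hx hx'
      simp only [hh₂ x hx hx']; ring
    · intro x hx
      simp only [hehat₁ x hx, hchat₁ x hx]; ring
    · intro x hx hx'
      simp only [hehat₂ x hx hx', hchat₂ x hx hx']; ring
    · linarith
  have kI : ∀ κ x y : ℝ, 0 < κ → 0 < x → x ≤ y → 1 / κ * I (y / κ) ≤ 1 / κ * I (x / κ) := by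
    intro κ x y hκ hx hxy
    exact mul_le_mul_of_nonneg_left (hI_anti.antitoneOn (div_pos hx hκ : 0 < x / κ)
      (div_pos (hx.trans_le hxy) hκ : 0 < y / κ)
      (div_le_div_of_nonneg_right hxy hκ.le)) (by positivity)
  have jump : ε₂ - 1 / κ₂ * I (z_S / κ₂) ≤ ε₁ - 1 / κ₁ * I (z_S / κ₁) := by
    have p1 : 0 < z_S / κ₁ := by positivity
    have p2 : 0 < z_S / κ₂ := by positivity
    have p12 : z_S / κ₂ < z_S / κ₁ := div_lt_div_of_pos_left hzS_pos hκ₁ hκ₁₂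
    have a := hsub (z_S / κ₂) (z_S / κ₁) p2 p1
    have b : I (z_S / κ₁) < I (z_S / κ₂) := hI_anti p2 p1 p12
    have b' := mul_lt_mul_of_pos_right b p2
    have : z_S * (ε₂ - 1 / κ₂ * I (z_S / κ₂)) ≤ z_S * (ε₁ - 1 / κ₁ * I (z_S / κ₁)) := by
      have e1 : z_S * (ε₂ - 1 / κ₂ * I (z_S / κ₂)) = z_S * ε₂ - I (z_S / κ₂) * (z_S / κ₂) := by ring
      have e2 : z_S * (ε₁ - 1 / κ₁ * I (z_S / κ₁)) = z_S * ε₁ - I (z_S / κ₁) * (z_S / κ₁) := by ring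
      rw [e1, e2]
      linarith
    exact le_of_mul_le_mul_left this hzS_pos
  have gm : MonotoneOn (fun x => ehat x - chat x) (Set.Ioi 0) := by
    intro x hx y hy hxy
    have hx : 0 < x := hx
    have hy : 0 < y := hy
    simp only
    rcases le_or_gt y z_S with l | l
    · rw [hehat₂ x hx (hxy.trans l), hchat₂ x hx (hxy.trans l), hehat₂ y hy l, hchat₂ y hy l]
      linarith [kI κ₂ x y hκ₂0 hx hxy]
    · rw [hehat₁ y l, hchat₁ y l]
      rcases le_or_gt x z_S with k | k
      · rw [hehat₂ x hx k, hchat₂ x hx k]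
        linarith [kI κ₂ x z_S hκ₂0 hx k, kI κ₁ z_S y hκ₁ hzS_pos l.le]
      · rw [hehat₁ x k, hchat₁ x k]
        linarith [kI κ₁ x y hκ₁ hx hxy]
  have w1 := QVI.w_mono (e := ε₁) hut hutld hI_pos hu_mono hI_anti hκ₁ hκ₁1
  have w2 := QVI.w_mono (e := ε₂) hut hutld hI_pos hu_mono hI_anti hκ₂0 hκ₂
  have hh₁' : ∀ z, z_S ≤ z → h z = utld (z / κ₁) - utld z + ε₁ * z := by
    intro z hz
    rcases hz.eq_or_lt with e | l
    · rw [← e, hh₂ z_S hzS_pos le_rfl]; linarith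
    · exact hh₁ z l
  have hmono : ∀ x y, 0 < x → x < y → h x / x < h y / y := by
    intro x y hx hxy
    have hy : 0 < y := hx.trans hxy
    rcases le_total y z_S with l | l
    · rw [hh₂ x hx (hxy.le.trans l), hh₂ y hy l]
      exact w2 hx hy hxy
    · rcases le_total z_S x with k | k
      · rw [hh₁' x k, hh₁' y l]
        exact w1 hx hy hxy
      · have a1 : h x / x ≤ h z_S / z_S := by
          rw [hh₂ x hx k, hh₂ z_S hzS_pos le_rfl]
          exact w2.monotoneOn hx hzS_pos k
        have a2 : h z_S / z_S ≤ h y / y := by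
          rw [hh₁' z_S le_rfl, hh₁' y l]
          exact w1.monotoneOn hzS_pos hy l
        rcases k.eq_or_lt with e | k
        · subst e
          rw [hh₁' x le_rfl, hh₁' y l]
          exact w1 hx hy hxy
        · refine lt_of_lt_of_le ?_ a2
          rw [hh₂ x hx k.le, hh₂ z_S hzS_pos le_rfl]
          exact w2 hx hzS_pos k
  have hneg : ∀ x, 0 < x → x < zhat → h x < 0 := by
    intro x hx hxz
    have := hmono x zhat hx hxz
    rw [hzhat_zero, zero_div] at this
    by_contra hcc
    have := div_nonneg (not_lt.mp hcc) hx.le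
    linarith
  have hpos : ∀ x, zhat < x → 0 < h x := by
    intro x hxz
    have := hmono zhat x hzhat_pos hxz
    rw [hzhat_zero, zero_div] at this
    by_contra hcc
    have := div_nonpos_of_nonpos_of_nonneg (not_lt.mp hcc) (hzhat_pos.trans hxz).le
    linarith
  have hzB_pos : 0 < z_B := hzR_pos.trans hzRB
  rw [hφ₁ _ _ hzR_pos hzB_pos] at hφ₁RB
  rw [hφ₂ _ _ hzR_pos hzB_pos] at hφ₂RB
  exact QVI.core hθ hδ hn₂0 hn₁1 hroot₁ hroot₂ rfl HU hI_pos HG gm hneg hpos hzhat_zero hJR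
    hzR_pos hzR_lt hzRB hφ₁RB hφ₂RB hE₁ hE₂ hΨ hQ₁ hQ₂ hQ₃
end
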